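/- arXiv:2312.06124 — 2 statements merged into one kernel-verified Lean document; each statement's English description precedes it below -/
import Mathlib

section
/- Let R be a Cohen-Macaulay local ring of dimension d ≥ 2 and M a finitely generated R-module with G-dim_R(M) < n for some integer 1 ≤ n ≤ d−1. Suppose M_p has finite projective dimension over R_p for every prime p of height at most n, and Ext^i_R(M,M) = 0 for all n ≤ i ≤ d−1. Then M has finite projective dimension. -/
open CategoryTheory Opposite

universe u

noncomputable section

/-- The Ext module `Ext^i_R(M,N)`. -/
def ExtMod (R : Type u) [CommRing R] (M N : ModuleCat.{u} R) (i : ℕ) : ModuleCat.{u} R :=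
  ((Ext R (ModuleCat.{u} R) i).obj (op M)).obj N

/-- The Tor module `Tor_i^R(M,N)`. -/
def TorMod (R : Type u) [CommRing R] (M N : ModuleCat.{u} R) (i : ℕ) : ModuleCat.{u} R :=
  ((Tor (ModuleCat.{u} R) i).obj M).obj N

/-- The depth of a module over a local ring, as the least `i` with
`Ext^i(k, M) ≠ 0`. -/
def moduleDepth (R : Type u) [CommRing R] [IsLocalRing R] (M : ModuleCat.{u} R) : ℕ∞ :=
  sInf {i : ℕ∞ | ∃ n : ℕ, i = n ∧
    Nontrivial (ExtMod R (ModuleCat.of R (IsLocalRing.ResidueField R)) M n)}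

/-- A Cohen-Macaulay local ring of dimension `d`. -/
def IsCMLocalOfDim (R : Type u) [CommRing R] [IsLocalRing R] [IsNoetherianRing R] (d : ℕ) : Prop :=
  ringKrullDim R = d ∧ moduleDepth R (ModuleCat.of R R) = d

/-- Totally reflexive modules. -/
def TotallyReflexive (R : Type u) [CommRing R] (M : Type u) [AddCommGroup M] [Module R M] : Prop :=
  Function.Bijective (Module.Dual.eval R M) ∧
  ∀ i : ℕ, 1 ≤ i →
    Subsingleton (ExtMod R (ModuleCat.of R M) (ModuleCat.of R R) i) ∧
    Subsingleton (ExtMod R (ModuleCat.of R (Module.Dual R M)) (ModuleCat.of R R) i)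

/-- `GdimLE R n M` : the Gorenstein dimension of `M` is at most `n`. -/
def GdimLE (R : Type u) [CommRing R] : ℕ → ModuleCat.{u} R → Prop
  | 0, M => TotallyReflexive R M
  | (n+1), M => ∃ (G : ModuleCat.{u} R) (g : G →ₗ[R] M), Module.Finite R G ∧
      TotallyReflexive R G ∧ Function.Surjective g ∧
      GdimLE R n (ModuleCat.of R (LinearMap.ker g))

/-- Finite Gorenstein dimension. -/
def FiniteGdim (R : Type u) [CommRing R] (M : Type u) [AddCommGroup M] [Module R M] : Prop :=
  ∃ n, GdimLE R n (ModuleCat.of R M)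

/-- `PdLE R n M` : the projective dimension of `M` is at most `n`. -/
def PdLE (R : Type u) [CommRing R] : ℕ → ModuleCat.{u} R → Prop
  | 0, M => Module.Projective R M
  | (n+1), M => ∃ (G : ModuleCat.{u} R) (g : G →ₗ[R] M), Module.Projective R G ∧
      Function.Surjective g ∧ PdLE R n (ModuleCat.of R (LinearMap.ker g))

/-- Finite projective dimension. -/
def FinitePd (R : Type u) [CommRing R] (M : Type u) [AddCommGroup M] [Module R M] : Prop :=
  ∃ n, PdLE R n (ModuleCat.of R M)

/-- A semidualizing module. -/
def Semidualizing (R : Type u) [CommRing R] (C : Type u) [AddCommGroup C] [Module R C] : Prop :=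
  Module.Finite R C ∧
  Function.Bijective (LinearMap.toSpanSingleton R (C →ₗ[R] C) LinearMap.id) ∧
  ∀ i : ℕ, 1 ≤ i → Subsingleton (ExtMod R (ModuleCat.of R C) (ModuleCat.of R C) i)

/-- Membership in the Auslander class with respect to `C`. -/
def InAuslanderClass (R : Type u) [CommRing R] (C : Type u) [AddCommGroup C] [Module R C]
    (X : Type u) [AddCommGroup X] [Module R X] : Prop :=
  Function.Bijective ((TensorProduct.mk R C X).flip) ∧
  (∀ i : ℕ, 1 ≤ i → Subsingleton (TorMod R (ModuleCat.of R C) (ModuleCat.of R X) i)) ∧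
  (∀ i : ℕ, 1 ≤ i →
    Subsingleton (ExtMod R (ModuleCat.of R C) (ModuleCat.of R (TensorProduct R C X)) i))

/-- Height of a prime ideal. -/
def primeHt (R : Type u) [CommRing R] (p : Ideal R) (hp : p.IsPrime) : ℕ∞ :=
  Order.height (⟨p, hp⟩ : PrimeSpectrum R)

/-- Finite injective dimension, via vanishing of `Ext` in high degrees. -/
def FiniteInjDim (R : Type u) [CommRing R] (M : Type u) [AddCommGroup M] [Module R M] : Prop :=
  ∃ n : ℕ, ∀ (N : ModuleCat.{u} R) (i : ℕ), n < i →
    Subsingleton (ExtMod R N (ModuleCat.of R M) i)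

/-- A canonical (dualizing) module over a Cohen-Macaulay local ring:
a semidualizing module of finite injective dimension. -/
def IsCanonicalModule (R : Type u) [CommRing R] (w : Type u) [AddCommGroup w] [Module R w] : Prop :=
  Semidualizing R w ∧ FiniteInjDim R w

end

noncomputable section


/-- vanishing of Ext in terms of the derived-category Ext. -/
def EV (R : Type u) [CommRing R] (M N : Type u) [AddCommGroup M] [Module R M]
    [AddCommGroup N] [Module R N] (i : ℕ) : Prop :=
  Subsingleton (Abelian.Ext.{u} (ModuleCat.of R M) (ModuleCat.of R N) i)

theorem ext_cmp (R : Type u) [CommRing R] (M N : ModuleCat.{u} R) (i : ℕ) :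
    Subsingleton (ExtMod R M N i) ↔ Subsingleton (Abelian.Ext.{u} M N i) := by
  let P := projectiveResolution M
  have h1 : Subsingleton (ExtMod R M N i) ↔
      (P.complex.linearYonedaObj R N).ExactAt i := by
    rw [HomologicalComplex.exactAt_iff_isZero_homology]
    rw [← ModuleCat.isZero_iff_subsingleton]
    exact (P.isoExt (R := R) i N).isZero_iff
  rw [h1]
  cases i with
  | zero => 
    rw [Abelian.Ext.addEquiv₀.subsingleton_congr]
    rw [HomologicalComplex.exactAt_iff' _ 0 0 1 (by simp) (by simp)]
    rw [ShortComplex.moduleCat_exact_iff]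
    have hd : P.complex.d 0 0 = 0 := P.complex.shape _ _ (by simp)
    constructor
    · intro h
      suffices ∀ a : M ⟶ N, a = 0 from ⟨fun a b => by rw [this a, this b]⟩
      intro a
      obtain ⟨π0, hπ0⟩ : ∃ π0 : P.complex.X 0 ⟶ M, π0 = P.π.f 0 := ⟨P.π.f 0, rfl⟩
      have hepi : Epi π0 := by rw [hπ0]; exact inferInstanceAs (Epi (P.π.f 0))
      have h10 : P.complex.d 1 0 ≫ π0 = 0 := by
        rw [hπ0]; exact P.complex_d_comp_π_f_zero
      have key : P.complex.d 1 0 ≫ (π0 ≫ a) = 0 := by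
        rw [← Category.assoc, h10, Limits.zero_comp]
      obtain ⟨g, hg⟩ := h (π0 ≫ a) key
      obtain ⟨g', hg'⟩ : ∃ g' : P.complex.X 0 ⟶ N, P.complex.d 0 0 ≫ g' = π0 ≫ a := ⟨g, hg⟩
      rw [hd, Limits.zero_comp] at hg'
      rw [← cancel_epi π0, ← hg', Limits.comp_zero]
    · intro h f hf
      have hf' : P.complex.d 1 0 ≫ f = 0 := hf
      refine ⟨0, ?_⟩
      have e := P.exact₀
      have : f = P.π.f 0 ≫ e.desc f hf' := (e.g_desc f hf').symm
      rw [map_zero, this, show e.desc f hf' = 0 from Subsingleton.elim (α := M ⟶ N) _ _]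
      exact (Limits.comp_zero).symm
  | succ p =>
    rw [HomologicalComplex.exactAt_iff' _ p (p+1) (p+1+1) (by simp) (by simp)]
    rw [ShortComplex.moduleCat_exact_iff]
    constructor
    · intro h
      refine ⟨fun a b => ?_⟩
      suffices ∀ a : Abelian.Ext.{u} M N (p+1), a = 0 by rw [this a, this b]
      intro a
      obtain ⟨f, hf, rfl⟩ := P.extMk_surjective a (p+1+1) rfl
      rw [P.extMk_eq_zero_iff f _ rfl hf p rfl]
      exact h f hf
    · intro h f hf
      exact (P.extMk_eq_zero_iff f (p+1+1) rfl hf p rfl).1 (Subsingleton.elim _ _)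

section LES
variable {R : Type u} [CommRing R] {A B C X Y : Type u}
  [AddCommGroup A] [Module R A] [AddCommGroup B] [Module R B] [AddCommGroup C] [Module R C]
  [AddCommGroup X] [Module R X] [AddCommGroup Y] [Module R Y]

theorem EV_iff (i : ℕ) : EV R X Y i ↔
    Subsingleton (ExtMod R (ModuleCat.of R X) (ModuleCat.of R Y) i) :=
  (ext_cmp R _ _ i).symm

theorem EV_of_forall {i : ℕ}
    (h : ∀ e : Abelian.Ext.{u} (ModuleCat.of R X) (ModuleCat.of R Y) i, e = 0) : EV R X Y i :=
  ⟨fun a b => by rw [h a, h b]⟩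

theorem EV.elim {i : ℕ} (h : EV R X Y i)
    (e : Abelian.Ext.{u} (ModuleCat.of R X) (ModuleCat.of R Y) i) : e = 0 := by
  have : Subsingleton (Abelian.Ext.{u} (ModuleCat.of R X) (ModuleCat.of R Y) i) := h
  exact Subsingleton.elim _ _

/-- the short complex of a pair of linear maps -/
abbrev sc (f : A →ₗ[R] B) (g : B →ₗ[R] C) (h : Function.Exact f g) :
    ShortComplex (ModuleCat.{u} R) :=
  ShortComplex.mk (ModuleCat.ofHom f) (ModuleCat.ofHom g)
    (by ext x; exact h.apply_apply_eq_zero x)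

theorem sc_shortExact {f : A →ₗ[R] B} {g : B →ₗ[R] C} (hf : Function.Injective f)
    (h : Function.Exact f g) (hg : Function.Surjective g) : (sc f g h).ShortExact where
  exact := by
    rw [ShortComplex.moduleCat_exact_iff]
    intro x hx
    exact (h x).1 hx
  mono_f := (ModuleCat.mono_iff_injective _).2 hf
  epi_g := (ModuleCat.epi_iff_surjective _).2 hg


theorem EV.left {f : A →ₗ[R] B} {g : B →ₗ[R] C} (hf : Function.Injective f)
    (h : Function.Exact f g) (hg : Function.Surjective g) {i : ℕ} (hB : EV R B Y i) (hC : EV R C Y (i+1)) : EV R A Y i := by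
  refine EV_of_forall fun e => ?_
  obtain ⟨e', rfl⟩ := Abelian.Ext.contravariant_sequence_exact₁ (sc_shortExact hf h hg)
    (ModuleCat.of R Y) e (add_comm 1 i) (hC.elim _)
  rw [hB.elim e']; simp

theorem EV.right {f : A →ₗ[R] B} {g : B →ₗ[R] C} (hf : Function.Injective f)
    (h : Function.Exact f g) (hg : Function.Surjective g) {i : ℕ} (hA : EV R A Y i) (hB : EV R B Y (i+1)) : EV R C Y (i+1) := by
  refine EV_of_forall fun e => ?_
  obtain ⟨e', rfl⟩ := Abelian.Ext.contravariant_sequence_exact₃ (sc_shortExact hf h hg)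
    (ModuleCat.of R Y) e (hB.elim _) (add_comm 1 i)
  rw [hA.elim e']; simp

theorem EV.mid {f : A →ₗ[R] B} {g : B →ₗ[R] C} (hf : Function.Injective f)
    (h : Function.Exact f g) (hg : Function.Surjective g) {i : ℕ} (hA : EV R A Y i) (hC : EV R C Y i) : EV R B Y i := by
  refine EV_of_forall fun e => ?_
  obtain ⟨e', rfl⟩ := Abelian.Ext.contravariant_sequence_exact₂ (sc_shortExact hf h hg)
    (ModuleCat.of R Y) e (hA.elim _)
  rw [hC.elim e']; simp

theorem EV.extend {f : A →ₗ[R] B} {g : B →ₗ[R] C} (hf : Function.Injective f)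
    (h : Function.Exact f g) (hg : Function.Surjective g) (hC : EV R C Y 1) (φ : A →ₗ[R] Y) : ∃ ψ : B →ₗ[R] Y, ψ ∘ₗ f = φ := by
  obtain ⟨e', he⟩ := Abelian.Ext.contravariant_sequence_exact₁ (sc_shortExact hf h hg)
    (ModuleCat.of R Y) (Abelian.Ext.mk₀ (ModuleCat.ofHom φ)) (add_comm 1 0) (hC.elim _)
  obtain ⟨ψ, rfl⟩ := Abelian.Ext.homEquiv₀.symm.surjective e'
  have : Abelian.Ext.mk₀ (ModuleCat.ofHom f ≫ ψ) = Abelian.Ext.mk₀ (ModuleCat.ofHom φ) := by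
    rw [← he]; simp
  have h2 := Abelian.Ext.homEquiv₀.symm.injective this
  refine ⟨ψ.hom, ?_⟩
  have := congrArg ModuleCat.Hom.hom h2
  simpa using this

theorem EV.of_extend {f : A →ₗ[R] B} {g : B →ₗ[R] C} (hf : Function.Injective f)
    (h : Function.Exact f g) (hg : Function.Surjective g) (hB : EV R B Y 1) (H : ∀ φ : A →ₗ[R] Y, ∃ ψ : B →ₗ[R] Y, ψ ∘ₗ f = φ) :
    EV R C Y 1 := by
  refine EV_of_forall fun e => ?_
  obtain ⟨e', rfl⟩ := Abelian.Ext.contravariant_sequence_exact₃ (sc_shortExact hf h hg)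
    (ModuleCat.of R Y) e (hB.elim _) (add_comm 1 0)
  obtain ⟨φ, rfl⟩ := Abelian.Ext.homEquiv₀.symm.surjective e'
  obtain ⟨ψ, hψ⟩ := H φ.hom
  have : φ = ModuleCat.ofHom f ≫ ModuleCat.ofHom ψ := by
    ext x
    exact (LinearMap.congr_fun hψ x).symm
  subst this
  have h0 : (sc_shortExact hf h hg).extClass.comp
    (Abelian.Ext.mk₀ (ModuleCat.ofHom f)) (add_zero 1) = 0 := 
      (sc_shortExact hf h hg).extClass_comp
  rw [Abelian.Ext.homEquiv₀_symm_apply, ← Abelian.Ext.mk₀_comp_mk₀,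
    ← Abelian.Ext.comp_assoc (a₁₂ := 1) (a₂₃ := 0), h0, Abelian.Ext.zero_comp] <;> rfl

theorem EV.cov_right {f : A →ₗ[R] B} {g : B →ₗ[R] C} (hf : Function.Injective f)
    (h : Function.Exact f g) (hg : Function.Surjective g) {i : ℕ} (hB : EV R X B i) (hA : EV R X A (i+1)) : EV R X C i := by
  refine EV_of_forall fun e => ?_
  obtain ⟨e', rfl⟩ := Abelian.Ext.covariant_sequence_exact₃ (ModuleCat.of R X)
    (sc_shortExact hf h hg) e rfl (hA.elim _)
  rw [hB.elim e']; simp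

theorem EV.cov_left {f : A →ₗ[R] B} {g : B →ₗ[R] C} (hf : Function.Injective f)
    (h : Function.Exact f g) (hg : Function.Surjective g) {i : ℕ} (hC : EV R X C i) (hB : EV R X B (i+1)) : EV R X A (i+1) := by
  refine EV_of_forall fun e => ?_
  obtain ⟨e', rfl⟩ := Abelian.Ext.covariant_sequence_exact₁ (ModuleCat.of R X)
    (sc_shortExact hf h hg) e (hB.elim _) rfl
  rw [hC.elim e']; simp


theorem EV.of_projective [Module.Projective R X] (i : ℕ) : EV R X Y (i+1) := by
  have : Projective (ModuleCat.of R X) := (IsProjective.iff_projective _).1 inferInstance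
  exact EV_of_forall fun e => Abelian.Ext.eq_zero_of_projective e

end LES

end


noncomputable section


section Step1
variable {R : Type u} [CommRing R] {A B C X X' Y Y' Z : Type u}
  [AddCommGroup A] [Module R A] [AddCommGroup B] [Module R B] [AddCommGroup C] [Module R C]
  [AddCommGroup X] [Module R X] [AddCommGroup Y] [Module R Y]
  [AddCommGroup X'] [Module R X'] [AddCommGroup Y'] [Module R Y'] [AddCommGroup Z] [Module R Z]

theorem EV.congr_left (e : X ≃ₗ[R] X') {i : ℕ} (h : EV R X Y i) : EV R X' Y i := by
  refine EV_of_forall fun t => ?_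
  have h1 : ModuleCat.ofHom e.symm.toLinearMap ≫ ModuleCat.ofHom e.toLinearMap
      = 𝟙 (ModuleCat.of R X') := by
    ext x; simp
  have h2 : (Abelian.Ext.mk₀ (ModuleCat.ofHom e.symm.toLinearMap)).comp
      ((Abelian.Ext.mk₀ (ModuleCat.ofHom e.toLinearMap)).comp t (zero_add i)) (zero_add i) = t := by
    rw [Abelian.Ext.mk₀_comp_mk₀_assoc, h1, Abelian.Ext.mk₀_id_comp]
  rw [← h2, h.elim ((Abelian.Ext.mk₀ (ModuleCat.ofHom e.toLinearMap)).comp t (zero_add i)),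
    Abelian.Ext.comp_zero]

theorem EV.congr_right (e : Y ≃ₗ[R] Y') {i : ℕ} (h : EV R X Y i) : EV R X Y' i := by
  refine EV_of_forall fun t => ?_
  have h1 : ModuleCat.ofHom e.symm.toLinearMap ≫ ModuleCat.ofHom e.toLinearMap
      = 𝟙 (ModuleCat.of R Y') := by
    ext x; simp
  have h2 : (t.comp (Abelian.Ext.mk₀ (ModuleCat.ofHom e.symm.toLinearMap)) (add_zero i)).comp
      ((Abelian.Ext.mk₀ (ModuleCat.ofHom e.toLinearMap))) (add_zero i) = t := by
    rw [Abelian.Ext.comp_assoc_of_third_deg_zero, Abelian.Ext.mk₀_comp_mk₀, h1,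
      Abelian.Ext.comp_mk₀_id]
  rw [← h2, h.elim (t.comp (Abelian.Ext.mk₀ (ModuleCat.ofHom e.symm.toLinearMap)) (add_zero i)),
    Abelian.Ext.zero_comp]

theorem EV.cov_mid {f : A →ₗ[R] B} {g : B →ₗ[R] C} (hf : Function.Injective f)
    (h : Function.Exact f g) (hg : Function.Surjective g)
    {i : ℕ} (hA : EV R X A i) (hC : EV R X C i) : EV R X B i := by
  refine EV_of_forall fun e => ?_
  obtain ⟨e', rfl⟩ := Abelian.Ext.covariant_sequence_exact₂ (ModuleCat.of R X)
    (sc_shortExact hf h hg) e (hC.elim _)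
  rw [hA.elim e']; simp

theorem exact_inl_snd : Function.Exact (LinearMap.inl R A B) (LinearMap.snd R A B) := by
  rintro ⟨a, b⟩
  constructor
  · intro h; exact ⟨a, by simp at h; simp [h]⟩
  · rintro ⟨c, hc⟩; rw [← hc]; simp

theorem EV.prod_left {i : ℕ} (hA : EV R A Y i) (hB : EV R B Y i) : EV R (A × B) Y i :=
  EV.mid (LinearMap.inl_injective) exact_inl_snd (LinearMap.snd_surjective) hA hB

theorem EV.prod_right {i : ℕ} (hA : EV R X A i) (hB : EV R X B i) : EV R X (A × B) i :=
  EV.cov_mid (LinearMap.inl_injective) exact_inl_snd (LinearMap.snd_surjective) hA hB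

theorem EV.of_subsingleton_right [Subsingleton Y] (i : ℕ) : EV R X Y i := by
  refine EV_of_forall fun t => ?_
  have h1 : 𝟙 (ModuleCat.of R Y) = 0 := by
    ext x; exact Subsingleton.elim (α := Y) _ _
  rw [← Abelian.Ext.comp_mk₀_id t, h1]; simp

theorem EV.pi_right {i : ℕ} (h : EV R X Y i) (n : ℕ) : EV R X (Fin n → Y) i := by
  induction n with
  | zero => exact EV.of_subsingleton_right i
  | succ n ih =>
    exact (EV.prod_right h ih).congr_right (Fin.consLinearEquiv R (fun _ => Y))

/-- multiplication by `r` factors through a f.g. projective module -/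
def FacProj (R : Type u) [CommRing R] (X : Type u) [AddCommGroup X] [Module R X] (r : R) : Prop :=
  ∃ (P : Type u) (_ : AddCommGroup P) (_ : Module R P) (_ : Module.Finite R P)
    (_ : Module.Projective R P) (a : X →ₗ[R] P) (b : P →ₗ[R] X), b ∘ₗ a = r • LinearMap.id

/-- the ideal of elements such that multiplication factors through a projective -/
def II (R : Type u) [CommRing R] (X : Type u) [AddCommGroup X] [Module R X] : Ideal R where
  carrier := {r | FacProj R X r}
  zero_mem' := ⟨PUnit, inferInstance, inferInstance, inferInstance, inferInstance, 0, 0, by simp⟩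
  add_mem' := by
    rintro r s ⟨P, _, _, _, _, a, b, h⟩ ⟨Q, _, _, _, _, c, d, h'⟩
    refine ⟨P × Q, inferInstance, inferInstance, inferInstance, inferInstance,
      a.prod c, b.coprod d, ?_⟩
    rw [LinearMap.coprod_comp_prod, h, h', add_smul]
  smul_mem' := by
    rintro s r ⟨P, _, _, _, _, a, b, h⟩
    refine ⟨P, inferInstance, inferInstance, inferInstance, inferInstance, a, s • b, ?_⟩
    rw [LinearMap.smul_comp, h, smul_smul]; rfl

theorem mem_II {r : R} : r ∈ II R X ↔ FacProj R X r := Iff.rfl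

theorem mem_II_fin {r : R} (h : r ∈ II R X) : ∃ (n : ℕ) (a : X →ₗ[R] (Fin n → R))
    (b : (Fin n → R) →ₗ[R] X), b ∘ₗ a = r • LinearMap.id := by
  obtain ⟨P, _, _, _, _, a, b, h⟩ := h
  obtain ⟨n, f, g, -, -, hfg⟩ := Module.Finite.exists_comp_eq_id_of_projective R P
  refine ⟨n, g ∘ₗ a, b ∘ₗ f, ?_⟩
  rw [← h]
  ext x
  have := LinearMap.congr_fun hfg (a x)
  simp at this
  simp [this]

/-- Step 1 -/
theorem EV.of_II {x : R} (hx : x ∈ II R X)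
    (hZ : Function.Bijective (fun z : Z => x • z)) (i : ℕ) : EV R X Z (i+1) := by
  refine EV_of_forall fun e => ?_
  obtain ⟨P, _, _, _, _, a, b, h⟩ := hx
  let u : Z ≃ₗ[R] Z := LinearEquiv.ofBijective (LinearMap.lsmul R Z x) hZ
  have h1 : ModuleCat.ofHom u.symm.toLinearMap ≫ (x • 𝟙 (ModuleCat.of R Z))
      = 𝟙 (ModuleCat.of R Z) := by
    ext z
    exact u.apply_symm_apply z
  have h2 : (e.comp (Abelian.Ext.mk₀ (ModuleCat.ofHom u.symm.toLinearMap)) (add_zero _)).comp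
      (Abelian.Ext.mk₀ (x • 𝟙 (ModuleCat.of R Z))) (add_zero _) = e := by
    rw [Abelian.Ext.comp_assoc_of_third_deg_zero, Abelian.Ext.mk₀_comp_mk₀, h1,
      Abelian.Ext.comp_mk₀_id]
  generalize (e.comp (Abelian.Ext.mk₀ (ModuleCat.ofHom u.symm.toLinearMap)) (add_zero _)) = e' at h2
  rw [← h2, Abelian.Ext.mk₀_smul, Abelian.Ext.comp_smul, Abelian.Ext.comp_mk₀_id]
  have h3 : x • e' = (Abelian.Ext.mk₀ (x • 𝟙 (ModuleCat.of R X))).comp e' (zero_add _) := by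
    rw [Abelian.Ext.mk₀_smul, Abelian.Ext.smul_comp, Abelian.Ext.mk₀_id_comp]
  have h4 : x • 𝟙 (ModuleCat.of R X) = ModuleCat.ofHom a ≫ ModuleCat.ofHom b := by
    ext z
    exact (LinearMap.congr_fun h z).symm
  rw [h3, h4, ← Abelian.Ext.mk₀_comp_mk₀_assoc,
    (EV.of_projective (R := R) (X := P) (Y := Z) i).elim
      ((Abelian.Ext.mk₀ (ModuleCat.ofHom b)).comp e' (zero_add _)), Abelian.Ext.comp_zero]

end Step1

section TRsec
variable {R : Type u} [CommRing R] {A B C X X' Y Y' Z : Type u}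
  [AddCommGroup A] [Module R A] [AddCommGroup B] [Module R B] [AddCommGroup C] [Module R C]
  [AddCommGroup X] [Module R X] [AddCommGroup Y] [Module R Y]
  [AddCommGroup X'] [Module R X'] [AddCommGroup Y'] [Module R Y'] [AddCommGroup Z] [Module R Z]

/-- f.g. totally reflexive -/
structure TR (R : Type u) [CommRing R] (G : Type u) [AddCommGroup G] [Module R G] : Prop where
  fin : Module.Finite R G
  refl : Function.Bijective (Module.Dual.eval R G)
  ev : ∀ i : ℕ, EV R G R (i+1)
  evd : ∀ i : ℕ, EV R (Module.Dual R G) R (i+1)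

theorem TR_iff [Module.Finite R X] : TR R X ↔ TotallyReflexive R X := by
  constructor
  · intro h
    refine ⟨h.refl, fun i hi => ?_⟩
    obtain ⟨j, rfl⟩ : ∃ j, i = j + 1 := ⟨i - 1, by omega⟩
    exact ⟨(EV_iff _).1 (h.ev j), (EV_iff _).1 (h.evd j)⟩
  · rintro ⟨h1, h2⟩
    exact ⟨inferInstance, h1, fun i => (EV_iff _).2 (h2 (i+1) (by omega)).1,
      fun i => (EV_iff _).2 (h2 (i+1) (by omega)).2⟩

theorem TR.congr (e : X ≃ₗ[R] X') (h : TR R X) : TR R X' := by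
  have := h.fin
  have h1 : Module.IsReflexive R X := ⟨h.refl⟩
  exact ⟨Module.Finite.equiv e, (Module.IsReflexive.of_split e.symm.toLinearMap e.toLinearMap
    (by ext; simp)).bijective_dual_eval', fun i => (h.ev i).congr_left e, 
    fun i => (h.evd i).congr_left e.symm.dualMap⟩

theorem TR.of_projective [Module.Finite R X] [Module.Projective R X] : TR R X :=
  ⟨inferInstance, Module.bijective_dual_eval R X, fun i => EV.of_projective i,
    fun i => EV.of_projective i⟩

theorem TR.prod (hA : TR R A) (hB : TR R B) : TR R (A × B) := by
  have := hA.fin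
  have := hB.fin
  have h1 : Module.IsReflexive R A := ⟨hA.refl⟩
  have h2 : Module.IsReflexive R B := ⟨hB.refl⟩
  exact ⟨inferInstance, Module.bijective_dual_eval R _, fun i => (hA.ev i).prod_left (hB.ev i),
    fun i => ((hA.evd i).prod_left (hB.evd i)).congr_left (Module.dualProdDualEquivDual R A B)⟩

theorem TR.dual [IsNoetherianRing R] (hA : TR R A) : TR R (Module.Dual R A) := by
  have := hA.fin
  have h1 : Module.IsReflexive R A := ⟨hA.refl⟩
  exact ⟨inferInstance, Module.bijective_dual_eval R _, fun i => hA.evd i,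
    fun i => (hA.ev i).congr_left (Module.evalEquiv R A)⟩

theorem dual_exact {f : A →ₗ[R] B} {g : B →ₗ[R] C} 
    (h : Function.Exact f g) (hg : Function.Surjective g) :
    Function.Exact g.dualMap f.dualMap := by
  intro β
  constructor
  · intro hβ
    have : LinearMap.ker g ≤ LinearMap.ker β := by
      intro b hb
      obtain ⟨a, rfl⟩ := (h b).1 hb
      exact LinearMap.congr_fun hβ a
    refine ⟨(Submodule.liftQ _ β this) ∘ₗ (g.quotKerEquivOfSurjective hg).symm.toLinearMap, ?_⟩
    ext b
    have : (g.quotKerEquivOfSurjective hg).symm (g b) = Submodule.Quotient.mk b := by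
      rw [LinearEquiv.symm_apply_eq]; rfl
    simp [this]
  · rintro ⟨γ, rfl⟩
    ext a
    simp [h.apply_apply_eq_zero]

theorem dual_inj {g : B →ₗ[R] C} (hg : Function.Surjective g) :
    Function.Injective g.dualMap := LinearMap.dualMap_injective_of_surjective hg

/-- (A) -/
theorem TR.left [IsNoetherianRing R] {f : A →ₗ[R] B} {g : B →ₗ[R] C} (hf : Function.Injective f)
    (h : Function.Exact f g) (hg : Function.Surjective g) (hB : TR R B) (hC : TR R C) :
    TR R A := by
  have := hB.fin
  have hs : Function.Surjective f.dualMap := fun φ => EV.extend hf h hg (hC.ev 0) φ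
  refine ⟨Module.Finite.of_injective f hf, ⟨?_, ?_⟩, 
    fun i => EV.left hf h hg (hB.ev i) (hC.ev (i+1)), fun i => ?_⟩
  · rw [injective_iff_map_eq_zero]
    intro a ha
    apply hf
    apply hB.refl.1
    ext β
    have := LinearMap.congr_fun ha (f.dualMap β)
    simpa using this
  · intro φ
    obtain ⟨b, hb⟩ := hB.refl.2 (φ ∘ₗ f.dualMap)
    have hb' : ∀ β : Module.Dual R B, β b = φ (β ∘ₗ f) := fun β => LinearMap.congr_fun hb β
    have : g b = 0 := by
      apply hC.refl.1
      ext γ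
      have := hb' (γ ∘ₗ g)
      rw [LinearMap.comp_assoc, h.linearMap_comp_eq_zero] at this
      simpa using this
    obtain ⟨a, rfl⟩ := (h b).1 this
    refine ⟨a, ?_⟩
    ext α
    obtain ⟨β, rfl⟩ := hs α
    exact hb' β
  · cases i with
    | zero =>
      refine EV.of_extend (dual_inj hg) (dual_exact h hg) hs (hB.evd 0) fun φ => ?_
      obtain ⟨c, hc⟩ := hC.refl.2 φ
      obtain ⟨b, rfl⟩ := hg c
      refine ⟨Module.Dual.eval R B b, ?_⟩
      rw [← hc]
      ext γ
      simp
    | succ i => exact EV.right (dual_inj hg) (dual_exact h hg) hs (hC.evd i) (hB.evd (i+1))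

end TRsec
end


noncomputable section


section Step3
variable {R : Type u} [CommRing R] {A B C X X' Y Y' Z G F : Type u}
  [AddCommGroup A] [Module R A] [AddCommGroup B] [Module R B] [AddCommGroup C] [Module R C]
  [AddCommGroup X] [Module R X] [AddCommGroup Y] [Module R Y]
  [AddCommGroup X'] [Module R X'] [AddCommGroup Y'] [Module R Y'] [AddCommGroup Z] [Module R Z]
  [AddCommGroup G] [Module R G] [AddCommGroup F] [Module R F]

theorem II_le_dual : II R G ≤ II R (Module.Dual R G) := by
  rintro r ⟨P, _, _, _, _, a, b, h⟩
  refine ⟨Module.Dual R P, inferInstance, inferInstance, inferInstance, inferInstance,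
    b.dualMap, a.dualMap, ?_⟩
  ext φ x
  have := LinearMap.congr_fun h x
  simp at this
  simp [this]

theorem exact_desc {f : A →ₗ[R] B} {g : B →ₗ[R] C}
    (h : Function.Exact f g) (hg : Function.Surjective g) (φ : B →ₗ[R] Y) (hφ : φ ∘ₗ f = 0) :
    ∃ ψ : C →ₗ[R] Y, ψ ∘ₗ g = φ := by
  have : LinearMap.ker g ≤ LinearMap.ker φ := by
    intro b hb
    obtain ⟨a, rfl⟩ := (h b).1 hb
    exact LinearMap.congr_fun hφ a
  refine ⟨(Submodule.liftQ _ φ this) ∘ₗ (g.quotKerEquivOfSurjective hg).symm.toLinearMap, ?_⟩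
  ext b
  have : (g.quotKerEquivOfSurjective hg).symm (g b) = Submodule.Quotient.mk b := by
    rw [LinearEquiv.symm_apply_eq]; rfl
  simp [this]

theorem extend_fin {ι : G →ₗ[R] F} {π : F →ₗ[R] X} (hι : Function.Injective ι)
    (h : Function.Exact ι π) (hπ : Function.Surjective π) (hX : EV R X Y 1) {n : ℕ}
    (a : G →ₗ[R] (Fin n → Y)) : ∃ a' : F →ₗ[R] (Fin n → Y), a' ∘ₗ ι = a := 
  EV.extend hι h hπ (hX.pi_right n) a

theorem II_le_of_exact {ι : G →ₗ[R] F} {π : F →ₗ[R] X} (hι : Function.Injective ι)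
    (h : Function.Exact ι π) (hπ : Function.Surjective π) [Module.Finite R F]
    [Module.Projective R F] (hX : EV R X R 1) : II R G ≤ II R X := by
  intro r hr
  obtain ⟨n, a, b, hab⟩ := mem_II_fin hr
  obtain ⟨a', ha'⟩ := extend_fin hι h hπ hX a
  obtain ⟨u, hu⟩ := exact_desc h hπ (r • LinearMap.id - ι ∘ₗ b ∘ₗ a') (by
    ext x
    have h1 := LinearMap.congr_fun hab x
    have h2 := LinearMap.congr_fun ha' x
    simp at h1 h2
    simp [h1, h2])
  refine ⟨F, inferInstance, inferInstance, inferInstance, inferInstance, u, π, ?_⟩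
  ext x
  obtain ⟨y, rfl⟩ := hπ x
  have h1 := LinearMap.congr_fun hu y
  simp at h1
  simp [h1, h.apply_apply_eq_zero]

theorem ker_exact (g : A →ₗ[R] B) : Function.Exact (LinearMap.ker g).subtype g := by
  rw [LinearMap.exact_iff]; simp

variable [IsNoetherianRing R]

theorem exists_fin_surj (R : Type u) [CommRing R] (M : Type u) [AddCommGroup M] [Module R M]
    [Module.Finite R M] : ∃ (b : ℕ) (q : (Fin b → R) →ₗ[R] M), Function.Surjective q := 
  Module.Finite.exists_fin' R M

theorem TR.exists_cosyz (hG : TR R G) : ∃ (X : Type u) (_ : AddCommGroup X) (_ : Module R X)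
    (b : ℕ) (ι : G →ₗ[R] (Fin b → R)) (π : (Fin b → R) →ₗ[R] X), Function.Injective ι ∧
    Function.Exact ι π ∧ Function.Surjective π ∧ TR R X := by
  have := hG.dual.fin
  obtain ⟨b, q, hq⟩ := exists_fin_surj R (Module.Dual R G)
  have hex : Function.Exact (LinearMap.ker q).subtype q := by
    rw [LinearMap.exact_iff]; simp
  have hK : TR R (LinearMap.ker q) :=
    TR.left (LinearMap.ker q).injective_subtype hex hq TR.of_projective hG.dual
  let e1 : G ≃ₗ[R] Module.Dual R (Module.Dual R G) :=
    LinearEquiv.ofBijective (Module.Dual.eval R G) hG.refl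
  let e2 : (Fin b → R) ≃ₗ[R] Module.Dual R (Fin b → R) := (Pi.basisFun R (Fin b)).toDualEquiv
  refine ⟨Module.Dual R (LinearMap.ker q), inferInstance, inferInstance, b,
    e2.symm.toLinearMap ∘ₗ q.dualMap ∘ₗ e1.toLinearMap, 
    (LinearMap.ker q).subtype.dualMap ∘ₗ e2.toLinearMap, ?_, ?_, ?_, hK.dual⟩
  · exact e2.symm.injective.comp ((dual_inj hq).comp e1.injective)
  · intro x
    have := dual_exact hex hq (e2 x)
    rw [LinearMap.comp_apply, LinearEquiv.coe_coe, this]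
    constructor
    · rintro ⟨y, hy⟩
      refine ⟨e1.symm y, ?_⟩
      simp [hy]
    · rintro ⟨y, rfl⟩
      exact ⟨e1 y, by simp⟩
  · have : Function.Surjective (LinearMap.ker q).subtype.dualMap := fun φ =>
      EV.extend (LinearMap.ker q).injective_subtype hex hq (hG.dual.ev 0) φ
    exact this.comp e2.surjective

theorem TotallyReflexive.congr' (e : X ≃ₗ[R] X') (h : TotallyReflexive R X) :
    TotallyReflexive R X' := by
  obtain ⟨h0, h2⟩ := h
  have h1 : Module.IsReflexive R X := ⟨h0⟩
  refine ⟨(Module.IsReflexive.of_split e.symm.toLinearMap e.toLinearMap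
    (by ext; simp)).bijective_dual_eval', fun i hi => ⟨?_, ?_⟩⟩
  · exact (EV_iff i).1 (((EV_iff i).2 (h2 i hi).1).congr_left e)
  · exact (EV_iff i).1 (((EV_iff i).2 (h2 i hi).2).congr_left e.symm.dualMap)

theorem GdimLE.congr' (e : X ≃ₗ[R] X') (k : ℕ) (h : GdimLE R k (ModuleCat.of R X)) :
    GdimLE R k (ModuleCat.of R X') := by
  cases k with
  | zero => exact TotallyReflexive.congr' e h
  | succ k =>
    obtain ⟨G, g, hf, ht, hs, hk⟩ := h
    refine ⟨G, e.toLinearMap ∘ₗ g, hf, ht, e.surjective.comp hs, ?_⟩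
    have : LinearMap.ker (e.toLinearMap ∘ₗ g) = LinearMap.ker g := by
      ext x; simp
    have hk' : GdimLE R k (ModuleCat.of R (LinearMap.ker (e.toLinearMap ∘ₗ g))) := by
      rw [this]; exact hk
    exact hk'

theorem GdimLE.ev {k : ℕ} : ∀ {X : Type u} [AddCommGroup X] [Module R X], 
    GdimLE R k (ModuleCat.of R X) → ∀ i, k < i → EV R X R i := by
  induction k with
  | zero =>
    intro X _ _ h i hi
    exact (EV_iff i).2 (h.2 i hi).1
  | succ k ih =>
    intro X _ _ h i hi
    obtain ⟨G, g, hf, ht, hs, hk⟩ := h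
    obtain ⟨j, rfl⟩ : ∃ j, i = j + 1 := ⟨i - 1, by omega⟩
    refine EV.right (R := R) (LinearMap.ker g).injective_subtype (ker_exact g) hs 
      (ih hk j (by omega)) ?_
    exact (EV_iff _).2 (ht.2 _ (by omega)).1

theorem GdimLE.syz {k : ℕ} {P M : Type u} [AddCommGroup P] [Module R P] [Module.Finite R P] 
    [Module.Projective R P] [AddCommGroup M] [Module R M] (π : P →ₗ[R] M)
    (hπ : Function.Surjective π)
    (h : GdimLE R (k+1) (ModuleCat.of R M)) : GdimLE R k (ModuleCat.of R (LinearMap.ker π)) := by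
  obtain ⟨G, g, hf, ht, hs, hk⟩ := h
  obtain ⟨h, hh⟩ := Module.projective_lifting_property (R := R) g π hs
  have hh' : ∀ p, g (h p) = π p := fun p => LinearMap.congr_fun hh p
  have hG : TR R G := TR_iff.2 ht
  cases k with
  | zero =>
    have hL : TR R (LinearMap.ker g) := TR_iff.2 hk
    let f : LinearMap.ker π →ₗ[R] (LinearMap.ker g × P) :=
      LinearMap.prod (LinearMap.codRestrict _ (-(h ∘ₗ (LinearMap.ker π).subtype)) (by
        rintro ⟨p, hp⟩
        rw [LinearMap.mem_ker] at hp
        simp [hh', hp])) (LinearMap.ker π).subtype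
    let θ : (LinearMap.ker g × P) →ₗ[R] G := (LinearMap.ker g).subtype.coprod h
    have : TR R (LinearMap.ker π) := by
      refine TR.left (f := f) (g := θ) ?_ ?_ ?_ (hL.prod TR.of_projective) hG
      · intro a b hab
        exact Subtype.ext (congrArg Prod.snd hab)
      · rintro ⟨⟨l, hl⟩, p⟩
        rw [LinearMap.mem_ker] at hl
        constructor
        · intro hz
          have hz' : l + h p = 0 := hz
          refine ⟨⟨p, ?_⟩, ?_⟩
          · have := congrArg g hz'
            rw [map_add, hl, hh'] at this
            simpa using this
          · have : l = - h p := eq_neg_of_add_eq_zero_left hz'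
            subst this
            rfl
        · rintro ⟨q, hq⟩
          rw [← hq]
          simp [θ, f]
      · intro x
        obtain ⟨p, hp⟩ := hπ (g x)
        refine ⟨(⟨x - h p, by simp [hh', hp]⟩, p), by simp [θ]⟩
    have hfin := this.fin
    exact TR_iff.1 this
  | succ k =>
    obtain ⟨G1, g1, hf1, ht1, hs1, hk1⟩ := hk
    have hG1 : TR R G1 := TR_iff.2 ht1
    let θ : (G1 × P) →ₗ[R] G := ((LinearMap.ker g).subtype ∘ₗ g1).coprod h
    have hθ : Function.Surjective θ := by
      intro x
      obtain ⟨p, hp⟩ := hπ (g x)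
      obtain ⟨a, ha⟩ := hs1 ⟨x - h p, by simp [hh', hp]⟩
      refine ⟨(a, p), ?_⟩
      have ha' : ((g1 a : LinearMap.ker g) : G) = x - h p := congrArg Subtype.val ha
      change ((g1 a : LinearMap.ker g) : G) + h p = x
      rw [ha']; simp
    have hZ : TR R (LinearMap.ker θ) := TR.left (LinearMap.ker θ).injective_subtype (ker_exact θ) hθ
      (hG1.prod TR.of_projective) hG
    have hmem : ∀ z : LinearMap.ker θ, ((g1 z.1.1 : LinearMap.ker g) : G) + h z.1.2 = 0 := 
      fun z => z.2
    let z : LinearMap.ker θ →ₗ[R] LinearMap.ker π := LinearMap.codRestrict _ 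
      (LinearMap.snd R G1 P ∘ₗ (LinearMap.ker θ).subtype) (by
        intro y
        have := congrArg g (hmem y)
        rw [map_add, hh', (g1 y.1.1).2] at this
        simpa using this)
    have := hZ.fin
    refine ⟨ModuleCat.of R (LinearMap.ker θ), z, inferInstance, TR_iff.1 hZ, ?_, ?_⟩
    · rintro ⟨p, hp⟩
      rw [LinearMap.mem_ker] at hp
      obtain ⟨a, ha⟩ := hs1 ⟨- h p, by simp [hh', hp]⟩
      have ha' : ((g1 a : LinearMap.ker g) : G) = - h p := congrArg Subtype.val ha
      refine ⟨⟨(a, p), ?_⟩, rfl⟩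
      change ((g1 a : LinearMap.ker g) : G) + h p = 0
      rw [ha']; simp
    · let j : LinearMap.ker g1 →ₗ[R] LinearMap.ker z := LinearMap.codRestrict _
        (LinearMap.codRestrict _ (LinearMap.inl R G1 P ∘ₗ (LinearMap.ker g1).subtype) (by
          rintro ⟨y, hy⟩
          rw [LinearMap.mem_ker] at hy
          simp [θ, hy])) (by
          intro y
          rfl)
      refine GdimLE.congr' (LinearEquiv.ofBijective j ⟨?_, ?_⟩) k hk1
      · intro a b hab
        have := congrArg (fun t : LinearMap.ker z => t.1.1.1) hab
        exact Subtype.ext this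
      · rintro ⟨⟨⟨a, p⟩, h1⟩, h2⟩
        have hp : p = 0 := congrArg Subtype.val h2
        subst hp
        refine ⟨⟨a, ?_⟩, rfl⟩
        have h1' : ((g1 a : LinearMap.ker g) : G) + h 0 = 0 := h1
        rw [map_zero, add_zero] at h1'
        exact Subtype.ext h1'

end Step3
end


noncomputable section


theorem PdLE.hasPD {A : Type u} [CommRing A] {k : ℕ} : ∀ {X : ModuleCat.{u} A},
    PdLE A k X → HasProjectiveDimensionLT X (k+1) := by
  induction k with
  | zero =>
    intro X h
    have h : Module.Projective A X := h
    have : Projective X := (IsProjective.iff_projective X).1 h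
    exact projective_iff_hasProjectiveDimensionLT_one.1 this
  | succ k ih =>
    rintro X ⟨G, g, hG, hs, hk⟩
    have : Projective G := (IsProjective.iff_projective G).1 hG
    have h1 := sc_shortExact (LinearMap.ker g).injective_subtype (ker_exact g) hs
    exact h1.hasProjectiveDimensionLT_X₃ (k+1) (ih hk)
      (hasProjectiveDimensionLT_of_ge _ 1 _ (by omega))

section Step5
variable {R : Type u} [CommRing R] [IsNoetherianRing R] (p : Ideal R) [p.IsPrime]
  {G M : Type u}
  [AddCommGroup G] [Module R G] [AddCommGroup M] [Module R M]

/-- local projective dimension -/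
def LPD (R : Type u) [CommRing R] (p : Ideal R) [p.IsPrime] (M : Type u) [AddCommGroup M]
    [Module R M] (m : ℕ) : Prop :=
  HasProjectiveDimensionLT (ModuleCat.of (Localization.AtPrime p)
    (LocalizedModule p.primeCompl M)) (m+1)

theorem sc_loc {R : Type u} [CommRing R] (S : Submonoid R) {A B C : Type u}
    [AddCommGroup A] [Module R A] [AddCommGroup B] [Module R B] [AddCommGroup C] [Module R C]
    (f : A →ₗ[R] B) (g : B →ₗ[R] C) (hf : Function.Injective f)
    (h : Function.Exact f g) (hg : Function.Surjective g) :
    (sc (R := Localization S) (LocalizedModule.map S f) (LocalizedModule.map S g)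
      (LocalizedModule.map_exact S _ _ h)).ShortExact :=
  sc_shortExact (R := Localization S) (f := LocalizedModule.map S f) (g := LocalizedModule.map S g)
    (LocalizedModule.map_injective S _ hf)
    (LocalizedModule.map_exact S _ _ h) (LocalizedModule.map_surjective S _ hg)

theorem LPD_syz {b : ℕ} (q : (Fin b → R) →ₗ[R] M) (hq : Function.Surjective q) {m : ℕ}
    (h : LPD R p M (m+1)) : LPD R p (LinearMap.ker q) m := by
  have h1 := sc_loc p.primeCompl _ _ (LinearMap.ker q).injective_subtype (ker_exact q) hq
  have : Module.Projective (Localization.AtPrime p) (LocalizedModule p.primeCompl (Fin b → R)) :=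
    Module.projective_of_isLocalizedModule p.primeCompl
      (LocalizedModule.mkLinearMap p.primeCompl (Fin b → R))
  have : Projective (ModuleCat.of (Localization.AtPrime p)
    (LocalizedModule p.primeCompl (Fin b → R))) := (IsProjective.iff_projective _).1 this
  exact h1.hasProjectiveDimensionLT_X₁ (m+1) (hasProjectiveDimensionLT_of_ge _ 1 _ (by omega)) h

theorem LPD_mono {m m' : ℕ} (hm : m ≤ m') (h : LPD R p M m) : LPD R p M m' := by
  have h : HasProjectiveDimensionLT _ _ := h
  exact hasProjectiveDimensionLT_of_ge _ (m+1) _ (by omega)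

theorem LPD_zero [Module.Finite R G] (h : LPD R p G 0) : ¬ II R G ≤ p := by
  have h' : Projective (ModuleCat.of (Localization.AtPrime p) (LocalizedModule p.primeCompl G)) :=
    projective_iff_hasProjectiveDimensionLT_one.2 h
  have hP : Module.Projective (Localization.AtPrime p) (LocalizedModule p.primeCompl G) :=
    (IsProjective.iff_projective _).2 h'
  obtain ⟨b, q, hq⟩ := exists_fin_surj R G
  let S := p.primeCompl
  obtain ⟨σ, hσ⟩ := Module.projective_lifting_property (R := Localization.AtPrime p) 
    (LocalizedModule.map S q) LinearMap.id
    (LocalizedModule.map_surjective p.primeCompl _ hq)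
  have : Module.FinitePresentation R G := Module.finitePresentation_of_finite R G
  obtain ⟨h, s, hs⟩ := Module.FinitePresentation.exists_lift_of_isLocalizedModule S
    (LocalizedModule.mkLinearMap S (Fin b → R)) 
      ((σ.restrictScalars R) ∘ₗ LocalizedModule.mkLinearMap S G)
  have key : (LocalizedModule.mkLinearMap S G) ∘ₗ (q ∘ₗ h) =
      (LocalizedModule.mkLinearMap S G) ∘ₗ (s.1 • LinearMap.id) := by
    ext x
    have h1 := LinearMap.congr_fun hs x
    have h2 := LinearMap.congr_fun hσ (LocalizedModule.mkLinearMap S G x)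
    have h3 : (LocalizedModule.map S q) (LocalizedModule.mkLinearMap S _ (h x)) =
      LocalizedModule.mkLinearMap S G (q (h x)) := by
      simp [LocalizedModule.map_mk]
    have h1' : LocalizedModule.mkLinearMap S (Fin b → R) (h x) =
      s.1 • σ (LocalizedModule.mkLinearMap S G x) := h1
    rw [h1', LinearMap.map_smul_of_tower] at h3
    change LocalizedModule.mkLinearMap S G (q (h x)) = LocalizedModule.mkLinearMap S G (s.1 • x)
    rw [← h3, map_smul]
    congr 1
  obtain ⟨t, ht⟩ := Module.Finite.exists_smul_of_comp_eq_of_isLocalizedModule S _ _ _ key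
  intro hle
  have : t.1 * s.1 ∈ II R G := by
    refine ⟨Fin b → R, inferInstance, inferInstance, inferInstance, inferInstance, h, t.1 • q, ?_⟩
    have ht' : t.1 • (q ∘ₗ h) = t.1 • (s.1 • LinearMap.id) := ht
    rw [LinearMap.smul_comp, ht', smul_smul]
  exact (t * s).2 (hle this)

theorem LPD_II (m : ℕ) : ∀ (G : Type u) [AddCommGroup G] [Module R G], TR R G → LPD R p G m →
    ¬ II R G ≤ p := by
  induction m with
  | zero => 
    intro G _ _ hG h
    have := hG.fin
    exact LPD_zero p h
  | succ m ih =>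
    intro G _ _ hG h hle
    have := hG.fin
    obtain ⟨b, q, hq⟩ := exists_fin_surj R G
    have hK : TR R (LinearMap.ker q) := TR.left (LinearMap.ker q).injective_subtype (ker_exact q)
      hq TR.of_projective hG
    exact ih _ hK (LPD_syz p q hq h) ((II_le_of_exact (LinearMap.ker q).injective_subtype
      (ker_exact q) hq (hG.ev 0)).trans hle)

end Step5

section Step6
variable {R : Type u} [CommRing R] [IsNoetherianRing R] (p : Ideal R) [p.IsPrime]
  {G M : Type u}
  [AddCommGroup G] [Module R G] [Module.Finite R G]

/-- rank `r` free piece up to `p` -/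
def Piece (R : Type u) [CommRing R] (p : Ideal R) (G : Type u) [AddCommGroup G] [Module R G]
    (r : ℕ) : Prop :=
  ∃ (a : G →ₗ[R] (Fin r → R)) (b : (Fin r → R) →ₗ[R] G) (s : R), s ∉ p ∧ a ∘ₗ b = s • LinearMap.id

theorem Piece.bdd {m : ℕ} (q : (Fin m → R) →ₗ[R] G) (hq : Function.Surjective q) {r : ℕ}
    (h : Piece R p G r) : r ≤ m := by
  obtain ⟨a, b, s, hs, hab⟩ := h
  obtain ⟨c, hc⟩ := Module.projective_lifting_property q b hq
  have h1 : (a ∘ₗ q) ∘ₗ c = s • LinearMap.id := by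
    rw [LinearMap.comp_assoc, hc, hab]
  let K := FractionRing (R ⧸ p)
  let f : R →+* K := (algebraMap (R ⧸ p) K).comp (Ideal.Quotient.mk p)
  have hf : f s ≠ 0 := by
    have h2 : Ideal.Quotient.mk p s ≠ 0 := by rwa [Ne, Ideal.Quotient.eq_zero_iff_mem]
    exact fun h3 => h2 ((IsFractionRing.injective (R ⧸ p) K) (by simpa [f] using h3))
  have h2 := congrArg LinearMap.toMatrix' h1
  rw [LinearMap.toMatrix'_comp, map_smul, LinearMap.toMatrix'_id] at h2
  have h3 := congrArg (fun A => A.map f) h2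
  simp only [Matrix.map_mul] at h3
  have h4 : ((s • (1 : Matrix (Fin r) (Fin r) R)).map f) = f s • (1 : Matrix (Fin r) (Fin r) K) := by
    ext i j
    simp [Matrix.one_apply]
    split <;> simp
  rw [h4] at h3
  have h5 : ((LinearMap.toMatrix' (a ∘ₗ q)).map f) * ((f s)⁻¹ • (LinearMap.toMatrix' c).map f) = 1 := by
    rw [Matrix.mul_smul, h3, smul_smul, inv_mul_cancel₀ hf, one_smul]
  have h6 := Matrix.rank_mul_le_left ((LinearMap.toMatrix' (a ∘ₗ q)).map f)
    ((f s)⁻¹ • (LinearMap.toMatrix' c).map f)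
  rw [h5, Matrix.rank_one] at h6
  simpa using h6.trans (Matrix.rank_le_width _)

theorem Piece.step {r : ℕ} {a : G →ₗ[R] (Fin r → R)} {b : (Fin r → R) →ₗ[R] G} {s : R} (hs : s ∉ p)
    (hab : a ∘ₗ b = s • LinearMap.id) (f : Module.Dual R G) (g : G)
    (hu : f (s • g - b (a g)) ∉ p) : Piece R p G (r+1) := by
  have hab' : ∀ v, a (b v) = s • v := fun v => LinearMap.congr_fun hab v
  let φ : G →ₗ[R] G := s • LinearMap.id - b ∘ₗ a
  have hφ : ∀ x, φ x = s • x - b (a x) := fun x => rfl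
  have haφ : ∀ x, a (φ x) = 0 := fun x => by simp [hφ, hab']
  have hφb : ∀ v, φ (b v) = 0 := fun x => by simp [hφ, hab']
  have hφφ : ∀ x, φ (φ x) = s • φ x := fun x => by rw [hφ (φ x), haφ, map_zero, sub_zero]
  rw [← hφ] at hu
  set w := f (φ g) with hw
  let e : (R × (Fin r → R)) ≃ₗ[R] (Fin (r+1) → R) := Fin.consLinearEquiv R (fun _ => R)
  refine ⟨e.toLinearMap ∘ₗ (f ∘ₗ φ).prod a, 
    (LinearMap.toSpanSingleton R G (φ g)).coprod (w • b) ∘ₗ e.symm.toLinearMap, s * w, ?_, ?_⟩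
  · intro h
    rcases (‹p.IsPrime›).mem_or_mem h with h | h
    exacts [hs h, hu h]
  · ext1 i
    apply LinearMap.ext
    intro x
    obtain ⟨⟨y, v⟩, hv⟩ := e.surjective (Pi.single i x)
    simp only [LinearMap.comp_apply, LinearMap.coe_single, LinearEquiv.coe_coe, ← hv,
      LinearEquiv.symm_apply_apply]
    rw [LinearMap.smul_apply, LinearMap.id_apply, ← map_smul]
    congr 1
    ext
    · simp [hφb, hφφ, ← hw]; ring
    · simp [hab', haφ]; ring

theorem exists_functional (h : G) (hh : ∀ t : R, t ∉ p → t • h ∉ p • (⊤ : Submodule R G)) :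
    ∃ l : G →ₗ[R] (R ⧸ p), l h ≠ 0 := by
  let A := R ⧸ p
  let N := G ⧸ p • (⊤ : Submodule R G)
  let K := FractionRing A
  let S := nonZeroDivisors A
  let V := LocalizedModule S N
  let hb : N := Submodule.Quotient.mk h
  have h1 : LocalizedModule.mkLinearMap S N hb ≠ 0 := by
    intro h0
    rw [IsLocalizedModule.eq_zero_iff S] at h0
    obtain ⟨⟨c, hc⟩, hc0⟩ := h0
    obtain ⟨t, rfl⟩ := Ideal.Quotient.mk_surjective c
    have ht : t ∉ p := by
      intro h3
      rw [← Ideal.Quotient.eq_zero_iff_mem] at h3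
      exact nonZeroDivisors.ne_zero hc h3
    apply hh t ht
    rw [← Submodule.Quotient.mk_eq_zero]
    exact hc0
  obtain ⟨φ, hφ⟩ : ∃ φ : Module.Dual K V, φ (LocalizedModule.mkLinearMap S N hb) ≠ 0 := by
    by_contra! hcon
    exact h1 ((Module.forall_dual_apply_eq_zero_iff K _).1 hcon)
  have : Module.Finite A N := Module.Finite.of_restrictScalars_finite R A N
  have : Module.FinitePresentation A N := Module.finitePresentation_of_finite A N
  obtain ⟨l, s, hl⟩ := Module.FinitePresentation.exists_lift_of_isLocalizedModule S
    (Algebra.linearMap A K) ((φ.restrictScalars A) ∘ₗ LocalizedModule.mkLinearMap S N)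
  refine ⟨(l.restrictScalars R) ∘ₗ (Submodule.mkQ _), ?_⟩
  intro h0
  have h0 : l hb = 0 := h0
  have h2 := LinearMap.congr_fun hl hb
  rw [LinearMap.comp_apply, h0, map_zero] at h2
  have h3 : s.1 • φ (LocalizedModule.mkLinearMap S N hb) = 0 := h2.symm
  rw [Algebra.smul_def] at h3
  rcases mul_eq_zero.1 h3 with h4 | h4
  · exact nonZeroDivisors.ne_zero s.2 ((IsFractionRing.injective A K) (by simpa using h4))
  · exact hφ h4

theorem step6 (hle : II R G ≤ p) : ∃ (g : G) (l : G →ₗ[R] (R ⧸ p)), l g ≠ 0 ∧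
    ∀ f : Module.Dual R G, f g ∈ p := by
  classical
  by_contra! hcon
  obtain ⟨m, q, hq⟩ := exists_fin_surj R G
  have hP0 : Piece R p G 0 := ⟨0, 0, 1, fun h => (‹p.IsPrime›).ne_top ((Ideal.eq_top_iff_one _).2 h),
    by ext i; exact i.elim0⟩
  let r := Nat.findGreatest (Piece R p G) m
  have hr : Piece R p G r := Nat.findGreatest_spec (Nat.zero_le m) hP0
  have hr1 : ¬ Piece R p G (r+1) := by
    intro h
    exact absurd (Nat.le_findGreatest (h.bdd p q hq) h) (by change ¬ (r + 1 ≤ r); omega)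
  obtain ⟨a, b, s, hs, hab⟩ := hr
  let φ : G →ₗ[R] G := s • LinearMap.id - b ∘ₗ a
  have h1 : ∀ (f : Module.Dual R G) (g : G), f (φ g) ∈ p := by
    intro f g
    by_contra hu
    exact hr1 (Piece.step p hs hab f g hu)
  have h2 : ∀ g (l : G →ₗ[R] (R ⧸ p)), l (φ g) = 0 := by
    intro g l
    by_contra h
    obtain ⟨f, hf⟩ := hcon (φ g) l h
    exact hf (h1 f g)
  have h3 : ∀ g, ∃ t, t ∉ p ∧ t • φ g ∈ p • (⊤ : Submodule R G) := by
    intro g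
    by_contra! h
    obtain ⟨l, hl⟩ := exists_functional p (φ g) h
    exact hl (h2 g l)
  choose t ht htp using h3
  obtain ⟨S, hS⟩ := (Module.Finite.fg_top : (⊤ : Submodule R G).FG)
  let T := ∏ g ∈ S, t g
  have hT : T ∉ p := by
    intro h
    obtain ⟨g, -, hg⟩ := (Ideal.IsPrime.prod_mem_iff (p := p)).1 h
    exact ht g hg
  have hrange : LinearMap.range (T • φ) ≤ p • (⊤ : Submodule R G) := by
    rw [LinearMap.range_eq_map, ← hS, Submodule.map_span_le, hS]
    intro g hg
    have : T = (∏ x ∈ S.erase g, t x) * t g := (Finset.prod_erase_mul S t hg).symm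
    rw [LinearMap.smul_apply, this, mul_smul]
    exact Submodule.smul_mem _ _ (htp g)
  obtain ⟨P, hPm, -, hPc, hP0⟩ :=
    LinearMap.exists_monic_and_natDegree_eq_and_coeff_mem_pow_and_aeval_eq_zero R
      (T • φ) p hrange
  let c := T * s
  have hc : c ∉ p := fun h => by
    rcases (‹p.IsPrime›).mem_or_mem h with h | h
    exacts [hT h, hs h]
  have hpow : ∀ k : ℕ, ∃ w : G →ₗ[R] (Fin r → R), (T • φ) ^ k = c ^ k • LinearMap.id - b ∘ₗ w := by
    intro k
    induction k with
    | zero => exact ⟨0, by ext; simp⟩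
    | succ k ih =>
      obtain ⟨w, hw⟩ := ih
      refine ⟨c • w + T • (a ∘ₗ ((T • φ) ^ k)), ?_⟩
      rw [pow_succ']
      ext x
      have hx : ((T • φ) ^ k) x = c ^ k • x - b (w x) := by rw [hw]; simp
      have : (T • φ * (T • φ) ^ k) x = T • (s • (((T • φ) ^ k) x) - b (a (((T • φ) ^ k) x))) := rfl
      rw [this]
      simp only [LinearMap.sub_apply, LinearMap.smul_apply, LinearMap.id_apply,
        LinearMap.comp_apply, LinearMap.add_apply, map_add, map_smul, smul_sub]
      rw [show (b (a (((T • φ) ^ k) x))) = b (a (((T • φ) ^ k) x)) from rfl]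
      generalize b (a (((T • φ) ^ k) x)) = y
      rw [hx]
      simp only [smul_sub, smul_smul, c, pow_succ']
      module
  have hpoly : ∀ Q : Polynomial R, ∃ w : G →ₗ[R] (Fin r → R), 
      Polynomial.aeval (T • φ) Q = Q.eval c • LinearMap.id - b ∘ₗ w := by
    intro Q
    induction Q using Polynomial.induction_on' with
    | add Q1 Q2 h1 h2 =>
      obtain ⟨w1, hw1⟩ := h1
      obtain ⟨w2, hw2⟩ := h2
      refine ⟨w1 + w2, ?_⟩
      rw [map_add, hw1, hw2, Polynomial.eval_add, LinearMap.comp_add]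
      module
    | monomial k x =>
      obtain ⟨w, hw⟩ := hpow k
      refine ⟨x • w, ?_⟩
      rw [Polynomial.aeval_monomial, hw, Polynomial.eval_monomial, LinearMap.comp_smul,
        ← Algebra.smul_def]
      module
  obtain ⟨w, hw⟩ := hpoly P
  rw [hP0] at hw
  have hmem : P.eval c ∈ II R G := by
    refine ⟨Fin r → R, inferInstance, inferInstance, inferInstance, inferInstance, w, b, ?_⟩
    exact (sub_eq_zero.1 hw.symm).symm
  have hmem := hle hmem
  rw [Polynomial.eval_eq_sum_range, Finset.sum_range_succ, hPm.coeff_natDegree, one_mul] at hmem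
  have : ∑ k ∈ Finset.range P.natDegree, P.coeff k * c ^ k ∈ p := by
    refine Ideal.sum_mem _ fun k hk => Ideal.mul_mem_right _ _ ?_
    rw [Finset.mem_range] at hk
    exact Ideal.pow_le_self (by omega) (hPc k)
  exact hc ((‹p.IsPrime›).mem_of_pow_mem _ ((Ideal.add_mem_iff_right _ this).1 hmem))

end Step6
end


noncomputable section

open scoped Pointwise

section Step7
variable {R : Type u} [CommRing R] 

theorem quot_exact (N : Type u) [AddCommGroup N] [Module R N] (x : R) :
    Function.Exact (LinearMap.lsmul R N x) (Submodule.mkQ (x • (⊤ : Submodule R N))) := by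
  intro n
  rw [Submodule.mkQ_apply, Submodule.Quotient.mk_eq_zero, Submodule.mem_smul_pointwise_iff_exists]
  simp

/-- chain of quotients -/
def Qchain (p I : Ideal R) : ℕ → ∀ (N : Type u) [AddCommGroup N] [Module R N], Prop
  | 0, N, _, _ => ∃ s : N, ∀ r : R, r • s = 0 ↔ r ∈ p
  | (c+1), N, _, _ => ∃ x ∈ I, IsSMulRegular N x ∧ Qchain p I c (QuotSMulTop x N)

theorem EV_zero_iff {X Y : Type u} [AddCommGroup X] [Module R X] [AddCommGroup Y] [Module R Y] :
    EV R X Y 0 ↔ ∀ f : X →ₗ[R] Y, f = 0 := by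
  unfold EV
  rw [Abelian.Ext.addEquiv₀.subsingleton_congr]
  constructor
  · intro h f
    have : ModuleCat.ofHom f = ModuleCat.ofHom 0 := Subsingleton.elim _ _
    exact congrArg ModuleCat.Hom.hom this
  · intro h
    refine ⟨fun a b => ?_⟩
    ext1
    rw [h a.hom, h b.hom]

variable [IsLocalRing R]


theorem kk_smul {x : R} (hx : x ∈ IsLocalRing.maximalIdeal R) (a : (IsLocalRing.ResidueField R)) : x • a = 0 := by
  rw [Algebra.smul_def]
  have : algebraMap R (IsLocalRing.ResidueField R) x = 0 := (IsLocalRing.residue_eq_zero_iff x).2 hx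
  rw [this, zero_mul]

theorem EV_kk_zero {N : Type u} [AddCommGroup N] [Module R N] {x : R} 
    (hx : x ∈ IsLocalRing.maximalIdeal R) (hr : IsSMulRegular N x) : EV R (IsLocalRing.ResidueField R) N 0 := by
  rw [EV_zero_iff]
  intro f
  ext a
  apply hr
  change x • f a = x • (0 : N)
  rw [← map_smul, kk_smul hx]; simp

theorem EV_kk_succ {N : Type u} [AddCommGroup N] [Module R N] {x : R} 
    (hx : x ∈ IsLocalRing.maximalIdeal R) (hr : IsSMulRegular N x) (e : ℕ)
    (h : EV R (IsLocalRing.ResidueField R) (QuotSMulTop x N) e) : EV R (IsLocalRing.ResidueField R) N (e+1) := by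
  refine EV_of_forall fun t => ?_
  obtain ⟨t', rfl⟩ := Abelian.Ext.covariant_sequence_exact₁ (ModuleCat.of R (IsLocalRing.ResidueField R))
    (sc_shortExact (f := LinearMap.lsmul R N x) hr (quot_exact N x) (Submodule.mkQ_surjective _)) t 
    (by
      have h1 : ModuleCat.ofHom (LinearMap.lsmul R N x) = x • 𝟙 (ModuleCat.of R N) := by
        ext; rfl
      change t.comp (Abelian.Ext.mk₀ (ModuleCat.ofHom (LinearMap.lsmul R N x))) (add_zero _) = 0
      rw [h1, Abelian.Ext.mk₀_smul, Abelian.Ext.comp_smul, Abelian.Ext.comp_mk₀_id]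
      have h3 : x • t = (Abelian.Ext.mk₀ (x • 𝟙 (ModuleCat.of R (IsLocalRing.ResidueField R)))).comp t (zero_add _) := by
        rw [Abelian.Ext.mk₀_smul, Abelian.Ext.smul_comp, Abelian.Ext.mk₀_id_comp]
      have h4 : x • 𝟙 (ModuleCat.of R (IsLocalRing.ResidueField R)) = 0 := by
        ext a
        exact kk_smul hx a
      rw [h3, h4]; simp) rfl
  have : t' = 0 := h.elim t'
  rw [this]; simp

theorem EV_kk_quot {N : Type u} [AddCommGroup N] [Module R N] {x : R} 
    (hr : IsSMulRegular N x) (e : ℕ)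
    (h : EV R (IsLocalRing.ResidueField R) N e) (h' : EV R (IsLocalRing.ResidueField R) N (e+1)) : EV R (IsLocalRing.ResidueField R) (QuotSMulTop x N) e :=
  EV.cov_right (f := LinearMap.lsmul R N x) hr (quot_exact N x) (Submodule.mkQ_surjective _) h h'

variable [IsNoetherianRing R]

theorem exists_ass {N : Type u} [AddCommGroup N] [Module R N] [Module.Finite R N] (I : Ideal R)
    (h : ∀ x ∈ I, ¬ IsSMulRegular N x) : ∃ (p : Ideal R), p.IsPrime ∧ I ≤ p ∧
      ∃ s : N, ∀ r : R, r • s = 0 ↔ r ∈ p := by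
  have h1 := biUnion_associatedPrimes_eq_compl_regular R N
  have h2 : (I : Set R) ⊆ ⋃ p ∈ associatedPrimes R N, ((id p : Ideal R) : Set R) := by
    simp only [id]
    rw [h1]
    exact fun x hx => h x hx
  obtain ⟨p, hp, hIp⟩ := (Ideal.subset_union_prime_finite (associatedPrimes.finite R N) (f := id) 0 0
    (fun _ h _ _ => h.isPrime)).1 h2
  have hp : IsAssociatedPrime p N := hp
  rw [isAssociatedPrime_iff] at hp
  obtain ⟨hp1, s, hs⟩ := hp
  refine ⟨p, hp1, hIp, s, fun r => ?_⟩
  rw [hs, Submodule.mem_colon_singleton, Submodule.mem_bot]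

theorem coheight_lemma (e : ℕ) : ∀ (N : Type u) [AddCommGroup N] [Module R N] [Module.Finite R N]
    (_ : ∀ i < e, EV R (IsLocalRing.ResidueField R) N i) (p : Ideal R) (hp : p.IsPrime) (s : N) 
    (_ : ∀ r : R, r • s = 0 ↔ r ∈ p),
    (e : ℕ∞) ≤ Order.coheight (⟨p, hp⟩ : PrimeSpectrum R) := by
  induction e with
  | zero => intros; simp
  | succ e ih =>
    intro N _ _ _ hN p hp s hs
    have h0 := EV_zero_iff.1 (hN 0 (by omega))
    obtain ⟨x, hx, hxr⟩ : ∃ x ∈ IsLocalRing.maximalIdeal R, IsSMulRegular N x := by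
      by_contra! hcon
      obtain ⟨q, hq, hmq, t, ht⟩ := exists_ass _ hcon
      let f : (IsLocalRing.ResidueField R) →ₗ[R] N := Submodule.liftQ (IsLocalRing.maximalIdeal R)
        (LinearMap.toSpanSingleton R N t) (by
          intro r hr
          exact (ht r).2 (hmq hr))
      have h1 : f (Submodule.Quotient.mk 1) = t := by
        change LinearMap.toSpanSingleton R N t 1 = t
        simp
      have ht0 : t = 0 := by rw [← h1, h0 f]; rfl
      exact hq.ne_top ((Ideal.eq_top_iff_one _).2 ((ht 1).1 (by rw [ht0, smul_zero])))
    let N' : Submodule R N := 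
      { carrier := {n | ∀ r ∈ p, r • n = 0}
        zero_mem' := by simp
        add_mem' := by
          intro a b ha hb r hr
          rw [smul_add, ha r hr, hb r hr, add_zero]
        smul_mem' := by
          intro c a ha r hr
          rw [smul_comm, ha r hr, smul_zero] }
    have hsN : s ∈ N' := fun r hr => (hs r).2 hr
    have hs0 : s ≠ 0 := by
      rintro rfl
      exact hp.ne_top ((Ideal.eq_top_iff_one _).2 ((hs 1).1 (by simp)))
    obtain ⟨n, hnN, hn⟩ : ∃ n ∈ N', n ∉ x • (⊤ : Submodule R N) := by
      by_contra! hcon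
      have : N' ≤ IsLocalRing.maximalIdeal R • N' := by
        intro n hn
        obtain ⟨y, -, rfl⟩ := (Submodule.mem_smul_pointwise_iff_exists _ _ _).1 (hcon n hn)
        refine Submodule.smul_mem_smul hx ?_
        intro r hr
        apply hxr
        change x • r • y = x • (0 : N)
        rw [smul_comm, hn r hr, smul_zero]
      have h1 := Submodule.eq_bot_of_le_smul_of_le_jacobson_bot _ N' (IsNoetherian.noetherian N') this
        (IsLocalRing.maximalIdeal_le_jacobson _)
      rw [h1] at hsN
      exact hs0 hsN
    let nb : QuotSMulTop x N := Submodule.Quotient.mk n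
    have hnb : nb ≠ 0 := by
      intro h
      exact hn ((Submodule.Quotient.mk_eq_zero _).1 h)
    obtain ⟨q, hq, hcq⟩ := exists_le_isAssociatedPrime_of_isNoetherianRing R nb hnb
    rw [isAssociatedPrime_iff] at hq
    obtain ⟨hq1, t, ht⟩ := hq
    have hpq : p ≤ q := by
      intro r hr
      apply hcq
      rw [Submodule.mem_colon_singleton, Submodule.mem_bot]
      change (Submodule.Quotient.mk (r • n) : QuotSMulTop x N) = 0
      rw [hnN r hr]; rfl
    have hxq : x ∈ q := by
      apply hcq
      rw [Submodule.mem_colon_singleton, Submodule.mem_bot]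
      change (Submodule.Quotient.mk (x • n) : QuotSMulTop x N) = 0
      rw [Submodule.Quotient.mk_eq_zero]
      exact Submodule.smul_mem_pointwise_smul _ _ _ trivial
    have hxp : x ∉ p := by
      intro h
      apply hs0
      apply hxr
      change x • s = x • (0 : N)
      rw [(hs x).2 h, smul_zero]
    have hlt : (⟨p, hp⟩ : PrimeSpectrum R) < ⟨q, hq1⟩ := by
      refine lt_of_le_of_ne hpq ?_
      intro h
      have : p = q := congrArg PrimeSpectrum.asIdeal h
      exact hxp (this ▸ hxq)
    refine le_trans ?_ (Order.coheight_add_one_le hlt)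
    have := ih (QuotSMulTop x N) (fun i hi => EV_kk_quot hxr i (hN i (by omega))
      (hN (i+1) (by omega))) q hq1 t (fun r => by
        rw [ht, Submodule.mem_colon_singleton, Submodule.mem_bot])
    push_cast
    gcongr

theorem chain_lemma (I : Ideal R) (hI : I ≤ IsLocalRing.maximalIdeal R) (e : ℕ) :
    ∀ (N : Type u) [AddCommGroup N] [Module R N] [Module.Finite R N]
    (_ : ∀ i < e, EV R (IsLocalRing.ResidueField R) N i) (_ : ¬ EV R (IsLocalRing.ResidueField R) N e), ∃ (c f : ℕ), c + f = e ∧ ∃ (p : Ideal R)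
      (hp : p.IsPrime), I ≤ p ∧ Qchain p I c N ∧ 
      (f : ℕ∞) ≤ Order.coheight (⟨p, hp⟩ : PrimeSpectrum R) := by
  induction e with
  | zero =>
    intro N _ _ _ h1 h2
    obtain ⟨p, hp, hIp, hs⟩ := exists_ass (N := N) I (fun x hx hr => h2 (EV_kk_zero (hI hx) hr))
    exact ⟨0, 0, rfl, p, hp, hIp, hs, by simp⟩
  | succ e ih =>
    intro N _ _ _ h1 h2
    by_cases hx : ∃ x ∈ I, IsSMulRegular N x
    · obtain ⟨x, hx, hr⟩ := hx
      obtain ⟨c, f, hcf, p, hp, hIp, hQ, hf⟩ := ih (QuotSMulTop x N) (fun i hi => 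
        EV_kk_quot hr i (h1 i (by omega)) (h1 (i+1) (by omega)))
        (fun h => h2 (EV_kk_succ (hI hx) hr e h))
      exact ⟨c+1, f, by omega, p, hp, hIp, ⟨x, hx, hr, hQ⟩, hf⟩
    · push Not at hx
      obtain ⟨p, hp, hIp, s, hs⟩ := exists_ass (N := N) I hx
      exact ⟨0, e+1, by omega, p, hp, hIp, ⟨s, hs⟩, coheight_lemma (e+1) N h1 p hp s hs⟩

theorem CM_depth {d : ℕ} (h : IsCMLocalOfDim R d) : (∀ i < d, EV R (IsLocalRing.ResidueField R) R i) ∧ ¬ EV R (IsLocalRing.ResidueField R) R d := by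
  obtain ⟨-, h⟩ := h
  unfold moduleDepth at h
  set S := {i : ℕ∞ | ∃ n : ℕ, i = n ∧
    Nontrivial (ExtMod R (ModuleCat.of R (IsLocalRing.ResidueField R)) (ModuleCat.of R R) n)} with hS
  have hne : S.Nonempty := by
    by_contra h0
    rw [Set.not_nonempty_iff_eq_empty] at h0
    rw [h0, sInf_empty] at h
    exact absurd h (ENat.top_ne_coe d)
  have hmem := csInf_mem hne
  rw [h] at hmem
  obtain ⟨n, hn, hnt⟩ := hmem
  have hn : d = n := by exact_mod_cast hn
  subst hn
  constructor
  · intro i hi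
    rw [EV_iff, ← not_nontrivial_iff_subsingleton]
    intro h1
    have : sInf S ≤ i := sInf_le ⟨i, rfl, h1⟩
    rw [h] at this
    have : d ≤ i := by exact_mod_cast this
    omega
  · rw [EV_iff, ← not_nontrivial_iff_subsingleton]
    exact fun h => h hnt

theorem step7 {d : ℕ} (h : IsCMLocalOfDim R d) (I : Ideal R) (hI : I ≠ ⊤) :
    ∃ c, c ≤ d ∧ ∃ (p : Ideal R) (hp : p.IsPrime), I ≤ p ∧ Qchain p I c R ∧ 
      primeHt R p hp ≤ c := by
  obtain ⟨h1, h2⟩ := CM_depth h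
  obtain ⟨c, f, hcf, p, hp, hIp, hQ, hf⟩ := chain_lemma I (IsLocalRing.le_maximalIdeal hI) d R h1 h2
  refine ⟨c, by omega, p, hp, hIp, hQ, ?_⟩
  have hd := h.1
  unfold ringKrullDim at hd
  rw [Order.krullDim_eq_iSup_height_add_coheight_of_nonempty] at hd
  have hd : (⨆ a : PrimeSpectrum R, Order.height a + Order.coheight a) = (d : ℕ∞) := by
    exact_mod_cast hd
  have h3 := le_iSup (fun a : PrimeSpectrum R => Order.height a + Order.coheight a) ⟨p, hp⟩
  rw [hd] at h3
  unfold primeHt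
  have h4 : Order.height (⟨p, hp⟩ : PrimeSpectrum R) + f ≤ c + f := by
    refine le_trans (by gcongr) (h3.trans ?_)
    rw [← hcf]; push_cast; rfl
  exact (ENat.add_le_add_iff_right (ENat.coe_ne_top f)).1 h4

end Step7
end


noncomputable section

open scoped Pointwise TensorProduct
section Step8
variable {R : Type u} [CommRing R]

/-- `R_x / R` -/
abbrev Cx (x : R) : Type u :=
  Localization.Away x ⧸ LinearMap.range (Algebra.linearMap R (Localization.Away x))

variable {W : Type u} [AddCommGroup W] [Module R W]

/-- inclusion -/
abbrev ci (x : R) (W : Type u) [AddCommGroup W] [Module R W] : W →ₗ[R] Localization.Away x ⊗[R] W :=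
  TensorProduct.mk R (Localization.Away x) W 1

/-- projection -/
abbrev cq (x : R) (W : Type u) [AddCommGroup W] [Module R W] :
    Localization.Away x ⊗[R] W →ₗ[R] Cx x ⊗[R] W :=
  (Submodule.mkQ (LinearMap.range (Algebra.linearMap R (Localization.Away x)))).rTensor W

theorem cq_surj (x : R) : Function.Surjective (cq x W) :=
  LinearMap.rTensor_surjective _ (Submodule.mkQ_surjective _)

theorem ci_cq (x : R) : Function.Exact (ci x W) (cq x W) := by
  have h0 : Function.Exact (Algebra.linearMap R (Localization.Away x))
      (Submodule.mkQ (LinearMap.range (Algebra.linearMap R (Localization.Away x)))) := by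
    rw [LinearMap.exact_iff]; simp
  have h := rTensor_exact W h0 (Submodule.mkQ_surjective _)
  intro t
  rw [h t]
  have : ci x W = (Algebra.linearMap R (Localization.Away x)).rTensor W ∘ₗ
      (TensorProduct.lid R W).symm.toLinearMap := by
    ext w; simp
  rw [this]
  constructor
  · rintro ⟨a, rfl⟩
    exact ⟨TensorProduct.lid R W a, by simp⟩
  · rintro ⟨a, rfl⟩
    exact ⟨(TensorProduct.lid R W).symm a, rfl⟩

theorem ci_inj {x : R} (hx : IsSMulRegular W x) : Function.Injective (ci x W) := by
  rw [← LinearMap.ker_eq_bot, LinearMap.ker_eq_bot']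
  intro w hw
  obtain ⟨⟨c, k, rfl⟩, hc⟩ := (IsLocalizedModule.eq_zero_iff (Submonoid.powers x) (ci x W)).1 hw
  have := hx.pow k
  apply this
  change x ^ k • w = x ^ k • (0 : W)
  rw [smul_zero]; exact hc

theorem ax_bij (x : R) : Function.Bijective (fun z : Localization.Away x ⊗[R] W => x • z) := by
  have := IsLocalizedModule.map_units (S := Submonoid.powers x) (ci x W) ⟨x, 1, by simp⟩
  rw [Module.End.isUnit_iff] at this
  exact this

theorem ax_surj (x : R) (u : Localization.Away x ⊗[R] W) : ∃ (k : ℕ) (w : W), x ^ k • u = ci x W w := by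
  obtain ⟨⟨w, ⟨_, k, rfl⟩⟩, h⟩ := IsLocalizedModule.surj (Submonoid.powers x) (ci x W) u
  exact ⟨k, w, h⟩

theorem ax_pow_inj (x : R) (k : ℕ) {u v : Localization.Away x ⊗[R] W} (h : x ^ k • u = x ^ k • v) :
    u = v := by
  have : IsSMulRegular (Localization.Away x ⊗[R] W) x := (ax_bij x).1
  exact this.pow k h

theorem Qchain.congr (p I : Ideal R) (c : ℕ) : ∀ {N N' : Type u} [AddCommGroup N] [Module R N]
    [AddCommGroup N'] [Module R N'] (_ : N ≃ₗ[R] N'), Qchain p I c N → Qchain p I c N' := by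
  induction c with
  | zero =>
    rintro N N' _ _ _ _ e ⟨s, hs⟩
    refine ⟨e s, fun r => ?_⟩
    rw [← hs, ← map_smul, e.map_eq_zero_iff]
  | succ c ih =>
    rintro N N' _ _ _ _ e ⟨x, hx, hr, hQ⟩
    exact ⟨x, hx, (e.isSMulRegular_congr x).1 hr, ih (QuotSMulTop.congr x e) hQ⟩

theorem mem_quot {N : Type u} [AddCommGroup N] [Module R N] {x : R} {n : N} :
    (Submodule.Quotient.mk n : QuotSMulTop x N) = 0 ↔ ∃ m : N, x • m = n := by
  rw [Submodule.Quotient.mk_eq_zero, Submodule.mem_smul_pointwise_iff_exists]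
  simp

theorem quot_reg {N : Type u} [AddCommGroup N] [Module R N] {x y : R} 
    (hy : IsSMulRegular (QuotSMulTop x N) y) {n m : N} (h : y • n = x • m) : ∃ n', x • n' = n := by
  rw [← mem_quot]
  apply hy
  change y • Submodule.Quotient.mk n = y • (0 : QuotSMulTop x N)
  rw [smul_zero, ← Submodule.Quotient.mk_smul, mem_quot]
  exact ⟨m, h.symm⟩

theorem quot_reg_pow {N : Type u} [AddCommGroup N] [Module R N] {x y : R} (hx : IsSMulRegular N x)
    (hy : IsSMulRegular (QuotSMulTop x N) y) (k : ℕ) : ∀ {n m : N} (_ : y • n = x ^ k • m),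
     ∃ n', x ^ k • n' = n ∧ y • n' = m := by
  induction k with
  | zero => 
    intro n m h
    exact ⟨n, by simp, by simpa using h⟩
  | succ k ih =>
    intro n m h
    obtain ⟨n1, rfl⟩ := quot_reg hy (n := n) (m := x ^ k • m) (by rw [h, smul_smul, pow_succ'])
    have : y • n1 = x ^ k • m := by
      apply hx
      change x • y • n1 = x • x ^ k • m
      rw [smul_comm, h, smul_smul, pow_succ']
    obtain ⟨n', h1, h2⟩ := ih this
    exact ⟨n', by rw [← h1, smul_smul, pow_succ'], h2⟩

theorem swap_reg {N : Type u} [AddCommGroup N] [Module R N] {x y : R} (hx : IsSMulRegular N x)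
    (hy : IsSMulRegular (QuotSMulTop x N) y) : IsSMulRegular (QuotSMulTop y N) x := by
  have hinj : Function.Injective (LinearMap.lsmul R (QuotSMulTop y N) x) := by
    rw [← LinearMap.ker_eq_bot, LinearMap.ker_eq_bot']
    intro t ht
    obtain ⟨n, rfl⟩ := Submodule.Quotient.mk_surjective _ t
    change (Submodule.Quotient.mk (x • n) : QuotSMulTop y N) = 0 at ht
    rw [mem_quot] at ht ⊢
    obtain ⟨m, hm⟩ := ht
    obtain ⟨m', rfl⟩ := quot_reg hy hm
    refine ⟨m', hx ?_⟩
    change x • y • m' = x • n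
    rw [smul_comm, hm]
  exact hinj

theorem C_reg {N : Type u} [AddCommGroup N] [Module R N] {x y : R} (hx : IsSMulRegular N x)
    (hy : IsSMulRegular (QuotSMulTop x N) y) : IsSMulRegular (Cx x ⊗[R] N) y := by
  have hinj : Function.Injective (LinearMap.lsmul R (Cx x ⊗[R] N) y) := by
    rw [← LinearMap.ker_eq_bot, LinearMap.ker_eq_bot']
    intro t ht
    obtain ⟨u, rfl⟩ := cq_surj x t
    rw [LinearMap.lsmul_apply, ← map_smul] at ht
    obtain ⟨m, hm⟩ := (ci_cq x _).1 ht
    obtain ⟨k, w, hw⟩ := ax_surj x u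
    have h1 : y • w = x ^ k • m := by
      apply ci_inj hx
      rw [map_smul, map_smul, ← hw, hm, smul_comm]
    obtain ⟨n', h2, h3⟩ := quot_reg_pow hx hy k h1
    have : u = ci x N n' := by
      apply ax_pow_inj x k
      rw [hw, ← h2, map_smul]
    rw [this]
    exact (ci_cq x _ ).2 ⟨_, rfl⟩
  exact hinj

/-- swap quotients -/
def quot_swap (N : Type u) [AddCommGroup N] [Module R N] (x y : R) :
    QuotSMulTop y (QuotSMulTop x N) ≃ₗ[R] QuotSMulTop x (QuotSMulTop y N) :=
  (QuotSMulTop.congr y (QuotSMulTop.equivQuotTensor x N)) ≪≫ₗ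
    (QuotSMulTop.tensorQuotSMulTopEquivQuotSMulTop y _ N).symm ≪≫ₗ
    (QuotSMulTop.equivQuotTensor x _).symm

theorem Qchain_C (p I : Ideal R) (x : R) (c : ℕ) : ∀ (N : Type u) [AddCommGroup N] [Module R N]
    (_ : IsSMulRegular N x), Qchain p I c (QuotSMulTop x N) → Qchain p I c (Cx x ⊗[R] N) := by
  induction c with
  | zero =>
    rintro N _ _ hx ⟨s, hs⟩
    obtain ⟨n, rfl⟩ := Submodule.Quotient.mk_surjective _ s
    obtain ⟨u, hu⟩ := (ax_bij x).2 (ci x N n)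
    refine ⟨cq x N u, fun r => ?_⟩
    rw [← hs, ← Submodule.Quotient.mk_smul, mem_quot, ← map_smul, ci_cq x (r • u)]
    constructor
    · rintro ⟨m, hm⟩
      refine ⟨m, ci_inj hx ?_⟩
      rw [map_smul, hm, map_smul, ← hu, smul_comm]
    · rintro ⟨m, hm⟩
      refine ⟨m, (ax_bij x).1 ?_⟩
      change x • ci x N m = x • r • u
      rw [← map_smul, hm, map_smul, ← hu, smul_comm]
  | succ c ih =>
    rintro N _ _ hx ⟨y, hy, hr, hQ⟩
    refine ⟨y, hy, C_reg hx hr, ?_⟩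
    have := ih (QuotSMulTop y N) (swap_reg hx hr) (hQ.congr p I c (quot_swap N x y))
    exact this.congr p I c (QuotSMulTop.tensorQuotSMulTopEquivQuotSMulTop y (Cx x) N)

/-- Tor-vanishing against TR modules -/
def TT (R : Type u) [CommRing R] (N : Type u) [AddCommGroup N] [Module R N] : Prop :=
  ∀ (G X : Type u) [AddCommGroup G] [Module R G] [AddCommGroup X] [Module R X] (b : ℕ)
    (f : G →ₗ[R] (Fin b → R)) (g : (Fin b → R) →ₗ[R] X), Function.Injective f →
    Function.Exact f g → Function.Surjective g → TR R X → Function.Injective (f.rTensor N)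

theorem TT_R : TT R R := by
  intro G X _ _ _ _ b f g hf _ _ _
  exact Module.Flat.rTensor_preserves_injective_linearMap _ hf

variable [IsNoetherianRing R]

theorem TT.reg {N : Type u} [AddCommGroup N] [Module R N] (hN : TT R N) {x : R}
    (hx : IsSMulRegular N x) {Y : Type u} [AddCommGroup Y] [Module R Y] (hY : TR R Y) :
    IsSMulRegular (Y ⊗[R] N) x := by
  obtain ⟨X, _, _, b, ι, π, h1, h2, h3, hX⟩ := hY.exists_cosyz
  have hinj := hN Y X b ι π h1 h2 h3 hX
  have hF : IsSMulRegular ((Fin b → R) ⊗[R] N) x := by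
    have : Function.Injective ((LinearMap.lsmul R N x).lTensor (Fin b → R)) :=
      Module.Flat.lTensor_preserves_injective_linearMap _ hx
    have h4 : (LinearMap.lsmul R N x).lTensor (Fin b → R) = LinearMap.lsmul R ((Fin b → R) ⊗[R] N) x := by
      ext; simp
    rw [h4] at this
    exact this
  intro a b hab
  apply hinj
  apply hF
  change x • _ = x • _
  rw [← map_smul, ← map_smul]
  exact congrArg _ hab

theorem TT.C {N : Type u} [AddCommGroup N] [Module R N] (hN : TT R N) {x : R}
    (hx : IsSMulRegular N x) : TT R (Cx x ⊗[R] N) := by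
  intro G X _ _ _ _ b f g hf hfg hg hX
  have hinj := hN G X b f g hf hfg hg hX
  have hex := rTensor_exact N hfg hg
  have hXr := ci_inj (hN.reg hx hX)
  have hA : Function.Injective ((f.rTensor N).lTensor (Localization.Away x)) :=
    Module.Flat.lTensor_preserves_injective_linearMap _ hinj
  have main : Function.Injective ((f.rTensor N).lTensor (Cx x)) := by
    rw [← LinearMap.ker_eq_bot, LinearMap.ker_eq_bot']
    intro t ht
    obtain ⟨u, rfl⟩ := cq_surj x t
    have e1 : (f.rTensor N).lTensor (Cx x) (cq x _ u) = 
        cq x _ ((f.rTensor N).lTensor (Localization.Away x) u) := by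
      simp only [cq, ← LinearMap.comp_apply, LinearMap.lTensor_comp_rTensor, 
        LinearMap.rTensor_comp_lTensor]
    rw [e1] at ht
    obtain ⟨w, hw⟩ := (ci_cq x _).1 ht
    have e2 : ci x _ (g.rTensor N w) = 0 := by
      have : ci x _ (g.rTensor N w) = (g.rTensor N).lTensor (Localization.Away x) (ci x _ w) := by simp
      rw [this, hw, ← LinearMap.comp_apply, ← LinearMap.lTensor_comp, hex.linearMap_comp_eq_zero]
      simp
    have e3 : g.rTensor N w = 0 := hXr (by rw [e2, map_zero])
    obtain ⟨v, rfl⟩ := (hex w).1 e3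
    have : u = ci x _ v := by
      apply hA
      rw [← hw]; simp
    rw [this]
    exact (ci_cq x _).2 ⟨_, rfl⟩
  have e4 : f.rTensor (Cx x ⊗[R] N) = (TensorProduct.leftComm R (Cx x) (Fin b → R) N).toLinearMap ∘ₗ
      ((f.rTensor N).lTensor (Cx x)) ∘ₗ (TensorProduct.leftComm R G (Cx x) N).toLinearMap := by
    ext; simp
  rw [e4]
  simp only [LinearMap.coe_comp, LinearEquiv.coe_coe]
  exact (LinearEquiv.injective _).comp (main.comp (LinearEquiv.injective _))

theorem EV_C {N : Type u} [AddCommGroup N] [Module R N] (hN : TT R N) {x : R}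
    (hx : IsSMulRegular N x) {X Y : Type u} [AddCommGroup X] [Module R X]
    [AddCommGroup Y] [Module R Y] (hY : TR R Y) (hX : x ∈ II R X) {i : ℕ}
    (h : EV R X (Y ⊗[R] N) (i+2)) : EV R X (Y ⊗[R] (Cx x ⊗[R] N)) (i+1) := by
  have := EV.cov_right (ci_inj (hN.reg hx hY)) (ci_cq x) (cq_surj x) 
    (EV.of_II hX (ax_bij x) i) h
  exact this.congr_right (TensorProduct.leftComm R (Cx x) Y N)

theorem step8 (p I : Ideal R) (c : ℕ) : ∀ (N : Type u) [AddCommGroup N] [Module R N] (_ : TT R N)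
    (_ : Qchain p I c N), ∃ (L : Type u) (_ : AddCommGroup L) (_ : Module R L) (s : L),
    (∀ r : R, r • s = 0 ↔ r ∈ p) ∧ ∀ (X Y : Type u) [AddCommGroup X] [Module R X]
      [AddCommGroup Y] [Module R Y] (_ : TR R X) (_ : TR R Y) (_ : I ≤ II R X), 
      EV R X (Y ⊗[R] N) (c+1) → EV R X (Y ⊗[R] L) 1 := by
  induction c with
  | zero =>
    rintro N _ _ hN ⟨s, hs⟩
    exact ⟨N, _, _, s, hs, fun X Y _ _ _ _ _ _ _ h => h⟩
  | succ c ih =>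
    rintro N _ _ hN ⟨x, hx, hr, hQ⟩
    obtain ⟨L, _, _, s, hs, hL⟩ := ih (Cx x ⊗[R] N) (hN.C hr) (Qchain_C p I x c N hr hQ)
    exact ⟨L, _, _, s, hs, fun X Y _ _ _ _ hX hY hI h => 
      hL X Y hX hY hI (EV_C hN hr hY (hI hx) h)⟩

theorem step8' (p I : Ideal R) (c : ℕ) 
    (hQ : Qchain p I c R) : ∃ (L : Type u) (_ : AddCommGroup L) (_ : Module R L) (s : L),
    (∀ r : R, r • s = 0 ↔ r ∈ p) ∧ ∀ (X Y : Type u) [AddCommGroup X] [Module R X]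
      [AddCommGroup Y] [Module R Y] (_ : TR R X) (_ : TR R Y) (_ : I ≤ II R X), 
      EV R X Y (c+1) → EV R X (Y ⊗[R] L) 1 := by
  obtain ⟨L, _, _, s, hs, hL⟩ := step8 p I c R TT_R hQ
  exact ⟨L, _, _, s, hs, fun X Y _ _ _ _ hX hY hI h => 
      hL X Y hX hY hI (h.congr_right (TensorProduct.rid R Y).symm)⟩

end Step8
end


noncomputable section

open scoped Pointwise TensorProduct
section Step9
variable {R : Type u} [CommRing R]
variable {G F X Y : Type u} [AddCommGroup G] [Module R G] [AddCommGroup X] [Module R X]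
  [AddCommGroup Y] [Module R Y]

theorem inj_of_zero {A B : Type u} [AddCommMonoid A] [Module R A] [AddCommMonoid B] [Module R B]
    (f : A →ₗ[R] B) (h : ∀ a, f a = 0 → a = 0) : Function.Injective f := by
  intro a b hab
  have h1 : a + (-1 : R) • b = 0 := by
    apply h
    rw [map_add, map_smul, hab]
    nth_rewrite 1 [← one_smul R (f b)]
    rw [← add_smul]; simp
  have h2 : (-1 : R) • b + b = 0 := by
    nth_rewrite 2 [← one_smul R b]
    rw [← add_smul]; simp
  calc a = a + ((-1 : R) • b + b) := by rw [h2, add_zero]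
    _ = b := by rw [← add_assoc, h1, zero_add]

theorem dt_nat {A B : Type u} [AddCommGroup A] [Module R A] [AddCommGroup B] [Module R B]
    (ι : A →ₗ[R] B) (t : Module.Dual R B ⊗[R] Y) :
    dualTensorHom R A Y ((Module.Dual.transpose (R := R) ι).rTensor Y t) = dualTensorHom R B Y t ∘ₗ ι := by
  induction t with
  | zero => simp
  | add a b ha hb => rw [map_add, map_add, ha, hb, map_add, LinearMap.add_comp]
  | tmul f y => ext a; simp [Module.Dual.transpose_apply]

theorem dt_free (b : ℕ) : Function.Bijective (dualTensorHom R (Fin b → R) Y) := 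
  (dualTensorHomEquiv R (Fin b → R) Y).bijective

theorem dt_surj {b : ℕ} {ι : G →ₗ[R] (Fin b → R)} {π : (Fin b → R) →ₗ[R] X} (h1 : Function.Injective ι)
    (h2 : Function.Exact ι π) (h3 : Function.Surjective π) (hX : EV R X Y 1) :
    Function.Surjective (dualTensorHom R G Y) := by
  intro φ
  obtain ⟨ψ, rfl⟩ := EV.extend h1 h2 h3 hX φ
  obtain ⟨t, rfl⟩ := (dt_free b).2 ψ
  exact ⟨_, dt_nat ι t⟩

theorem dt_inj {b : ℕ} {ι : G →ₗ[R] (Fin b → R)} {π : (Fin b → R) →ₗ[R] X} (h1 : Function.Injective ι)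
    (h2 : Function.Exact ι π) (h3 : Function.Surjective π) (hX : EV R X R 1) 
    (hs : Function.Surjective (dualTensorHom R X Y)) :
    Function.Injective (dualTensorHom R G Y) := by
  refine inj_of_zero (dualTensorHom R G Y) ?_
  intro t ht
  have hsurj : Function.Surjective (Module.Dual.transpose (R := R) ι) := by
    intro φ
    obtain ⟨ψ, hψ⟩ := EV.extend h1 h2 h3 hX φ
    exact ⟨ψ, hψ⟩
  obtain ⟨w, rfl⟩ := LinearMap.rTensor_surjective Y hsurj t
  rw [dt_nat] at ht
  obtain ⟨ψ, hψ⟩ := exact_desc h2 h3 _ ht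
  obtain ⟨v, rfl⟩ := hs ψ
  rw [← dt_nat] at hψ
  rw [← (dt_free b).1 hψ, ← LinearMap.comp_apply, ← LinearMap.rTensor_comp]
  have : Module.Dual.transpose (R := R) ι ∘ₗ Module.Dual.transpose (R := R) π = 0 := by
    ext f a
    simp [Module.Dual.transpose_apply, h2.apply_apply_eq_zero]
  rw [this]; simp

variable [IsNoetherianRing R]

theorem core (hG : TR R G) (p : Ideal R) (hp : p.IsPrime) (hI : II R G ≤ p) (e : ℕ)
    (hQ : Qchain p (II R G) (e+2) R) (hE : EV R G G (e+1)) : False := by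
  obtain ⟨L, _, _, s, hs, hL⟩ := step8' p (II R G) (e+2) hQ
  have hLR : ∀ (X : Type u) [AddCommGroup X] [Module R X] (_ : TR R X) (_ : II R G ≤ II R X), 
      EV R X L 1 := by
    intro X _ _ hX hle
    exact (hL X R hX TR.of_projective hle (hX.ev _)).congr_right (TensorProduct.lid R L)
  obtain ⟨X1, _, _, b1, ι1, π1, a1, a2, a3, hX1⟩ := hG.exists_cosyz
  obtain ⟨X2, _, _, b2, ι2, π2, a4, a5, a6, hX2⟩ := hX1.exists_cosyz
  have l1 : II R G ≤ II R X1 := II_le_of_exact a1 a2 a3 (hX1.ev 0)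
  have l2 : II R G ≤ II R X2 := l1.trans (II_le_of_exact a4 a5 a6 (hX2.ev 0))
  obtain ⟨Z1, _, _, c1, ι3, π3, b1, b2, b3, hZ1⟩ := hG.dual.exists_cosyz
  obtain ⟨Z2, _, _, c2, ι4, π4, b4, b5, b6, hZ2⟩ := hZ1.exists_cosyz
  have l3 : II R G ≤ II R Z1 := II_le_dual.trans (II_le_of_exact b1 b2 b3 (hZ1.ev 0))
  have l4 : II R G ≤ II R Z2 := l3.trans (II_le_of_exact b4 b5 b6 (hZ2.ev 0))
  have hE1 : EV R X1 G (e+2) := EV.right a1 a2 a3 hE (EV.of_projective _)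
  have hE2 : EV R X2 G (e+3) := EV.right a4 a5 a6 hE1 (EV.of_projective _)
  have s2 : Function.Surjective (dualTensorHom R G L) := dt_surj a1 a2 a3 (hLR X1 hX1 l1)
  have s1 : Function.Injective (dualTensorHom R G (G ⊗[R] L)) :=
    dt_inj a1 a2 a3 (hX1.ev 0) (dt_surj a4 a5 a6 (hL X2 G hX2 hG l2 hE2))
  have s3 : Function.Injective (dualTensorHom R (Module.Dual R G) L) :=
    dt_inj b1 b2 b3 (hZ1.ev 0) (dt_surj b4 b5 b6 (hLR Z2 hZ2 l4))
  have := hG.fin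
  obtain ⟨g, l, hl, hg⟩ := step6 p hI
  have hgs : g ⊗ₜ[R] s = 0 := by
    have h1 : (Module.Dual.eval R G g) ⊗ₜ[R] s = 0 := by
      apply s3
      rw [map_zero]
      ext f
      simp [(hs _).2 (hg f)]
    let ev : G ≃ₗ[R] Module.Dual R (Module.Dual R G) := LinearEquiv.ofBijective _ hG.refl
    have h2 := congrArg (ev.symm.toLinearMap.rTensor L) h1
    rw [map_zero, LinearMap.rTensor_tmul] at h2
    have h3 : ev.symm.toLinearMap (Module.Dual.eval R G g) = g := ev.symm_apply_apply g
    rwa [h3] at h2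
  let m : (R ⧸ p) →ₗ[R] L := Submodule.liftQ p (LinearMap.toSpanSingleton R L s) (fun r hr => (hs r).2 hr)
  have hm : ∀ r : R, m (Submodule.Quotient.mk r) = r • s := fun r => rfl
  obtain ⟨t, ht⟩ := s2 (m ∘ₗ l)
  have k1 : ∀ t : Module.Dual R G ⊗[R] L, dualTensorHom R G (G ⊗[R] L) 
      ((TensorProduct.mk R G L g).lTensor (Module.Dual R G) t)
      = TensorProduct.mk R G L g ∘ₗ dualTensorHom R G L t := by
    intro t
    induction t with
    | zero => simp
    | add a b ha hb => rw [map_add, map_add, ha, hb, map_add, LinearMap.comp_add]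
    | tmul f y => ext a; simp
  have k2 : ∀ t : Module.Dual R G ⊗[R] L, TensorProduct.lid R L ((contractLeft R G).rTensor L
      ((TensorProduct.assoc R (Module.Dual R G) G L).symm 
        ((TensorProduct.mk R G L g).lTensor (Module.Dual R G) t))) = dualTensorHom R G L t g := by
    intro t
    induction t with
    | zero => simp
    | add a b ha hb => simp only [map_add, ha, hb, LinearMap.add_apply]
    | tmul f y => simp
  have k3 : (TensorProduct.mk R G L g).lTensor (Module.Dual R G) t = 0 := by
    apply s1
    rw [k1, ht, map_zero]
    ext g'
    obtain ⟨r, hr⟩ := Submodule.Quotient.mk_surjective p (l g')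
    rw [LinearMap.comp_apply, LinearMap.comp_apply, ← hr, hm, TensorProduct.mk_apply, 
      TensorProduct.tmul_smul, hgs, smul_zero]; rfl
  have k4 := k2 t
  rw [k3, ht] at k4
  simp only [map_zero] at k4
  obtain ⟨r, hr⟩ := Submodule.Quotient.mk_surjective p (l g)
  rw [LinearMap.comp_apply, ← hr, hm] at k4
  apply hl
  rw [← hr, Submodule.Quotient.mk_eq_zero]
  exact (hs r).1 k4.symm

end Step9
end


noncomputable section

section Final
variable {R : Type u} [CommRing R] [IsLocalRing R] [IsNoetherianRing R]

theorem projective_of_II {G : Type u} [AddCommGroup G] [Module R G] (h : II R G = ⊤) :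
    Module.Projective R G := by
  have h1 : (1 : R) ∈ II R G := by rw [h]; trivial
  obtain ⟨P, _, _, _, _, a, b, hab⟩ := h1
  exact Module.Projective.of_split a b (by rw [hab, one_smul])

theorem final_ind {d n : ℕ} (hCM : IsCMLocalOfDim R d) (k : ℕ) (hk : k < n) :
    ∀ (M : Type u) [AddCommGroup M] [Module R M] [Module.Finite R M]
    (_ : GdimLE R k (ModuleCat.of R M))
    (_ : ∀ (p : Ideal R) (hp : p.IsPrime), primeHt R p hp ≤ (n : ℕ∞) → ∃ m, LPD R p M m)
    (_ : ∀ i : ℕ, n ≤ i → i + 1 ≤ d → EV R M M i), FinitePd R M := by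
  induction k with
  | zero =>
    intro G _ _ _ hG hloc hext
    have hG : TR R G := TR_iff.2 hG
    by_cases hI : II R G = ⊤
    · exact ⟨0, projective_of_II hI⟩
    · exfalso
      obtain ⟨c, hcd, p, hp, hIp, hQ, hht⟩ := step7 hCM _ hI
      have hnc : n < c := by
        by_contra hcon
        obtain ⟨m, hm⟩ := hloc p hp (hht.trans (by exact_mod_cast not_lt.1 hcon))
        exact LPD_II p m G hG hm hIp
      obtain ⟨e, rfl⟩ : ∃ e, c = e + 2 := ⟨c - 2, by omega⟩
      exact core hG p hp hIp e hQ (hext (e+1) (by omega) (by omega))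
  | succ k ih =>
    intro M _ _ _ hG hloc hext
    obtain ⟨b, q, hq⟩ := exists_fin_surj R M
    obtain ⟨m, hm⟩ := ih (by omega) (LinearMap.ker q) (GdimLE.syz q hq hG) (by
      intro p hp hht
      obtain ⟨m, hm⟩ := hloc p hp hht
      exact ⟨m, LPD_syz p q hq (LPD_mono p (Nat.le_succ m) hm)⟩) (by
      intro i hi hid
      have h1 : EV R M (LinearMap.ker q) (i+1) := 
        EV.cov_left (LinearMap.ker q).injective_subtype (ker_exact q) hq (hext i hi hid)
          ((hG.ev (i+1) (by omega)).pi_right b)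
      obtain ⟨j, rfl⟩ : ∃ j, i = j + 1 := ⟨i - 1, by omega⟩
      exact EV.left (LinearMap.ker q).injective_subtype (ker_exact q) hq (EV.of_projective j) h1)
    exact ⟨m+1, ModuleCat.of R (Fin b → R), q, (inferInstance : Module.Projective R (Fin b → R)), hq, hm⟩

end Final
end

theorem stmt6 (R : Type u) [CommRing R] [IsLocalRing R] [IsNoetherianRing R] (d n : ℕ)
    (hd : 2 ≤ d) (hCM : IsCMLocalOfDim R d) (hn1 : 1 ≤ n) (hn2 : n ≤ d - 1)
    (M : Type u) [AddCommGroup M] [Module R M] [Module.Finite R M]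
    (hG : GdimLE R (n - 1) (ModuleCat.of R M))
    (hloc : ∀ (p : Ideal R) (hp : p.IsPrime), primeHt R p hp ≤ (n : ℕ∞) →
      FinitePd (Localization.AtPrime p) (LocalizedModule p.primeCompl M))
    (hext : ∀ i : ℕ, n ≤ i → i ≤ d - 1 →
      Subsingleton (ExtMod R (ModuleCat.of R M) (ModuleCat.of R M) i)) :
    FinitePd R M := by
  refine final_ind (n := n) hCM (n - 1) (by omega) M hG ?_ ?_
  · intro p hp hht
    obtain ⟨m, hm⟩ := hloc p hp hht
    exact ⟨m, hm.hasPD⟩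
  · intro i hi hid
    exact (EV_iff i).2 (hext i hi (by omega))
end

section
/- Let R be a Cohen-Macaulay local ring of dimension d ≥ 2 and M a maximal Cohen-Macaulay finitely generated R-module of finite Gorenstein dimension. Let 1 ≤ n ≤ d−1 be an integer such that M_p has finite projective dimension over R_p for all primes p of height at most n. If Ext^i_R(M,M) = 0 for all n ≤ i ≤ d−1, then M is free. -/
open CategoryTheory Opposite

universe u

abbrev EE (R : Type u) [CommRing R] (A N : Type u) [AddCommGroup A] [Module R A]
    [AddCommGroup N] [Module R N] (i : ℕ) : Type u :=
  Abelian.Ext (ModuleCat.of R A) (ModuleCat.of R N) i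

namespace EE
open Abelian
section
variable {R : Type u} [CommRing R]
variable {A B C X Y N N' N'' A' B' C' : Type u}
  [AddCommGroup A] [Module R A] [AddCommGroup B] [Module R B] [AddCommGroup C] [Module R C]
  [AddCommGroup A'] [Module R A'] [AddCommGroup B'] [Module R B'] [AddCommGroup C'] [Module R C']
  [AddCommGroup X] [Module R X] [AddCommGroup Y] [Module R Y]
  [AddCommGroup N] [Module R N] [AddCommGroup N'] [Module R N'] [AddCommGroup N''] [Module R N'']

/-- pushforward on Ext -/
noncomputable def push (X : Type u) [AddCommGroup X] [Module R X] (i : ℕ) (f : N →ₗ[R] N') :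
    EE R X N i →ₗ[R] EE R X N' i where
  toFun x := x.comp (Ext.mk₀ (ModuleCat.ofHom f)) (add_zero i)
  map_add' x y := by simp
  map_smul' r x := by simp

noncomputable def pull (N : Type u) [AddCommGroup N] [Module R N] (i : ℕ) (f : X →ₗ[R] Y) :
    EE R Y N i →ₗ[R] EE R X N i where
  toFun x := (Ext.mk₀ (ModuleCat.ofHom f)).comp x (zero_add i)
  map_add' x y := by simp
  map_smul' r x := by simp

lemma push_comp (i : ℕ) (f : N →ₗ[R] N') (g : N' →ₗ[R] N'') (x : EE R X N i) :
    push X i (g ∘ₗ f) x = push X i g (push X i f x) := by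
  simp only [push, LinearMap.coe_mk, AddHom.coe_mk]
  rw [Ext.comp_assoc_of_third_deg_zero, Ext.mk₀_comp_mk₀, ← ModuleCat.ofHom_comp]

lemma push_id (i : ℕ) (x : EE R X N i) : push X i (LinearMap.id : N →ₗ[R] N) x = x := by
  simp only [push, LinearMap.coe_mk, AddHom.coe_mk]
  rw [ModuleCat.ofHom_id, Ext.comp_mk₀_id]

lemma push_add (i : ℕ) (f g : N →ₗ[R] N') (x : EE R X N i) :
    push X i (f + g) x = push X i f x + push X i g x := by
  simp only [push, LinearMap.coe_mk, AddHom.coe_mk]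
  rw [ModuleCat.ofHom_add, Ext.mk₀_add, Ext.comp_add]

lemma push_smul (i : ℕ) (r : R) (f : N →ₗ[R] N') (x : EE R X N i) :
    push X i (r • f) x = r • push X i f x := by
  simp only [push, LinearMap.coe_mk, AddHom.coe_mk]
  have : ModuleCat.ofHom (r • f) = r • ModuleCat.ofHom f := rfl
  rw [this, Ext.mk₀_smul, Ext.comp_smul]

noncomputable def pushL (X N N' : Type u) [AddCommGroup X] [Module R X] [AddCommGroup N] [Module R N]
    [AddCommGroup N'] [Module R N'] (i : ℕ) (x : EE R X N i) :
    (N →ₗ[R] N') →ₗ[R] EE R X N' i where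
  toFun f := push X i f x
  map_add' f g := push_add i f g x
  map_smul' r f := push_smul i r f x

lemma push_zero (i : ℕ) (x : EE R X N i) : push X i (0 : N →ₗ[R] N') x = 0 :=
  (pushL X N N' i x).map_zero
lemma push_sum {ι : Type*} (s : Finset ι) (i : ℕ) (f : ι → (N →ₗ[R] N')) (x : EE R X N i) :
    push X i (∑ j ∈ s, f j) x = ∑ j ∈ s, push X i (f j) x :=
  map_sum (pushL X N N' i x) f s

lemma push_sub (i : ℕ) (f g : N →ₗ[R] N') (x : EE R X N i) :
    push X i (f - g) x = push X i f x - push X i g x :=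
  (pushL X N N' i x).map_sub f g

lemma push_smul_id (i : ℕ) (r : R) (x : EE R X N i) :
    push X i (r • (LinearMap.id : N →ₗ[R] N)) x = r • x := by
  rw [push_smul, push_id]

lemma pull_comp (i : ℕ) (f : A →ₗ[R] B) (g : B →ₗ[R] C) (x : EE R C N i) :
    pull N i (g ∘ₗ f) x = pull N i f (pull N i g x) := by
  simp only [pull, LinearMap.coe_mk, AddHom.coe_mk]
  rw [← Ext.comp_assoc_of_second_deg_zero, Ext.mk₀_comp_mk₀, ← ModuleCat.ofHom_comp]

lemma pull_id (i : ℕ) (x : EE R X N i) : pull N i (LinearMap.id : X →ₗ[R] X) x = x := by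
  simp only [pull, LinearMap.coe_mk, AddHom.coe_mk]
  rw [ModuleCat.ofHom_id, Ext.mk₀_id_comp]

lemma pull_smul (i : ℕ) (r : R) (f : X →ₗ[R] Y) (x : EE R Y N i) :
    pull N i (r • f) x = r • pull N i f x := by
  simp only [pull, LinearMap.coe_mk, AddHom.coe_mk]
  have : ModuleCat.ofHom (r • f) = r • ModuleCat.ofHom f := rfl
  rw [this, Ext.mk₀_smul, Ext.smul_comp]

lemma pull_zero (i : ℕ) (x : EE R Y N i) : pull N i (0 : X →ₗ[R] Y) x = 0 := by
  have := pull_smul i (0 : R) (0 : X →ₗ[R] Y) x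
  simpa using this

lemma pull_smul_id (i : ℕ) (r : R) (x : EE R X N i) :
    pull N i (r • (LinearMap.id : X →ₗ[R] X)) x = r • x := by
  rw [pull_smul, pull_id]

lemma smul_eq_zero_of_ann (i : ℕ) (r : R) (h : ∀ a : X, r • a = 0) (x : EE R X N i) :
    r • x = 0 := by
  rw [← pull_smul_id]
  have : r • (LinearMap.id : X →ₗ[R] X) = 0 := by ext a; simpa using h a
  rw [this, pull_zero]

/-- short exact sequences -/
structure SES (f : A →ₗ[R] B) (g : B →ₗ[R] C) : Prop where
  inj : Function.Injective f
  ex : Function.Exact f g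
  surj : Function.Surjective g

lemma SES.zero {f : A →ₗ[R] B} {g : B →ₗ[R] C} (h : SES f g) : g ∘ₗ f = 0 :=
  h.ex.linearMap_comp_eq_zero

abbrev SES.S {f : A →ₗ[R] B} {g : B →ₗ[R] C} (h : SES f g) : ShortComplex (ModuleCat.{u} R) :=
  ShortComplex.mk (ModuleCat.ofHom f) (ModuleCat.ofHom g) (by
    rw [← ModuleCat.ofHom_comp, h.zero]; rfl)

lemma SES.short {f : A →ₗ[R] B} {g : B →ₗ[R] C} (h : SES f g) : h.S.ShortExact where
  exact := by
    rw [ShortComplex.ShortExact.moduleCat_exact_iff_function_exact]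
    exact h.ex
  mono_f := (ModuleCat.mono_iff_injective _).mpr h.inj
  epi_g := (ModuleCat.epi_iff_surjective _).mpr h.surj

noncomputable def SES.delta {f : A →ₗ[R] B} {g : B →ₗ[R] C} (h : SES f g)
    (X : Type u) [AddCommGroup X] [Module R X] (i : ℕ) : EE R X C i →ₗ[R] EE R X A (i+1) where
  toFun x := x.comp h.short.extClass rfl
  map_add' x y := by simp
  map_smul' r x := by simp

lemma SES.exact₂ {f : A →ₗ[R] B} {g : B →ₗ[R] C} (h : SES f g) {i : ℕ} (x : EE R X B i)
    (hx : push X i g x = 0) : ∃ y, push X i f y = x :=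
  Ext.covariant_sequence_exact₂ _ h.short x hx

lemma SES.exact₃ {f : A →ₗ[R] B} {g : B →ₗ[R] C} (h : SES f g) {i : ℕ} (x : EE R X C i)
    (hx : h.delta X i x = 0) : ∃ y, push X i g y = x :=
  Ext.covariant_sequence_exact₃ _ h.short x rfl hx

lemma SES.exact₁ {f : A →ₗ[R] B} {g : B →ₗ[R] C} (h : SES f g) {i : ℕ} (x : EE R X A (i+1))
    (hx : push X (i+1) f x = 0) : ∃ y, h.delta X i y = x :=
  Ext.covariant_sequence_exact₁ _ h.short x hx rfl

lemma SES.delta_push {f : A →ₗ[R] B} {g : B →ₗ[R] C} (h : SES f g) {i : ℕ} (x : EE R X B i) :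
    h.delta X i (push X i g x) = 0 := by
  simp only [SES.delta, push, LinearMap.coe_mk, AddHom.coe_mk]
  rw [Ext.comp_assoc_of_second_deg_zero]
  have := h.short.comp_extClass
  exact (congrArg (fun t => x.comp t (rfl : i + 1 = i+1)) this).trans (by simp)

lemma SES.push_delta {f : A →ₗ[R] B} {g : B →ₗ[R] C} (h : SES f g) {i : ℕ} (x : EE R X C i) :
    push X (i+1) f (h.delta X i x) = 0 := by
  simp only [SES.delta, push, LinearMap.coe_mk, AddHom.coe_mk]
  rw [Ext.comp_assoc_of_third_deg_zero]
  have := h.short.extClass_comp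
  exact (congrArg (fun t => x.comp t (rfl : i + 1 = i+1)) this).trans (by simp)

lemma SES.push_push {f : A →ₗ[R] B} {g : B →ₗ[R] C} (h : SES f g) {i : ℕ} (x : EE R X A i) :
    push X i g (push X i f x) = 0 := by
  rw [← push_comp, h.zero, push_zero]

lemma SES.delta_nat {f : A →ₗ[R] B} {g : B →ₗ[R] C} (h : SES f g)
    {f' : A' →ₗ[R] B'} {g' : B' →ₗ[R] C'} (h' : SES f' g') (a : A →ₗ[R] A') (b : B →ₗ[R] B')
    (c : C →ₗ[R] C') (h1 : f' ∘ₗ a = b ∘ₗ f) (h2 : g' ∘ₗ b = c ∘ₗ g) {i : ℕ} (x : EE R X C i) :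
    push X (i+1) a (h.delta X i x) = h'.delta X i (push X i c x) := by
  simp only [SES.delta, push, LinearMap.coe_mk, AddHom.coe_mk]
  rw [Ext.comp_assoc_of_third_deg_zero, Ext.comp_assoc_of_second_deg_zero]
  let F : h.S ⟶ h'.S := ShortComplex.homMk (ModuleCat.ofHom a) (ModuleCat.ofHom b) (ModuleCat.ofHom c)
    (by simp only [← ModuleCat.ofHom_comp]; rw [h1])
    (by simp only [← ModuleCat.ofHom_comp]; rw [h2])
  have := ShortComplex.ShortExact.extClass_naturality h.short h'.short F
  exact congrArg (fun t => x.comp t (rfl : i + 1 = i+1)) this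

/-- contravariant connecting map -/
noncomputable def SES.codelta {f : A →ₗ[R] B} {g : B →ₗ[R] C} (h : SES f g)
    (N : Type u) [AddCommGroup N] [Module R N] (i : ℕ) : EE R A N i →ₗ[R] EE R C N (i+1) where
  toFun x := h.short.extClass.comp x (add_comm 1 i)
  map_add' x y := by simp
  map_smul' r x := by simp

lemma SES.coexact₂ {f : A →ₗ[R] B} {g : B →ₗ[R] C} (h : SES f g) {i : ℕ} (x : EE R B N i)
    (hx : pull N i f x = 0) : ∃ y, pull N i g y = x :=
  Ext.contravariant_sequence_exact₂ h.short _ x hx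

lemma SES.coexact₁ {f : A →ₗ[R] B} {g : B →ₗ[R] C} (h : SES f g) {i : ℕ} (x : EE R A N i)
    (hx : h.codelta N i x = 0) : ∃ y, pull N i f y = x :=
  Ext.contravariant_sequence_exact₁ h.short _ x (add_comm 1 i) hx

lemma SES.coexact₃ {f : A →ₗ[R] B} {g : B →ₗ[R] C} (h : SES f g) {i : ℕ} (x : EE R C N (i+1))
    (hx : pull N (i+1) g x = 0) : ∃ y, h.codelta N i y = x :=
  Ext.contravariant_sequence_exact₃ h.short _ x hx (add_comm 1 i)

/-- degree zero -/
noncomputable def zeroEquiv (X N : Type u) [AddCommGroup X] [Module R X] [AddCommGroup N] [Module R N] :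
    EE R X N 0 ≃ (X →ₗ[R] N) :=
  Ext.addEquiv₀.toEquiv.trans ModuleCat.homEquiv

lemma zeroEquiv_symm (g : X →ₗ[R] N) : (zeroEquiv X N).symm g = Ext.mk₀ (ModuleCat.ofHom g) := rfl

lemma push_zeroEquiv (f : N →ₗ[R] N') (g : X →ₗ[R] N) :
    push X 0 f ((zeroEquiv X N).symm g) = (zeroEquiv X N').symm (f ∘ₗ g) := by
  simp only [zeroEquiv_symm, push, LinearMap.coe_mk, AddHom.coe_mk, Ext.mk₀_comp_mk₀]
  rw [ModuleCat.ofHom_comp]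

lemma pull_zeroEquiv (f : X →ₗ[R] Y) (g : Y →ₗ[R] N) :
    pull N 0 f ((zeroEquiv Y N).symm g) = (zeroEquiv X N).symm (g ∘ₗ f) := by
  simp only [zeroEquiv_symm, pull, LinearMap.coe_mk, AddHom.coe_mk, Ext.mk₀_comp_mk₀]
  rw [ModuleCat.ofHom_comp]

lemma sub_zero_iff : Subsingleton (EE R X N 0) ↔ ∀ f : X →ₗ[R] N, f = 0 := by
  rw [(zeroEquiv X N).subsingleton_congr]
  exact ⟨fun h f => Subsingleton.elim _ _, fun h => ⟨fun a b => (h a).trans (h b).symm⟩⟩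

/-- extension of maps -/
lemma SES.extend {f : A →ₗ[R] B} {g : B →ₗ[R] C} (h : SES f g) (hE : Subsingleton (EE R C N 1))
    (a : A →ₗ[R] N) : ∃ b : B →ₗ[R] N, b ∘ₗ f = a := by
  obtain ⟨y, hy⟩ := h.coexact₁ ((zeroEquiv A N).symm a) (Subsingleton.elim _ _)
  refine ⟨zeroEquiv B N y, ?_⟩
  rw [← (zeroEquiv B N).symm_apply_apply y, pull_zeroEquiv] at hy
  exact (zeroEquiv A N).symm.injective hy

lemma sub_of_projective [Module.Projective R X] (i : ℕ) : Subsingleton (EE R X N (i+1)) := by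
  have : Projective (ModuleCat.of R X) := (IsProjective.iff_projective X).mp inferInstance
  exact ⟨fun a b => (Ext.eq_zero_of_projective a).trans (Ext.eq_zero_of_projective b).symm⟩

lemma SES.ext1_sub {f : A →ₗ[R] B} {g : B →ₗ[R] C} (h : SES f g) (hB : Subsingleton (EE R B N 1))
    (H : ∀ a : A →ₗ[R] N, ∃ b : B →ₗ[R] N, b ∘ₗ f = a) : Subsingleton (EE R C N 1) := by
  refine ⟨fun x y => ?_⟩
  suffices ∀ x : EE R C N 1, x = 0 from (this x).trans (this y).symm
  intro x
  obtain ⟨y, rfl⟩ := h.coexact₃ x (Subsingleton.elim _ _)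
  obtain ⟨b, hb⟩ := H (zeroEquiv A N y)
  have : y = pull N 0 f ((zeroEquiv B N).symm b) := by
    rw [pull_zeroEquiv, hb, Equiv.symm_apply_apply]
  rw [this]
  simp only [SES.codelta, pull, LinearMap.coe_mk, AddHom.coe_mk]
  rw [← Ext.comp_assoc_of_second_deg_zero]
  have := h.short.extClass_comp
  exact (congrArg (fun t => t.comp ((zeroEquiv B N).symm b) (rfl : 1 + 0 = 1)) this).trans
    (Ext.zero_comp (X := ModuleCat.of R C) (Y := ModuleCat.of R B) (n := 1) ((zeroEquiv B N).symm b) 1 rfl)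

/-- long exact sequence vanishing lemmas -/
lemma sub_iff (i : ℕ) : Subsingleton (EE R X N i) ↔ ∀ x : EE R X N i, x = 0 :=
  ⟨fun _ x => Subsingleton.elim _ _, fun h => ⟨fun a b => (h a).trans (h b).symm⟩⟩

lemma SES.sub₂ {f : A →ₗ[R] B} {g : B →ₗ[R] C} (h : SES f g) {i : ℕ}
    (h1 : Subsingleton (EE R X A i)) (h3 : Subsingleton (EE R X C i)) :
    Subsingleton (EE R X B i) := by
  rw [sub_iff]; intro x
  obtain ⟨y, rfl⟩ := h.exact₂ x (Subsingleton.elim _ _)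
  rw [Subsingleton.elim y 0, map_zero]

lemma SES.sub₃ {f : A →ₗ[R] B} {g : B →ₗ[R] C} (h : SES f g) {i : ℕ}
    (h2 : Subsingleton (EE R X B i)) (h1 : Subsingleton (EE R X A (i+1))) :
    Subsingleton (EE R X C i) := by
  rw [sub_iff]; intro x
  obtain ⟨y, rfl⟩ := h.exact₃ x (Subsingleton.elim _ _)
  rw [Subsingleton.elim y 0, map_zero]

lemma SES.sub₁ {f : A →ₗ[R] B} {g : B →ₗ[R] C} (h : SES f g) {i : ℕ}
    (h3 : Subsingleton (EE R X C i)) (h2 : Subsingleton (EE R X B (i+1))) :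
    Subsingleton (EE R X A (i+1)) := by
  rw [sub_iff]; intro x
  obtain ⟨y, rfl⟩ := h.exact₁ x (Subsingleton.elim _ _)
  rw [Subsingleton.elim y 0, map_zero]

lemma sub_zero_of_inj {f : A →ₗ[R] B} (hf : Function.Injective f)
    (h : Subsingleton (EE R X B 0)) : Subsingleton (EE R X A 0) := by
  rw [sub_zero_iff] at *
  intro g
  have := h (f ∘ₗ g)
  ext x
  exact hf (by simpa using LinearMap.congr_fun this x)

lemma SES.cosub₂ {f : A →ₗ[R] B} {g : B →ₗ[R] C} (h : SES f g) {i : ℕ}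
    (h1 : Subsingleton (EE R A N i)) (h3 : Subsingleton (EE R C N i)) :
    Subsingleton (EE R B N i) := by
  rw [sub_iff]; intro x
  obtain ⟨y, rfl⟩ := h.coexact₂ x (Subsingleton.elim _ _)
  rw [Subsingleton.elim y 0, map_zero]

lemma SES.cosub₁ {f : A →ₗ[R] B} {g : B →ₗ[R] C} (h : SES f g) {i : ℕ}
    (h2 : Subsingleton (EE R B N i)) (h1 : Subsingleton (EE R C N (i+1))) :
    Subsingleton (EE R A N i) := by
  rw [sub_iff]; intro x
  obtain ⟨y, rfl⟩ := h.coexact₁ x (Subsingleton.elim _ _)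
  rw [Subsingleton.elim y 0, map_zero]

lemma SES.cosub₃ {f : A →ₗ[R] B} {g : B →ₗ[R] C} (h : SES f g) {i : ℕ}
    (h3 : Subsingleton (EE R A N i)) (h2 : Subsingleton (EE R B N (i+1))) :
    Subsingleton (EE R C N (i+1)) := by
  rw [sub_iff]; intro x
  obtain ⟨y, rfl⟩ := h.coexact₃ x (Subsingleton.elim _ _)
  rw [Subsingleton.elim y 0, map_zero]

lemma cosub_zero_of_surj {f : A →ₗ[R] B} (hf : Function.Surjective f)
    (h : Subsingleton (EE R A N 0)) : Subsingleton (EE R B N 0) := by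
  rw [sub_zero_iff] at *
  intro g
  have := h (g ∘ₗ f)
  ext x
  obtain ⟨y, rfl⟩ := hf x
  simpa using LinearMap.congr_fun this y

lemma sub_of_injective (h : Injective (ModuleCat.of R N)) (i : ℕ) : Subsingleton (EE R X N (i+1)) :=
  ⟨fun a b => (Ext.eq_zero_of_injective a).trans (Ext.eq_zero_of_injective b).symm⟩

lemma sub_congr_right (e : N ≃ₗ[R] N') (i : ℕ) (h : Subsingleton (EE R X N i)) :
    Subsingleton (EE R X N' i) := by
  rw [sub_iff]; intro x
  have : x = push X i e.toLinearMap (push X i e.symm.toLinearMap x) := by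
    rw [← push_comp]; simp [push_id]
  rw [this, Subsingleton.elim (push X i e.symm.toLinearMap x) 0, map_zero]

lemma sub_congr_left (e : X ≃ₗ[R] Y) (i : ℕ) (h : Subsingleton (EE R X N i)) :
    Subsingleton (EE R Y N i) := by
  rw [sub_iff]; intro x
  have : x = pull N i e.symm.toLinearMap (pull N i e.toLinearMap x) := by
    rw [← pull_comp]; simp [pull_id]
  rw [this, Subsingleton.elim (pull N i e.toLinearMap x) 0, map_zero]

lemma pi_ext {ι : Type} [Fintype ι] [DecidableEq ι] (i : ℕ) (x : EE R X (ι → N) i)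
    (h : ∀ j, push X i (LinearMap.proj j : (ι → N) →ₗ[R] N) x = 0) : x = 0 := by
  have : x = ∑ j : ι, push X i (LinearMap.single R (fun _ : ι => N) j)
      (push X i (LinearMap.proj j : (ι → N) →ₗ[R] N) x) := by
    simp_rw [← push_comp]
    rw [← push_sum]
    conv_lhs => rw [← push_id i x]
    have : (LinearMap.id : (ι → N) →ₗ[R] (ι → N)) = ∑ j : ι,
        (LinearMap.single R (fun _ : ι => N) j) ∘ₗ (LinearMap.proj j : (ι → N) →ₗ[R] N) := by
      apply LinearMap.ext; intro a
      funext b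
      simp [Pi.single_apply]
    rw [this]
  rw [this]
  simp [h]

lemma SES.ker {f : A →ₗ[R] B} (hf : Function.Surjective f) : SES (LinearMap.ker f).subtype f where
  inj := Subtype.val_injective
  ex := LinearMap.exact_subtype_ker_map f
  surj := hf

lemma SES.coker {f : A →ₗ[R] B} (hf : Function.Injective f) : SES f (LinearMap.range f).mkQ where
  inj := hf
  ex := LinearMap.exact_map_mkQ_range f
  surj := Submodule.mkQ_surjective _

end
end EE

namespace EE
open Abelian
variable {R : Type u} [CommRing R]

lemma extMod_iff (A N : ModuleCat.{u} R) (P : ProjectiveResolution A) (i : ℕ) :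
    Subsingleton (ExtMod R A N i) ↔ (P.complex.linearYonedaObj R N).ExactAt i := by
  rw [HomologicalComplex.exactAt_iff_isZero_homology]
  rw [← (P.isoExt i N).isZero_iff]
  exact (ModuleCat.isZero_iff_subsingleton (M := ExtMod R A N i)).symm

lemma bridge_succ (A N : ModuleCat.{u} R) (i : ℕ) :
    Subsingleton (ExtMod R A N (i+1)) ↔ Subsingleton (Abelian.Ext A N (i+1)) := by
  obtain ⟨P⟩ := HasProjectiveResolution.out (Z := A)
  rw [extMod_iff A N P, HomologicalComplex.exactAt_iff' _ i (i+1) (i+2) (by simp) (by simp),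
    ShortComplex.moduleCat_exact_iff]
  constructor
  · intro h
    suffices ∀ x : Abelian.Ext A N (i+1), x = 0 from ⟨fun a b => (this a).trans (this b).symm⟩
    intro x
    obtain ⟨f, hf, rfl⟩ := P.extMk_surjective x (i+2) rfl
    rw [P.extMk_eq_zero_iff f (i+2) rfl hf i rfl]
    obtain ⟨g, hg⟩ := h f hf
    exact ⟨g, hg⟩
  · intro h f hf
    have := Subsingleton.elim (P.extMk f (i+2) rfl hf) 0
    rw [P.extMk_eq_zero_iff f (i+2) rfl hf i rfl] at this
    exact this

lemma bridge_zero (A N : ModuleCat.{u} R) (h : Subsingleton (ExtMod R A N 0)) :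
    Subsingleton (Abelian.Ext A N 0) := by
  obtain ⟨P⟩ := HasProjectiveResolution.out (Z := A)
  rw [extMod_iff A N P, HomologicalComplex.exactAt_iff' _ 0 0 1 (by simp) (by simp),
    ShortComplex.moduleCat_exact_iff] at h
  rw [Ext.addEquiv₀.toEquiv.subsingleton_congr]
  suffices ∀ x : A ⟶ N, x = 0 from ⟨fun a b => (this a).trans (this b).symm⟩
  intro x
  let y : ((ChainComplex.single₀ (ModuleCat.{u} R)).obj A).X 0 ⟶ N := x
  have hd : P.complex.d 1 0 ≫ P.π.f 0 = 0 := P.complex_d_comp_π_f_zero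
  have hd2 : P.complex.d 1 0 ≫ (P.π.f 0 ≫ y) = 0 := by
    rw [← Category.assoc, hd, Limits.zero_comp]
  obtain ⟨g, hg⟩ := h (P.π.f 0 ≫ y) hd2
  have h0 : P.π.f 0 ≫ y = 0 := by
    rw [← hg]
    have : (P.complex.linearYonedaObj R N).d 0 0 = 0 := HomologicalComplex.shape _ _ _ (by simp)
    change (P.complex.linearYonedaObj R N).d 0 0 g = 0
    rw [this]; rfl
  have hq : Epi (P.π.f 0) := by
    have : ∀ n, Epi (P.π.f n) := inferInstance
    exact this 0
  have hy : y = 0 := by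
    rw [← cancel_epi (P.π.f 0), h0, Limits.comp_zero]
  exact hy

lemma bridge (A N : Type u) [AddCommGroup A] [Module R A] [AddCommGroup N] [Module R N] (i : ℕ)
    (h : Subsingleton (ExtMod R (ModuleCat.of R A) (ModuleCat.of R N) i)) : 
    Subsingleton (EE R A N i) := by
  cases i with
  | zero => exact bridge_zero _ _ h
  | succ i => exact (bridge_succ _ _ _).mp h

lemma depth_lt [IsLocalRing R] (N : Type u) [AddCommGroup N] [Module R N] (d : ℕ)
    (h : moduleDepth R (ModuleCat.of R N) = d) (j : ℕ) (hj : j < d) :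
    Subsingleton (EE R (IsLocalRing.ResidueField R) N j) := by
  apply bridge
  by_contra hc
  rw [not_subsingleton_iff_nontrivial] at hc
  have : moduleDepth R (ModuleCat.of R N) ≤ j := sInf_le ⟨j, rfl, hc⟩
  rw [h] at this
  exact absurd (Nat.cast_le.mp this) (by omega)

lemma depth_eq [IsLocalRing R] (N : Type u) [AddCommGroup N] [Module R N] (d : ℕ) (hd : 1 ≤ d)
    (h : moduleDepth R (ModuleCat.of R N) = d) :
    Nontrivial (EE R (IsLocalRing.ResidueField R) N d) := by
  obtain ⟨d, rfl⟩ : ∃ e, d = e + 1 := ⟨d - 1, by omega⟩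
  rw [← not_subsingleton_iff_nontrivial, ← bridge_succ, not_subsingleton_iff_nontrivial]
  have hne : {i : ℕ∞ | ∃ n : ℕ, i = n ∧
    Nontrivial (ExtMod R (ModuleCat.of R (IsLocalRing.ResidueField R)) (ModuleCat.of R N) n)}.Nonempty := by
    by_contra hc
    rw [Set.not_nonempty_iff_eq_empty] at hc
    rw [moduleDepth, hc, sInf_empty] at h
    exact absurd h.symm (ENat.natCast_ne_top _)
  obtain ⟨n, hn, hN⟩ := csInf_mem hne
  change moduleDepth R (ModuleCat.of R N) = n at hn
  rw [h] at hn
  have := Nat.cast_injective hn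
  rwa [this]
end EE

namespace EE
open Abelian
section
variable {R : Type u} [CommRing R]
variable {A B C X Y N K F G M Q : Type u}
  [AddCommGroup A] [Module R A] [AddCommGroup B] [Module R B] [AddCommGroup C] [Module R C]
  [AddCommGroup X] [Module R X] [AddCommGroup Y] [Module R Y]
  [AddCommGroup N] [Module R N] [AddCommGroup K] [Module R K] [AddCommGroup F] [Module R F]
  [AddCommGroup G] [Module R G] [AddCommGroup M] [Module R M] [AddCommGroup Q] [Module R Q]

lemma pi_sub (s : ℕ) (i : ℕ) (h : Subsingleton (EE R X N i)) :
    Subsingleton (EE R X (Fin s → N) i) := by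
  rw [sub_iff]; intro x
  exact pi_ext i x fun j => Subsingleton.elim _ _

lemma hom_free_sub (s : ℕ) (i : ℕ) (h : Subsingleton (EE R X N i)) :
    Subsingleton (EE R X ((Fin s → R) →ₗ[R] N) i) :=
  sub_congr_right (LinearEquiv.piRing R N (Fin s) R).symm i (pi_sub s i h)

lemma factor_surj (g : B →ₗ[R] C) (hg : Function.Surjective g) (φ : B →ₗ[R] N)
    (hk : LinearMap.ker g ≤ LinearMap.ker φ) : ∃ ψ : C →ₗ[R] N, ψ ∘ₗ g = φ := by
  refine ⟨(LinearMap.ker g).liftQ φ hk ∘ₗ (g.quotKerEquivOfSurjective hg).symm.toLinearMap, ?_⟩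
  ext b
  have : (g.quotKerEquivOfSurjective hg).symm (g b) = (LinearMap.ker g).mkQ b := by
    rw [LinearEquiv.symm_apply_eq]; rfl
  simp only [LinearMap.comp_apply, LinearEquiv.coe_coe, this]
  simp

lemma SES.hom {f : A →ₗ[R] B} {g : B →ₗ[R] C} (h : SES f g) (hE : Subsingleton (EE R C N 1)) :
    SES (LinearMap.lcomp R N g) (LinearMap.lcomp R N f) where
  inj := by
    intro a b hab
    apply LinearMap.ext; intro c
    obtain ⟨x, rfl⟩ := h.surj c
    exact LinearMap.congr_fun hab x
  ex := by
    intro φ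
    constructor
    · intro hφ
      have hφ' : φ ∘ₗ f = 0 := hφ
      have hk : LinearMap.ker g ≤ LinearMap.ker φ := by
        intro b hb
        obtain ⟨a, rfl⟩ := (h.ex b).mp hb
        exact LinearMap.congr_fun hφ' a
      obtain ⟨ψ, hψ⟩ := factor_surj g h.surj φ hk
      exact ⟨ψ, hψ⟩
    · rintro ⟨ψ, rfl⟩
      change (ψ ∘ₗ g) ∘ₗ f = 0
      rw [LinearMap.comp_assoc, h.zero, LinearMap.comp_zero]
  surj := fun a => h.extend hE a

def VV (R : Type u) [CommRing R] (X N : Type u) [AddCommGroup X] [Module R X] [AddCommGroup N] [Module R N] :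
  Prop := ∀ i, Subsingleton (EE R X N (i+1))

lemma VV.ker {f : A →ₗ[R] B} {g : B →ₗ[R] C} (h : SES f g) (hB : VV R B N) (hC : VV R C N) :
    VV R A N := fun i => h.cosub₁ (hB i) (hC (i+1))

lemma VV.proj [Module.Projective R X] : VV R X N := fun i => sub_of_projective i

lemma VV.congr (e : X ≃ₗ[R] Y) (h : VV R X N) : VV R Y N := fun i => sub_congr_left e _ (h i)

lemma hom_depth [IsNoetherianRing R] (j : ℕ) : ∀ (X : Type u) [AddCommGroup X] [Module R X] [Module.Finite R X]
    (_ : VV R X N) (_ : ∀ i ≤ j, Subsingleton (EE R Q N i)), Subsingleton (EE R Q (X →ₗ[R] N) j) := by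
  induction j with
  | zero =>
    intro X _ _ _ hX hQ
    obtain ⟨s, g, hg⟩ := Module.Finite.exists_fin' R X
    refine sub_zero_of_inj (((SES.ker hg).hom (N := N) (hX 0)).inj) (hom_free_sub s 0 (hQ 0 le_rfl))
  | succ j ih =>
    intro X _ _ _ hX hQ
    obtain ⟨s, g, hg⟩ := Module.Finite.exists_fin' R X
    refine ((SES.ker hg).hom (N := N) (hX 0)).sub₁ ?_ (hom_free_sub s (j+1) (hQ _ le_rfl))
    exact ih _ (VV.ker (SES.ker hg) VV.proj hX) fun i hi => hQ i (by omega)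

/-- embedding of a dual -/
lemma dualEmbed [IsNoetherianRing R] [Module.Finite R Y] (hY : VV R Y R) :
    ∃ (s : ℕ) (i : Module.Dual R Y →ₗ[R] (Fin s → R)) (Y1 : Type u) (_ : AddCommGroup Y1)
      (_ : Module R Y1) (q : (Fin s → R) →ₗ[R] Module.Dual R Y1),
      Module.Finite R Y1 ∧ VV R Y1 R ∧ SES i q ∧
      ∀ y : Y, ∃ b : (Fin s → R) →ₗ[R] R, ∀ φ, b (i φ) = φ y := by
  obtain ⟨s, g, hg⟩ := Module.Finite.exists_fin' R Y
  let e := LinearEquiv.piRing R R (Fin s) R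
  have h := (SES.ker hg).hom (N := R) (hY 0)
  refine ⟨s, e.toLinearMap ∘ₗ LinearMap.lcomp R R g, LinearMap.ker g, inferInstance, inferInstance,
    LinearMap.lcomp R R (LinearMap.ker g).subtype ∘ₗ e.symm.toLinearMap, inferInstance,
    VV.ker (SES.ker hg) VV.proj hY, ⟨?_, ?_, ?_⟩, ?_⟩
  · exact e.injective.comp h.inj
  · intro x
    have := h.ex (e.symm x)
    constructor
    · intro hx
      obtain ⟨y, hy⟩ := this.mp hx
      refine ⟨y, ?_⟩
      change e (LinearMap.lcomp R R g y) = x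
      rw [hy, LinearEquiv.apply_symm_apply]
    · rintro ⟨y, rfl⟩
      apply this.mpr
      exact ⟨y, (e.symm_apply_apply _).symm⟩
  · exact h.surj.comp e.symm.surjective
  · intro y
    obtain ⟨t, rfl⟩ := hg y
    refine ⟨LinearMap.applyₗ t ∘ₗ e.symm.toLinearMap, fun φ => ?_⟩
    change (e.symm (e (LinearMap.lcomp R R g φ))) t = _
    rw [LinearEquiv.symm_apply_apply]
    rfl

structure TR (R : Type u) [CommRing R] (M : Type u) [AddCommGroup M] [Module R M] : Prop where
  bij : Function.Bijective (Module.Dual.eval R M)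
  v : VV R M R
  vd : VV R (Module.Dual R M) R

instance [IsNoetherianRing R] [Module.Finite R X] [Module.Finite R N] : Module.Finite R (X →ₗ[R] N) := by
  obtain ⟨s, g, hg⟩ := Module.Finite.exists_fin' R X
  have : Function.Injective (LinearMap.lcomp R N g) := by
    intro a b hab
    apply LinearMap.ext; intro c
    obtain ⟨x, rfl⟩ := hg c
    exact LinearMap.congr_fun hab x
  exact Module.Finite.of_injective _ this

lemma trEmbed [IsNoetherianRing R] [Module.Finite R Y] (hY : TR R Y) :
    ∃ (s : ℕ) (i : Y →ₗ[R] (Fin s → R)) (Y1 : Type u) (_ : AddCommGroup Y1)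
      (_ : Module R Y1) (q : (Fin s → R) →ₗ[R] Module.Dual R Y1),
      Module.Finite R Y1 ∧ VV R Y1 R ∧ SES i q ∧
      ∀ y : Y →ₗ[R] R, ∃ b : (Fin s → R) →ₗ[R] R, b ∘ₗ i = y := by
  obtain ⟨s, i, Y1, _, _, q, h1, h2, h3, h4⟩ := dualEmbed (Y := Module.Dual R Y) hY.vd
  refine ⟨s, i ∘ₗ Module.Dual.eval R Y, Y1, inferInstance, inferInstance, q, h1, h2,
    ⟨h3.inj.comp hY.bij.1, ?_, h3.surj⟩, ?_⟩
  · intro x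
    rw [h3.ex x]
    constructor
    · rintro ⟨y, rfl⟩
      obtain ⟨z, rfl⟩ := hY.bij.2 y
      exact ⟨z, rfl⟩
    · rintro ⟨y, rfl⟩
      exact ⟨_, rfl⟩
  · intro y
    obtain ⟨b, hb⟩ := h4 y
    exact ⟨b, by ext z; exact hb _⟩

lemma TR.depth [IsNoetherianRing R] [Module.Finite R Y] (hY : TR R Y) (j : ℕ)
    (h : ∀ i ≤ j, Subsingleton (EE R Q R i)) : Subsingleton (EE R Q Y j) :=
  sub_congr_right (LinearEquiv.ofBijective _ hY.bij).symm j (hom_depth j _ hY.vd h)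


open IsLocalRing in
lemma key_ext [IsNoetherianRing R] [IsLocalRing R] [Module.Finite R K] [Module.Finite R G]
    (hK : TR R K) (hG : TR R G) {ι : K →ₗ[R] G} {g : G →ₗ[R] M} (h : SES ι g) (e : ℕ)
    (hR : ∀ j ≤ e, Subsingleton (EE R (ResidueField R) R j))
    (hR2 : Nontrivial (EE R (ResidueField R) R (e+1)))
    (hM : Subsingleton (EE R (ResidueField R) M e)) (ψ : K →ₗ[R] R) :
    ∃ χ : G →ₗ[R] R, χ ∘ₗ ι = ψ := by
  obtain ⟨s, i, Y1, _, _, q, hY1, vY1, hi, hext⟩ := trEmbed hK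
  obtain ⟨s1, i1, Z1, _, _, q1, hZ1, vZ1, hi1, -⟩ := trEmbed hG
  obtain ⟨s2, i2, Z2, _, _, q2, hZ2, vZ2, hi2, -⟩ := dualEmbed (R := R) vY1
  choose b hb using fun j => hext (LinearMap.proj j ∘ₗ i1 ∘ₗ ι)
  let A : Submodule R (Module.Dual R (Fin s → R)) :=
    Submodule.comap (LinearMap.lcomp R R i) (LinearMap.range (LinearMap.lcomp R R ι))
  have hA1 : ∀ j, b j ∈ A := fun j => ⟨(LinearMap.proj j : (Fin s1 → R) →ₗ[R] R) ∘ₗ i1, (hb j).symm⟩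
  have hA2 : ∀ j, (LinearMap.proj j ∘ₗ i2 ∘ₗ q) ∈ A := fun j => ⟨0, by
    change 0 = ((LinearMap.proj j ∘ₗ i2) ∘ₗ q) ∘ₗ i
    rw [LinearMap.comp_assoc, hi.zero, LinearMap.comp_zero]⟩
  suffices A = ⊤ by
    obtain ⟨φ, rfl⟩ := hext ψ
    have : φ ∈ A := this ▸ Submodule.mem_top
    obtain ⟨χ, hχ⟩ := this
    exact ⟨χ, hχ⟩
  by_contra hne
  obtain ⟨A', hA', hAA'⟩ := (eq_top_or_exists_le_coatom A).resolve_left hne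
  have hsimp : IsSimpleModule R (Module.Dual R (Fin s → R) ⧸ A') :=
    isSimpleModule_iff_isCoatom.mpr hA'
  obtain ⟨I, hI, ⟨eq⟩⟩ := isSimpleModule_iff_quot_maximal.mp hsimp
  obtain rfl := eq_maximalIdeal hI
  let lam := eq.toLinearMap ∘ₗ A'.mkQ
  obtain ⟨lam', hlam'⟩ := Module.projective_lifting_property
    (Submodule.mkQ (maximalIdeal R)) lam (Submodule.mkQ_surjective _)
  let E : Fin s → R := fun j => lam' (LinearMap.proj j)
  have hE : ∀ φ : Module.Dual R (Fin s → R), lam' φ = φ E := by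
    intro φ
    have : φ = ∑ j, φ (Pi.single j 1) • (LinearMap.proj j : (Fin s → R) →ₗ[R] R) := by
      apply LinearMap.pi_ext'
      intro j
      ext
      simp [Pi.single_apply]
    conv_lhs => rw [this]
    conv_rhs => rw [this]
    simp [E]
  have hmem : ∀ φ ∈ A, φ E ∈ maximalIdeal R := by
    intro φ hφ
    rw [← hE, ← Submodule.Quotient.mk_eq_zero]
    have : (Submodule.mkQ (maximalIdeal R)) (lam' φ) = lam φ := LinearMap.congr_fun hlam' φ
    change (Submodule.mkQ (maximalIdeal R)) (lam' φ) = 0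
    rw [this]
    have : A'.mkQ φ = 0 := by simpa using hAA' hφ
    simp [lam, this]
  obtain ⟨φ0, hφ0⟩ : ∃ φ : Module.Dual R (Fin s → R), φ E ∉ maximalIdeal R := by
    obtain ⟨φ, hφ⟩ := (eq.surjective.comp A'.mkQ_surjective) (Submodule.Quotient.mk 1)
    refine ⟨φ, fun hc => ?_⟩
    rw [← hE, ← Submodule.Quotient.mk_eq_zero] at hc
    have h1 : (Submodule.mkQ (maximalIdeal R)) (lam' φ) = lam φ := LinearMap.congr_fun hlam' φ
    have h2 : lam φ = Submodule.Quotient.mk 1 := hφ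
    have h3 : (Submodule.mkQ (maximalIdeal R)) (lam' φ) = 0 := hc
    rw [h1, h2, Submodule.Quotient.mk_eq_zero] at h3
    exact (Ideal.ne_top_iff_one _).mp hI.ne_top h3
  have hu : IsUnit (φ0 E) := by simpa using hφ0
  obtain ⟨z, hz⟩ := exists_ne (0 : EE R (ResidueField R) R (e+1))
  have hcomp : ∀ φ : (Fin s → R) →ₗ[R] R,
      push _ (e+1) φ (push _ (e+1) (LinearMap.toSpanSingleton R _ E) z) = φ E • z := by
    intro φ
    rw [← push_comp, ← push_smul_id]
    congr 2
    ext; simp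
  have hkill : ∀ φ ∈ A, push _ (e+1) φ (push _ (e+1) (LinearMap.toSpanSingleton R _ E) z) = 0 := by
    intro φ hφ
    rw [hcomp]
    apply smul_eq_zero_of_ann
    intro a
    obtain ⟨a, rfl⟩ := IsLocalRing.residue_surjective a
    have : φ E • residue R a = residue R (φ E * a) := by
      rw [map_mul]; rfl
    rw [this, residue_eq_zero_iff]
    exact Ideal.mul_mem_right _ _ (hmem φ hφ)
  set y := push _ (e+1) (LinearMap.toSpanSingleton R _ E) z with hy
  have hy0 : y ≠ 0 := by
    intro h0
    have := hcomp φ0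
    rw [h0, map_zero] at this
    obtain ⟨v, hv⟩ := hu
    rw [← hv] at this
    have h5 := congrArg (fun t => (↑(v⁻¹) : R) • t) this
    simp only [smul_zero, smul_smul, Units.inv_mul, one_smul] at h5
    exact hz h5.symm
  apply hy0
  have hq : push _ (e+1) q y = 0 := by
    have h1 : push _ (e+1) i2 (push _ (e+1) q y) = 0 := by
      apply pi_ext
      intro j
      rw [← push_comp, ← push_comp]
      exact hkill _ (hA2 j)
    obtain ⟨t, ht⟩ := hi2.exact₁ _ h1
    have : Subsingleton (EE R (ResidueField R) (Module.Dual R Z2) e) := hom_depth e _ vZ2 hR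
    rw [← ht, Subsingleton.elim t 0, map_zero]
  obtain ⟨w, hw⟩ := hi.exact₂ _ hq
  have h1 : push _ (e+1) i1 (push _ (e+1) ι w) = 0 := by
    apply pi_ext
    intro j
    rw [← push_comp, ← push_comp, LinearMap.comp_assoc, ← hb j, push_comp, hw]
    exact hkill _ (hA1 j)
  have h2 : push _ (e+1) ι w = 0 := by
    obtain ⟨t, ht⟩ := hi1.exact₁ _ h1
    have : Subsingleton (EE R (ResidueField R) (Module.Dual R Z1) e) := hom_depth e _ vZ1 hR
    rw [← ht, Subsingleton.elim t 0, map_zero]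
  obtain ⟨t, ht⟩ := h.exact₁ _ h2
  rw [← hw, ← ht, Subsingleton.elim t 0, map_zero, map_zero]

lemma TR.of_totallyReflexive (h : TotallyReflexive R M) : TR R M :=
  ⟨h.1, fun i => bridge _ _ _ (h.2 (i+1) (by omega)).1, fun i => bridge _ _ _ (h.2 (i+1) (by omega)).2⟩

open IsLocalRing in
lemma mcm_tr [IsNoetherianRing R] [IsLocalRing R] (e : ℕ)
    (hR : ∀ j ≤ e, Subsingleton (EE R (ResidueField R) R j))
    (hR2 : Nontrivial (EE R (ResidueField R) R (e+1))) (n : ℕ) :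
    ∀ (M : Type u) [AddCommGroup M] [Module R M] [Module.Finite R M]
      (_ : GdimLE R n (ModuleCat.of R M))
      (_ : ∀ j ≤ e, Subsingleton (EE R (ResidueField R) M j)), TR R M := by
  induction n with
  | zero => exact fun M _ _ _ h _ => TR.of_totallyReflexive h
  | succ n ih =>
    intro M _ _ _ h hM
    obtain ⟨G, g, hG, hTG, hg, hK⟩ := h
    change G →ₗ[R] M at g
    have hTG := TR.of_totallyReflexive hTG
    have S := SES.ker hg
    have hG' : ∀ j ≤ e, Subsingleton (EE R (ResidueField R) G j) :=
      fun j hj => hTG.depth j fun i hi => hR i (by omega)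
    have hK' : TR R (LinearMap.ker g) := by
      refine ih _ hK fun j hj => ?_
      cases j with
      | zero => exact sub_zero_of_inj S.inj (hG' 0 (by omega))
      | succ j => exact S.sub₁ (hM j (by omega)) (hG' _ hj)
    have h1 : Subsingleton (EE R M R 1) :=
      S.ext1_sub (hTG.v 0) (key_ext hK' hTG S e hR hR2 (hM e le_rfl))
    have D := S.hom (N := R) h1
    have DD := D.hom (N := R) (hK'.vd 0)
    refine ⟨⟨?_, ?_⟩, ?_, ?_⟩
    · rw [injective_iff_map_eq_zero]
      intro m hm
      obtain ⟨y, rfl⟩ := hg m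
      have hy : LinearMap.lcomp R R (LinearMap.lcomp R R g) (Module.Dual.eval R G y) = 0 := hm
      obtain ⟨t, ht⟩ := (DD.ex _).mp hy
      obtain ⟨k, rfl⟩ := hK'.bij.2 t
      have : Module.Dual.eval R G k = Module.Dual.eval R G y := ht
      rw [← hTG.bij.1 this]
      exact k.2
    · intro x
      obtain ⟨y, rfl⟩ := DD.surj x
      obtain ⟨y, rfl⟩ := hTG.bij.2 y
      exact ⟨g y, rfl⟩
    · intro i
      cases i with
      | zero => exact h1
      | succ i => exact S.cosub₃ (hK'.v i) (hTG.v (i+1))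
    · exact VV.ker D hTG.vd hK'.vd

end
end EE

namespace EE
open Abelian
section
variable {R : Type u} [CommRing R]
variable {A B C X Y N K F G M Q : Type u}
  [AddCommGroup A] [Module R A] [AddCommGroup B] [Module R B] [AddCommGroup C] [Module R C]
  [AddCommGroup X] [Module R X] [AddCommGroup Y] [Module R Y]
  [AddCommGroup N] [Module R N] [AddCommGroup K] [Module R K] [AddCommGroup F] [Module R F]
  [AddCommGroup G] [Module R G] [AddCommGroup M] [Module R M] [AddCommGroup Q] [Module R Q]

/-- the ideal of scalars which factor through a finite free module -/
def stab (R : Type u) [CommRing R] (M : Type u) [AddCommGroup M] [Module R M] : Ideal R :=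
  (LinearMap.range (dualTensorHom R M M)).comap (LinearMap.toSpanSingleton R (M →ₗ[R] M) LinearMap.id)

lemma mem_range_dualTensorHom_of (s : ℕ) (α : M →ₗ[R] (Fin s → R)) (β : (Fin s → R) →ₗ[R] N) :
    β ∘ₗ α ∈ LinearMap.range (dualTensorHom R M N) := by
  have : β ∘ₗ α = ∑ j, dualTensorHom R M N ((LinearMap.proj j ∘ₗ α) ⊗ₜ[R] β (Pi.single j 1)) := by
    ext m
    conv_lhs => rw [LinearMap.comp_apply, pi_eq_sum_univ' (α m)]
    simp [dualTensorHom_apply]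
  rw [this]
  exact Submodule.sum_mem _ fun j _ => ⟨_, rfl⟩

lemma exists_of_mem_range (φ : M →ₗ[R] N) (h : φ ∈ LinearMap.range (dualTensorHom R M N)) :
    ∃ (s : ℕ) (α : M →ₗ[R] (Fin s → R)) (β : (Fin s → R) →ₗ[R] N), β ∘ₗ α = φ := by
  obtain ⟨t, rfl⟩ := h
  obtain ⟨s, a, b, rfl⟩ := TensorProduct.exists_sum_tmul_eq t
  refine ⟨s, LinearMap.pi a, Fintype.linearCombination R b, ?_⟩
  ext m
  simp [Fintype.linearCombination_apply, dualTensorHom_apply]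

lemma mem_stab_iff {r : R} : r ∈ stab R M ↔
    ∃ (s : ℕ) (α : M →ₗ[R] (Fin s → R)) (β : (Fin s → R) →ₗ[R] M), β ∘ₗ α = r • LinearMap.id := by
  constructor
  · intro h
    exact exists_of_mem_range _ h
  · rintro ⟨s, α, β, h⟩
    have := mem_range_dualTensorHom_of s α β
    rw [h] at this
    exact this

lemma proj_of_vanish (h : ∀ (N : Type u) [AddCommGroup N] [Module R N], Subsingleton (EE R X N 1)) :
    Module.Projective R X := by
  have hs : Function.Surjective (Finsupp.linearCombination R (id : X → X)) := by
    intro x; exact ⟨Finsupp.single x 1, by simp⟩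
  have S := SES.ker hs
  obtain ⟨b, hb⟩ := S.extend (N := LinearMap.ker (Finsupp.linearCombination R (id : X → X))) (h _) LinearMap.id
  have hk : LinearMap.ker (Finsupp.linearCombination R (id : X → X)) ≤
      LinearMap.ker (LinearMap.id - (LinearMap.ker (Finsupp.linearCombination R (id : X → X))).subtype ∘ₗ b) := by
    intro y hy
    have : b y = ⟨y, hy⟩ := LinearMap.congr_fun hb ⟨y, hy⟩
    simp [this]
  obtain ⟨σ, hσ⟩ := factor_surj _ hs _ hk
  refine Module.Projective.of_split σ (Finsupp.linearCombination R (id : X → X)) ?_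
  ext x
  obtain ⟨y, rfl⟩ := hs x
  have := LinearMap.congr_fun hσ y
  simp only [LinearMap.comp_apply, LinearMap.id_apply] at this ⊢
  rw [this]
  simp

lemma pd_vanish (n : ℕ) : ∀ (X : ModuleCat.{u} R) (_ : PdLE R n X) (N : Type u) [AddCommGroup N] [Module R N] (i : ℕ),
    Subsingleton (EE R X N (n+1+i)) := by
  induction n with
  | zero =>
    intro X h N _ _ i
    have : Module.Projective R X := h
    have := sub_of_projective (R := R) (X := X) (N := N) i
    rwa [show 0 + 1 + i = i + 1 by omega]
  | succ n ih =>
    rintro X ⟨G, g, hG, hg, hK⟩ N _ _ i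
    have := (SES.ker hg).cosub₃ (N := N) (ih _ hK N i) (sub_of_projective _)
    rwa [show n + 1 + 1 + i = n + 1 + i + 1 by omega]

lemma stab_of_proj_loc [IsNoetherianRing R] [Module.Finite R M] (p : Ideal R) [p.IsPrime]
    (h : Module.Projective (Localization.AtPrime p) (LocalizedModule p.primeCompl M)) :
    ∃ r ∈ stab R M, r ∉ p := by
  obtain ⟨s, g, hg⟩ := Module.Finite.exists_fin' R M
  have hgp := LocalizedModule.map_surjective p.primeCompl g hg
  obtain ⟨σ, hσ⟩ := Module.projective_lifting_property
    (LocalizedModule.map p.primeCompl g) (LinearMap.id) hgp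
  have : Module.FinitePresentation R M := Module.finitePresentation_of_finite R M
  obtain ⟨h, t, ht⟩ := Module.FinitePresentation.exists_lift_of_isLocalizedModule p.primeCompl
    (LocalizedModule.mkLinearMap p.primeCompl (Fin s → R))
    ((σ.restrictScalars R) ∘ₗ LocalizedModule.mkLinearMap p.primeCompl M)
  obtain ⟨t', ht'⟩ := Module.Finite.exists_smul_of_comp_eq_of_isLocalizedModule p.primeCompl
    (LocalizedModule.mkLinearMap p.primeCompl M) (g ∘ₗ h) ((t : R) • LinearMap.id) (by
      ext m
      have h1 := LinearMap.congr_fun ht m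
      have h2 : LocalizedModule.map p.primeCompl g (LocalizedModule.mkLinearMap p.primeCompl _ (h m))
        = LocalizedModule.mkLinearMap p.primeCompl M (g (h m)) := by
          simp [LocalizedModule.mkLinearMap_apply, LocalizedModule.map_mk]
      simp only [LinearMap.comp_apply] at h1 ⊢
      rw [← h2, h1]
      have h3 := LinearMap.congr_fun hσ (LocalizedModule.mkLinearMap p.primeCompl M m)
      simp only [LinearMap.comp_apply, LinearMap.id_apply] at h3
      simp only [LinearMap.smul_apply, LinearMap.comp_apply, LinearMap.id_apply, LinearMap.map_smul]
      conv_rhs => rw [← h3]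
      change ((LocalizedModule.map p.primeCompl g).restrictScalars R) ((t : R) • _) = _
      rw [LinearMap.map_smul]
      rfl)
  refine ⟨t' * t, mem_stab_iff.mpr ⟨s, (t' : R) • h, g, ?_⟩, ?_⟩
  · have : (t' : R) • (g ∘ₗ h) = (t' : R) • ((t : R) • LinearMap.id) := ht'
    rw [LinearMap.comp_smul, this, smul_smul]
  · exact (t' * t).2

lemma stab_of_pd_loc [IsNoetherianRing R] (p : Ideal R) [p.IsPrime] (n : ℕ) :
    ∀ (M : Type u) [AddCommGroup M] [Module R M] [Module.Finite R M] (_ : VV R M R)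
    (_ : ∀ (N : Type u) [AddCommGroup N] [Module (Localization.AtPrime p) N] (i : ℕ),
      Subsingleton (EE (Localization.AtPrime p) (LocalizedModule p.primeCompl M) N (n+1+i))),
    ∃ r ∈ stab R M, r ∉ p := by
  induction n with
  | zero =>
    intro M _ _ _ hV h
    exact stab_of_proj_loc p (proj_of_vanish fun N _ _ => h N 0)
  | succ n ih =>
    intro M _ _ _ hV h
    obtain ⟨s, g, hg⟩ := Module.Finite.exists_fin' R M
    have S := SES.ker hg
    let ip : LocalizedModule p.primeCompl (LinearMap.ker g) →ₗ[Localization.AtPrime p]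
      LocalizedModule p.primeCompl (Fin s → R) :=
        LocalizedModule.map p.primeCompl (LinearMap.ker g).subtype
    let gp : LocalizedModule p.primeCompl (Fin s → R) →ₗ[Localization.AtPrime p]
      LocalizedModule p.primeCompl M := LocalizedModule.map p.primeCompl g
    have Sp : SES (R := Localization.AtPrime p)
        (A := LocalizedModule p.primeCompl (LinearMap.ker g))
        (B := LocalizedModule p.primeCompl (Fin s → R)) (C := LocalizedModule p.primeCompl M) ip gp := by
      constructor
      · exact LocalizedModule.map_injective p.primeCompl _ S.inj
      · exact LocalizedModule.map_exact p.primeCompl _ _ S.ex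
      · exact LocalizedModule.map_surjective p.primeCompl _ S.surj
    obtain ⟨r, hr, hrp⟩ := ih (LinearMap.ker g) (VV.ker S VV.proj hV) (fun N _ _ i => by
      refine Sp.cosub₁ ?_ ?_
      · rw [show n + 1 + i = (n + i) + 1 by omega]; exact sub_of_projective _
      · rw [show n + 1 + i + 1 = n + 1 + 1 + i by omega]; exact h N i)
    obtain ⟨b, α, β, hαβ⟩ := mem_stab_iff.mp hr
    have hE : Subsingleton (EE R M (Fin b → R) 1) := pi_sub _ _ (hV 0)
    obtain ⟨α', hα'⟩ := S.extend hE α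
    refine ⟨r, mem_stab_iff.mpr ?_, hrp⟩
    have hk : LinearMap.ker g ≤ LinearMap.ker (r • LinearMap.id - (LinearMap.ker g).subtype ∘ₗ β ∘ₗ α') := by
      intro y hy
      have h1 : α' y = α ⟨y, hy⟩ := LinearMap.congr_fun hα' ⟨y, hy⟩
      have h2 : β (α ⟨y, hy⟩) = r • ⟨y, hy⟩ := LinearMap.congr_fun hαβ ⟨y, hy⟩
      simp [h1, h2]
    obtain ⟨σ, hσ⟩ := factor_surj _ hg _ hk
    refine ⟨s, σ, g, ?_⟩
    ext x
    obtain ⟨y, rfl⟩ := hg x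
    have := LinearMap.congr_fun hσ y
    simp only [LinearMap.comp_apply] at this ⊢
    rw [this]
    simp

lemma stab_not_le [IsNoetherianRing R] [Module.Finite R M] (p : Ideal R) [p.IsPrime] (hV : VV R M R)
    (h : FinitePd (Localization.AtPrime p) (LocalizedModule p.primeCompl M)) : ¬ stab R M ≤ p := by
  obtain ⟨n, hn⟩ := h
  obtain ⟨r, hr, hrp⟩ := stab_of_pd_loc p n M hV (fun N _ _ i => pd_vanish n _ hn N i)
  exact fun hc => hrp (hc hr)

lemma stab_kill {r : R} (hr : r ∈ stab R M) (i : ℕ) (x : EE R M N (i+1)) : r • x = 0 := by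
  obtain ⟨s, α, β, h⟩ := mem_stab_iff.mp hr
  rw [← pull_smul_id, ← h, pull_comp]
  have := sub_of_projective (R := R) (X := Fin s → R) (N := N) i
  rw [Subsingleton.elim (pull N (i+1) β x) 0, map_zero]

lemma free_of_stab_top [IsLocalRing R] [IsNoetherianRing R] [Module.Finite R M] (h : stab R M = ⊤) : Module.Free R M := by
  have : (1 : R) ∈ stab R M := h ▸ Submodule.mem_top
  obtain ⟨s, α, β, h⟩ := mem_stab_iff.mp this
  rw [one_smul] at h
  have := Module.Projective.of_split α β h
  exact Module.free_of_flat_of_isLocalRing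

end
end EE

namespace EE
open Abelian
section
variable {R : Type u} [CommRing R]
variable {N W : Type u} [AddCommGroup N] [Module R N] [AddCommGroup W] [Module R W]

lemma filt [IsNoetherianRing R] (j : ℕ) (W : Type u) [AddCommGroup W] [Module R W] [hW : Module.Finite R W] :
    (∀ (Q : Ideal R) (_ : Q.IsPrime), Module.annihilator R W ≤ Q → Subsingleton (EE R (R ⧸ Q) N j)) →
    Subsingleton (EE R W N j) := by
  induction hW using IsNoetherianRing.induction_on_isQuotientEquivQuotientPrime R with
  | subsingleton W =>
    intro _
    rw [sub_iff]; intro x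
    rw [← pull_id j x]
    have : (LinearMap.id : W →ₗ[R] W) = 0 := Subsingleton.elim _ _
    rw [this, pull_zero]
  | quotient W p e =>
    intro h
    refine sub_congr_left e.symm j (h p.1 p.2 ?_)
    rw [e.annihilator_eq, Ideal.annihilator_quotient]
  | exact N₁ N₂ N₃ f g hf hg hfg ih1 ih2 =>
    intro h
    refine SES.cosub₂ ⟨hf, hfg, hg⟩ (ih1 fun Q hQ hle => h Q hQ ?_) (ih2 fun Q hQ hle => h Q hQ ?_)
    · exact (LinearMap.annihilator_le_of_injective f hf).trans hle
    · exact (LinearMap.annihilator_le_of_surjective g hg).trans hle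

open IsLocalRing in
lemma ischebeck [IsNoetherianRing R] [IsLocalRing R] [Module.Finite R N] (d : ℕ)
    (hd : (maximalIdeal R).height ≤ d)
    (h : ∀ j < d, Subsingleton (EE R (ResidueField R) N j)) (P : Ideal R) :
    ∀ (_ : P.IsPrime) (j : ℕ) (_ : (j : ℕ∞) < P.height), Subsingleton (EE R (R ⧸ P) N j) := by
  induction P using WellFoundedGT.induction with
  | ind P ih =>
    intro hP j hj
    by_cases hPm : P = maximalIdeal R
    · subst hPm
      exact h j (by exact_mod_cast hj.trans_le hd)
    have hle : P ≤ maximalIdeal R := le_maximalIdeal hP.ne_top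
    obtain ⟨x, hxm, hxP⟩ := SetLike.exists_of_lt (lt_of_le_of_ne hle hPm)
    let f : (R ⧸ P) →ₗ[R] (R ⧸ P) := x • LinearMap.id
    have hf : Function.Injective f := by
      rw [injective_iff_map_eq_zero]
      intro a ha
      obtain ⟨a, rfl⟩ := Ideal.Quotient.mk_surjective a
      have : Ideal.Quotient.mk P (x * a) = 0 := ha
      rw [Ideal.Quotient.eq_zero_iff_mem] at this ⊢
      exact (hP.mem_or_mem this).resolve_left hxP
    have S := SES.coker hf
    have hL : Subsingleton (EE R ((R ⧸ P) ⧸ LinearMap.range f) N (j+1)) := by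
      apply filt
      intro Q hQ hle
      have hPQ : P ≤ Q := by
        refine le_trans ?_ hle
        refine le_trans (Ideal.annihilator_quotient (I := P)).ge
          (LinearMap.annihilator_le_of_surjective _ S.surj)
      have hxQ : x ∈ Q := by
        apply hle
        rw [Module.mem_annihilator]
        intro a
        obtain ⟨a, rfl⟩ := Submodule.mkQ_surjective _ a
        rw [← map_smul, Submodule.mkQ_apply, Submodule.Quotient.mk_eq_zero]
        exact ⟨a, rfl⟩
      have hlt : P < Q := lt_of_le_of_ne hPQ fun hc => hxP (hc ▸ hxQ)
      refine ih Q hlt hQ (j+1) ?_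
      refine lt_of_lt_of_le ?_ (Ideal.height_add_one_le_of_lt_of_isPrime hlt)
      push_cast
      exact (ENat.add_lt_add_iff_right (by simp)).mpr hj
    have htop : (⊤ : Submodule R (EE R (R ⧸ P) N j)) ≤ maximalIdeal R • ⊤ := by
      intro y _
      obtain ⟨z, hz⟩ := S.coexact₁ y (Subsingleton.elim _ _)
      have : y = x • z := by
        rw [← hz, ← pull_smul_id]
      rw [this]
      exact Submodule.smul_mem_smul hxm trivial
    have hfin : Module.Finite R (EE R (R ⧸ P) N j) := by
      have : Module.Finite R (ModuleCat.of R (R ⧸ P)) := inferInstanceAs (Module.Finite R (R ⧸ P))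
      have : Module.Finite R (ModuleCat.of R N) := inferInstanceAs (Module.Finite R N)
      exact ModuleCat.finite_ext R _ _ _
    have := Submodule.eq_bot_of_le_smul_of_le_jacobson_bot (maximalIdeal R) ⊤ hfin.fg_top htop
      (by rw [jacobson_eq_maximalIdeal ⊥ bot_ne_top])
    rw [sub_iff]; intro y
    have : y ∈ (⊥ : Submodule R (EE R (R ⧸ P) N j)) := this ▸ trivial
    simpa using this

open IsLocalRing in
lemma depth_of_ann [IsNoetherianRing R] [IsLocalRing R] [Module.Finite R N] [Module.Finite R W] (d : ℕ)
    (hd : (maximalIdeal R).height ≤ d)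
    (h : ∀ j < d, Subsingleton (EE R (ResidueField R) N j)) (b : Ideal R)
    (hb : b ≤ Module.annihilator R W) (j : ℕ) (hj : (j : ℕ∞) < b.height) : Subsingleton (EE R W N j) :=
  filt j W fun Q hQ hle => ischebeck d hd h Q hQ j (hj.trans_le (Ideal.height_mono (hb.trans hle)))
end
end EE

namespace EE
open Abelian
section
variable {R : Type u} [CommRing R]
variable {A B C X M N Q : Type u}
  [AddCommGroup A] [Module R A] [AddCommGroup B] [Module R B] [AddCommGroup C] [Module R C]
  [AddCommGroup X] [Module R X]
  [AddCommGroup M] [Module R M] [AddCommGroup N] [Module R N] [AddCommGroup Q] [Module R Q]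

lemma SES.sub (S : Submodule R A) : SES S.subtype S.mkQ where
  inj := S.injective_subtype
  ex := LinearMap.exact_subtype_mkQ S
  surj := S.mkQ_surjective

lemma exists_trace [IsNoetherianRing R] [Module.Finite R M]
    (h0 : Subsingleton (EE R (R ⧸ stab R M) R 0))
    (h1 : ∀ (W : Type u) [AddCommGroup W] [Module R W] [Module.Finite R W],
      stab R M ≤ Module.annihilator R W → Subsingleton (EE R W R 1)) :
    ∃ tr : (M →ₗ[R] M) →ₗ[R] R, ∀ (f : M →ₗ[R] R) (s : M),
      tr (dualTensorHom R M M (f ⊗ₜ[R] s)) = f s := by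
  have key : ∀ r ∈ stab R M, ∀ t, dualTensorHom R M M t = 0 → r • contractLeft R M t = 0 := by
    intro r hr t ht
    obtain ⟨s, α, β, hαβ⟩ := mem_stab_iff.mp hr
    have hid : r • contractLeft R M = (∑ j, ((LinearMap.proj j ∘ₗ α) ∘ₗ
        LinearMap.applyₗ (β (Pi.single j 1)))) ∘ₗ dualTensorHom R M M := by
      apply TensorProduct.ext'
      intro f m
      have h2 : r • m = β (α m) := (LinearMap.congr_fun hαβ m).symm
      have h3 : r • f m = ∑ j, α m j * f (β (Pi.single j 1)) := by
        rw [← map_smul, h2]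
        conv_lhs => rw [pi_eq_sum_univ' (α m)]
        simp
      simp only [LinearMap.smul_apply, contractLeft_apply, h3]
      simp [dualTensorHom_apply, mul_comm]
    have := LinearMap.congr_fun hid t
    simpa [ht] using this
  have hker : LinearMap.ker (dualTensorHom R M M).rangeRestrict ≤ LinearMap.ker (contractLeft R M) := by
    intro t ht
    have ht' : dualTensorHom R M M t = 0 := by
      simpa using ht
    have := sub_zero_iff.mp h0 (Submodule.liftQ _ (LinearMap.toSpanSingleton R R (contractLeft R M t)) (by
      intro r hr
      simpa using key r hr t ht'))
    have := LinearMap.congr_fun this ((stab R M).mkQ 1)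
    rw [Submodule.mkQ_apply, Submodule.liftQ_apply] at this
    simpa using this
  obtain ⟨tr0, htr0⟩ : ∃ ψ : (LinearMap.range (dualTensorHom R M M)) →ₗ[R] R,
      ψ ∘ₗ (dualTensorHom R M M).rangeRestrict = contractLeft R M :=
    factor_surj (R := R) (B := TensorProduct R (Module.Dual R M) M)
      (C := LinearMap.range (dualTensorHom R M M)) (N := R) (dualTensorHom R M M).rangeRestrict
      (LinearMap.surjective_rangeRestrict _) (contractLeft R M) hker
  have hW : Subsingleton (EE R ((M →ₗ[R] M) ⧸ LinearMap.range (dualTensorHom R M M)) R 1) := by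
    apply h1
    intro r hr
    rw [Module.mem_annihilator]
    intro a
    obtain ⟨a, rfl⟩ := Submodule.mkQ_surjective _ a
    rw [← map_smul, Submodule.mkQ_apply, Submodule.Quotient.mk_eq_zero]
    obtain ⟨s, α, β, hαβ⟩ := mem_stab_iff.mp hr
    have : r • a = (a ∘ₗ β) ∘ₗ α := by
      rw [LinearMap.comp_assoc, hαβ]; ext; simp
    rw [this]
    exact mem_range_dualTensorHom_of s α _
  obtain ⟨tr, htr⟩ := (SES.sub (LinearMap.range (dualTensorHom R M M))).extend hW tr0
  refine ⟨tr, fun f s => ?_⟩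
  have h2 := LinearMap.congr_fun htr ((dualTensorHom R M M).rangeRestrict (f ⊗ₜ[R] s))
  have h3 := LinearMap.congr_fun htr0 (f ⊗ₜ[R] s)
  simp only [LinearMap.comp_apply] at h2 h3
  rw [h3] at h2
  simpa using h2

lemma SES.homRange {f : A →ₗ[R] B} {g : B →ₗ[R] C} (h : SES f g) :
    SES (LinearMap.lcomp R N g) (LinearMap.lcomp R N f).rangeRestrict where
  inj := by
    intro a b hab
    apply LinearMap.ext; intro c
    obtain ⟨x, rfl⟩ := h.surj c
    exact LinearMap.congr_fun hab x
  ex := by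
    intro φ
    have hiff : (LinearMap.lcomp R N f).rangeRestrict φ = 0 ↔ φ ∘ₗ f = 0 := by
      rw [← Subtype.coe_inj]; rfl
    rw [hiff]
    constructor
    · intro hφ'
      have hk : LinearMap.ker g ≤ LinearMap.ker φ := by
        intro b hb
        obtain ⟨a, rfl⟩ := (h.ex b).mp hb
        exact LinearMap.congr_fun hφ' a
      obtain ⟨ψ, hψ⟩ := factor_surj g h.surj φ hk
      exact ⟨ψ, hψ⟩
    · rintro ⟨ψ, rfl⟩
      change (ψ ∘ₗ g) ∘ₗ f = 0
      rw [LinearMap.comp_assoc, h.zero, LinearMap.comp_zero]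
  surj := LinearMap.surjective_rangeRestrict _

lemma hom_sub_zero [Module.Finite R X] (h0 : Subsingleton (EE R Q N 0)) :
    Subsingleton (EE R Q (X →ₗ[R] N) 0) := by
  obtain ⟨s, g, hg⟩ := Module.Finite.exists_fin' R X
  exact sub_zero_of_inj ((SES.ker hg).homRange (N := N)).inj (hom_free_sub s 0 h0)

lemma hom_sub_one [IsNoetherianRing R] [Module.Finite R X] (h0 : Subsingleton (EE R Q N 0))
    (h1 : Subsingleton (EE R Q N 1)) :
    Subsingleton (EE R Q (X →ₗ[R] N) 1) := by
  obtain ⟨s, g, hg⟩ := Module.Finite.exists_fin' R X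
  refine ((SES.ker hg).homRange (N := N)).sub₁ ?_ (hom_free_sub s 1 h1)
  exact sub_zero_of_inj (Submodule.injective_subtype _) (hom_sub_zero (X := LinearMap.ker g) h0)

lemma core [IsNoetherianRing R] [Module.Finite R M] (I : Ideal R) (h : ℕ)
    (hQ : ∀ j < h, Subsingleton (EE R Q M j)) (k : ℕ) (hk : k + 2 ≤ h) :
    ∀ (X : Type u) [AddCommGroup X] [Module R X] [Module.Finite R X]
      (_ : ∀ (j : ℕ) (x : EE R X M (j+1)), ∀ r ∈ I, r • x = 0)
      (_ : Subsingleton (EE R X M (k+1)))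
      (s : ℕ) (π : (Fin s → R) →ₗ[R] X) (_ : Function.Surjective π)
      (Z : Type u) [AddCommGroup Z] [Module R Z]
      (_ : ∀ (W : Type u) [AddCommGroup W] [Module R W] [Module.Finite R W],
        I ≤ Module.annihilator R W → ∀ j < k + 1, Subsingleton (EE R W Z (j+1)))
      (c : EE R Q (X →ₗ[R] M) (k+2)) (_ : push Q (k+2) (LinearMap.lcomp R M π) c = 0)
      (γ : (X →ₗ[R] M) →ₗ[R] Z), push Q (k+2) γ c = 0 := by
  induction k with
  | zero =>
    intro X _ _ _ hI hX s π hπ Z _ _ hZ c hc γ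
    have S := (SES.ker hπ).hom (N := M) hX
    obtain ⟨c1, rfl⟩ := S.exact₁ c hc
    have : Subsingleton (EE R Q (LinearMap.ker π →ₗ[R] M) 1) :=
      hom_sub_one (hQ 0 (by omega)) (hQ 1 (by omega))
    rw [Subsingleton.elim c1 0, map_zero, map_zero]
  | succ k ih =>
    intro X _ _ _ hI hX s π hπ Z _ _ hZ c hc γ
    obtain ⟨K, hKdef⟩ : ∃ K, K = LinearMap.ker π := ⟨_, rfl⟩
    have S0 : SES K.subtype π := by rw [hKdef]; exact SES.ker hπ
    have S := S0.homRange (N := M)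
    obtain ⟨c1, rfl⟩ := S.exact₁ c hc
    obtain ⟨P⟩ := EnoughInjectives.presentation (ModuleCat.of R Z)
    obtain ⟨J, inj, ι, hmono⟩ : ∃ (J : ModuleCat.{u} R) (_ : Injective J) (ι : ModuleCat.of R Z ⟶ J), Mono ι :=
      ⟨P.J, P.injective, P.f, P.mono⟩
    let ι' : Z →ₗ[R] J := ι.hom
    have hι : Function.Injective ι' := (ModuleCat.mono_iff_injective ι).mp hmono
    have S' := SES.coker hι
    have hJ : ∀ (W : Type u) [AddCommGroup W] [Module R W] (j : ℕ), Subsingleton (EE R W J (j+1)) :=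
      fun W _ _ j => sub_of_injective inj j
    obtain ⟨Γ, hΓ⟩ := S.extend (hJ _ 0) (ι' ∘ₗ γ)
    obtain ⟨β, hβ⟩ := factor_surj _ S.surj ((LinearMap.range ι').mkQ ∘ₗ Γ) (by
      intro φ hφ
      obtain ⟨ψ, rfl⟩ := (S.ex φ).mp hφ
      have h1 : Γ (LinearMap.lcomp R M π ψ) = ι' (γ ψ) := LinearMap.congr_fun hΓ ψ
      simp [h1])
    rw [S.delta_nat S' γ Γ β hΓ.symm hβ.symm]
    suffices push Q (k+2) β c1 = 0 by rw [this, map_zero]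
    have hZ1 : ∀ (W : Type u) [AddCommGroup W] [Module R W] [Module.Finite R W],
        I ≤ Module.annihilator R W → ∀ j < k + 1, Subsingleton (EE R W (J ⧸ LinearMap.range ι') (j+1)) :=
      fun W _ _ _ hW j hj => S'.sub₃ (hJ _ _) (hZ W hW (j+1) (by omega))
    have SB := SES.sub (LinearMap.range (LinearMap.lcomp R M K.subtype))
    have hW1 : Subsingleton (EE R ((K →ₗ[R] M) ⧸ LinearMap.range (LinearMap.lcomp R M K.subtype))
        (J ⧸ LinearMap.range ι') 1) := by
      refine hZ1 _ ?_ 0 (by omega)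
      intro r hr
      rw [Module.mem_annihilator]
      intro a
      obtain ⟨a, rfl⟩ := Submodule.mkQ_surjective _ a
      rw [← map_smul, Submodule.mkQ_apply, Submodule.Quotient.mk_eq_zero]
      have h1 : S0.codelta M 0 (r • (zeroEquiv K M).symm a) = 0 := by
        rw [map_smul]; exact hI 0 _ r hr
      obtain ⟨y, hy⟩ := S0.coexact₁ _ h1
      refine ⟨zeroEquiv _ M y, ?_⟩
      have h2 : r • (zeroEquiv K M).symm a = (zeroEquiv K M).symm (r • a) := by
        rw [← push_smul_id, push_zeroEquiv]
        congr 1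
      rw [h2, ← (zeroEquiv _ M).symm_apply_apply y, pull_zeroEquiv] at hy
      exact (zeroEquiv K M).symm.injective hy
    obtain ⟨γ1, hγ1⟩ := SB.extend hW1 β
    rw [← hγ1, push_comp]
    obtain ⟨s', π', hπ'⟩ := Module.Finite.exists_fin' R K
    refine ih (by omega) K ?_ (S0.cosub₁ (sub_of_projective _) hX) s' π' hπ' _ hZ1 _ ?_ γ1
    · intro j x r hr
      have h1 : S0.codelta M (j+1) (r • x) = 0 := by
        rw [map_smul]; exact hI (j+1) _ r hr
      obtain ⟨y, hy⟩ := S0.coexact₁ _ h1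
      have := sub_of_projective (R := R) (X := Fin s → R) (N := M) j
      rw [← hy, Subsingleton.elim y 0, map_zero]
    · have : Subsingleton (EE R Q ((Fin s' → R) →ₗ[R] M) (k+2)) := hom_free_sub s' _ (hQ _ (by omega))
      exact Subsingleton.elim _ _

end
end EE

namespace EE
open Abelian
section
variable {R : Type u} [CommRing R]
variable {M N : Type u}
  [AddCommGroup M] [Module R M] [AddCommGroup N] [Module R N]

def Split (p : Ideal R) (M : Type u) [AddCommGroup M] [Module R M] (a : ℕ)
    (π : M →ₗ[R] (Fin a → R)) (ι : (Fin a → R) →ₗ[R] M) (u : R) : Prop :=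
  u ∉ p ∧ π ∘ₗ ι = u • LinearMap.id

lemma Split.bound {p : Ideal R} [p.IsPrime] {a : ℕ} {π : M →ₗ[R] (Fin a → R)}
    {ι : (Fin a → R) →ₗ[R] M} {u : R} (h : Split p M a π ι u) (s : ℕ)
    (g : (Fin s → R) →ₗ[R] M) (hg : Function.Surjective g) : a ≤ s := by
  obtain ⟨ι', hι'⟩ := Module.projective_lifting_property g ι hg
  set A := LinearMap.toMatrix' (π ∘ₗ g)
  set B := LinearMap.toMatrix' ι'
  have hAB : A * B = u • (1 : Matrix (Fin a) (Fin a) R) := by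
    rw [← LinearMap.toMatrix'_comp, LinearMap.comp_assoc, hι', h.2, map_smul, LinearMap.toMatrix'_id]
  let φ := Ideal.Quotient.mk p
  have hAB' : A.map φ * B.map φ = (φ u) • (1 : Matrix (Fin a) (Fin a) (R ⧸ p)) := by
    rw [← Matrix.map_mul, hAB]
    ext i j
    by_cases hij : i = j <;> simp [Matrix.one_apply, hij]
  have hu : φ u ≠ 0 := fun hc => h.1 (Ideal.Quotient.eq_zero_iff_mem.mp hc)
  apply le_of_fin_injective (R ⧸ p) (B.map φ).mulVecLin
  rw [← LinearMap.ker_eq_bot, LinearMap.ker_eq_bot']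
  intro v hv
  have h1 : (A.map φ * B.map φ).mulVec v = 0 := by
    rw [← Matrix.mulVec_mulVec]
    have : (B.map φ).mulVec v = 0 := hv
    rw [this, Matrix.mulVec_zero]
  rw [hAB', Matrix.smul_mulVec, Matrix.one_mulVec] at h1
  exact (smul_eq_zero.mp h1).resolve_left hu

lemma Split.step {p : Ideal R} [hp : p.IsPrime] {a : ℕ} {π : M →ₗ[R] (Fin a → R)}
    {ι : (Fin a → R) →ₗ[R] M} {u : R} (h : Split p M a π ι u) (f : M →ₗ[R] R) (hf : f ∘ₗ ι = 0)
    (x : M) (hx : f x ∉ p) : ∃ π' ι' u', Split p M (a+1) π' ι' u' := by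
  let e := Fin.consLinearEquiv R (fun _ : Fin (a+1) => R)
  let x' := u • x - ι (π x)
  let v := u * f x
  have hπι : ∀ w, π (ι w) = u • w := fun w => LinearMap.congr_fun h.2 w
  have hfι : ∀ w, f (ι w) = 0 := fun w => LinearMap.congr_fun hf w
  have hπx : π x' = 0 := by simp [x', hπι]
  have hfx : f x' = v := by simp [x', hfι, v]
  refine ⟨e.toLinearMap ∘ₗ f.prod π,
    (LinearMap.toSpanSingleton R M (u • x')).coprod (v • ι) ∘ₗ e.symm.toLinearMap, u * v, ?_, ?_⟩
  · intro hc
    rcases hp.mem_or_mem hc with h1 | h1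
    · exact h.1 h1
    · rcases hp.mem_or_mem h1 with h1 | h1
      · exact h.1 h1
      · exact hx h1
  · apply LinearMap.ext
    intro w
    obtain ⟨⟨t, w⟩, rfl⟩ := e.surjective w
    simp only [LinearMap.comp_apply, LinearEquiv.coe_coe, LinearEquiv.symm_apply_apply,
      LinearMap.smul_apply, LinearMap.id_apply]
    rw [← map_smul]
    congr 1
    ext
    · simp [hfι, hfx]; ring
    · simp [hπι, hπx]; ring

lemma exists_split [Module.Finite R M] (p : Ideal R) [hp : p.IsPrime] :
    ∃ (a : ℕ) (π : M →ₗ[R] (Fin a → R)) (ι : (Fin a → R) →ₗ[R] M) (u : R),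
      u ∉ p ∧ π ∘ₗ ι = u • LinearMap.id ∧ ∀ f : M →ₗ[R] R, f ∘ₗ ι = 0 → ∀ x, f x ∈ p := by
  by_contra hc
  push Not at hc
  have key : ∀ a, ∃ π ι u, Split p M a π ι u := by
    intro a
    induction a with
    | zero => exact ⟨0, 0, 1, fun h => hp.ne_top ((Ideal.eq_top_iff_one _).mpr h),
        LinearMap.ext fun w => Subsingleton.elim _ _⟩
    | succ a ih =>
      obtain ⟨π, ι, u, h⟩ := ih
      obtain ⟨f, hf, x, hx⟩ := hc a π ι u h.1 h.2
      exact h.step f hf x hx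
  obtain ⟨s, g, hg⟩ := Module.Finite.exists_fin' R M
  obtain ⟨π, ι, u, h⟩ := key (s+1)
  have := h.bound s g hg
  omega

lemma nak [IsNoetherianRing R] [Module.Finite R N] {p : Ideal R} [hp : p.IsPrime]
    (ε : N →ₗ[R] N) (u : R) (hu : u ∉ p) (hε : ∀ x, ε (ε x) = u • ε x)
    (hne : ∀ r ∉ p, r • ε ≠ 0) (y : R) (hy : y ∈ p) (r : R) (hr : r ∉ p)
    (h : ∀ x, ∃ z, r • ε x = y • z) : False := by
  let T := LinearMap.range ε
  let c := r * u
  have hc : c ∉ p := fun hc => (hp.mem_or_mem hc).elim hr hu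
  obtain ⟨P, hP, -, hcoef, hP0⟩ :=
    LinearMap.exists_monic_and_natDegree_eq_and_coeff_mem_pow_and_aeval_eq_zero R
    (algebraMap R (Module.End R T) c) (Ideal.span {y}) (by
      rintro _ ⟨⟨t, x, rfl⟩, rfl⟩
      obtain ⟨z, hz⟩ := h x
      have : algebraMap R (Module.End R T) c ⟨ε x, x, rfl⟩ = y • (⟨ε z, z, rfl⟩ : T) := by
        rw [Module.algebraMap_end_apply]
        apply Subtype.ext
        change (r * u) • ε x = y • ε z
        rw [mul_smul, ← hε, ← map_smul, hz, map_smul]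
      rw [this]
      exact Submodule.smul_mem_smul (Ideal.mem_span_singleton_self y) trivial)
  rw [Polynomial.aeval_algebraMap_apply] at hP0
  refine hne (Polynomial.aeval c P) ?_ ?_
  · intro hmem
    rw [Polynomial.aeval_eq_sum_range, Finset.sum_range_succ, hP.coeff_natDegree, one_smul] at hmem
    have h2 : ∑ i ∈ Finset.range P.natDegree, P.coeff i • c ^ i ∈ p := by
      refine Ideal.sum_mem _ fun i hi => ?_
      refine Ideal.mul_mem_right _ _ ?_
      have h3 := Ideal.pow_le_self (by have := Finset.mem_range.mp hi; omega) (hcoef i)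
      exact (Ideal.span_singleton_le_iff_mem _).mpr hy h3
    exact hc (hp.mem_of_pow_mem _ ((Ideal.add_mem_iff_right _ h2).mp hmem))
  · ext x
    have := LinearMap.congr_fun hP0 ⟨ε x, x, rfl⟩
    rw [Module.algebraMap_end_apply] at this
    exact congrArg Subtype.val this

lemma exists_class [IsNoetherianRing R] {p : Ideal R} [hp : p.IsPrime] (u : R) (hu : u ∉ p) (h : ℕ) :
    ∀ (N : Type u) [AddCommGroup N] [Module R N] [Module.Finite R N]
      (ε : N →ₗ[R] N) (_ : ∀ x, ε (ε x) = u • ε x) (_ : ∀ r ∉ p, r • ε ≠ 0)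
      (_ : ∀ q : Ideal R, q.IsPrime → Module.annihilator R N ≤ q → q ≤ p → p.height ≤ q.height + h)
      (_ : ∀ j < h, Subsingleton (EE R (R ⧸ p) N j)),
      ∃ e : EE R (R ⧸ p) N h, push (R ⧸ p) h ε e ≠ 0 := by
  induction h with
  | zero =>
    intro N _ _ _ ε hε hne hht _
    have hmin : p ∈ (Module.annihilator R (LinearMap.range ε)).minimalPrimes := by
      refine ⟨⟨hp, ?_⟩, ?_⟩
      · intro r hr
        by_contra hrp
        refine hne r hrp ?_
        ext x
        rw [Module.mem_annihilator] at hr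
        exact congrArg Subtype.val (hr ⟨ε x, x, rfl⟩)
      · rintro q ⟨hq, hle⟩ hqp
        by_contra hpq
        have hlt : q < p := lt_of_le_not_ge hqp hpq
        have h1 := hht q hq ((LinearMap.annihilator_le_of_injective _
          (Submodule.injective_subtype (LinearMap.range ε))).trans hle) hqp
        have h2 := Ideal.height_add_one_le_of_lt_of_isPrime hlt
        have h3 : q.height ≠ ⊤ := (Ideal.height_lt_top_of_isPrime).ne
        simp only [Nat.cast_zero, add_zero] at h1
        exact absurd (h2.trans h1) (not_le.mpr (ENat.lt_add_one_iff h3 |>.mpr le_rfl))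
    have hass := Module.associatedPrimes.minimalPrimes_annihilator_subset_associatedPrimes R _ hmin
    obtain ⟨-, f, hf⟩ := (isAssociatedPrime_iff_exists_injective_linearMap _ _).mp hass
    refine ⟨(zeroEquiv _ _).symm ((LinearMap.range ε).subtype ∘ₗ f), ?_⟩
    rw [push_zeroEquiv]
    intro hc
    have hz : (zeroEquiv (R := R) (R ⧸ p) N).symm 0 = 0 := by
      have h1 := push_zeroEquiv (R := R) (0 : N →ₗ[R] N) (0 : (R ⧸ p) →ₗ[R] N)
      rw [push_zero, LinearMap.zero_comp] at h1
      exact h1.symm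
    rw [← hz] at hc
    have h1 := LinearMap.congr_fun ((zeroEquiv (R := R) (R ⧸ p) N).symm.injective hc) (p.mkQ 1)
    obtain ⟨x, hx⟩ := (f (p.mkQ 1)).2
    simp only [LinearMap.comp_apply, Submodule.subtype_apply, LinearMap.zero_apply] at h1
    rw [← hx, hε, hx] at h1
    have h2 : f (u • p.mkQ 1) = 0 := by
      rw [map_smul]; exact Subtype.ext h1
    rw [← map_smul] at h2
    have h3 := hf (h2.trans (map_zero f).symm)
    rw [Submodule.mkQ_apply, Submodule.Quotient.mk_eq_zero] at h3
    exact hu (by simpa using h3)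
  | succ h ih =>
    intro N _ _ _ ε hε hne hht hE
    have h0 : Subsingleton ((R ⧸ p) →ₗ[R] N) :=
      ⟨fun a b => (sub_zero_iff.mp (hE 0 (by omega)) a).trans (sub_zero_iff.mp (hE 0 (by omega)) b).symm⟩
    obtain ⟨y, hyp, hy⟩ := IsSMulRegular.subsingleton_linearMap_iff.mp h0
    rw [Ideal.annihilator_quotient] at hyp
    let m : N →ₗ[R] N := y • LinearMap.id
    have S : SES m (LinearMap.range m).mkQ := SES.coker (f := m) hy
    have hm : ε ∘ₗ m = m ∘ₗ ε := by ext x; simp [m]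
    let ε' : (N ⧸ LinearMap.range m) →ₗ[R] (N ⧸ LinearMap.range m) :=
      (LinearMap.range m).mapQ (LinearMap.range m) ε (by
        rintro _ ⟨x, rfl⟩
        exact ⟨ε x, (LinearMap.congr_fun hm x).symm⟩)
    have hmk : ∀ x, ε' ((LinearMap.range m).mkQ x) = (LinearMap.range m).mkQ (ε x) := fun x => rfl
    obtain ⟨e, he⟩ := ih (N ⧸ LinearMap.range m) ε' (by
        intro x
        obtain ⟨x, rfl⟩ := Submodule.mkQ_surjective _ x
        rw [hmk, hmk, hε, map_smul]) (by
        intro r hr hc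
        refine nak ε u hu hε hne y hyp r hr fun x => ?_
        have h1 := LinearMap.congr_fun hc ((LinearMap.range m).mkQ x)
        rw [LinearMap.smul_apply, hmk, ← map_smul, LinearMap.zero_apply, Submodule.mkQ_apply,
          Submodule.Quotient.mk_eq_zero] at h1
        obtain ⟨z, hz⟩ := h1
        exact ⟨z, hz.symm⟩) (by
        intro q hq hle hqp
        obtain ⟨q0, hq0, hq0q⟩ := Ideal.exists_minimalPrimes_le
          ((LinearMap.annihilator_le_of_surjective _ (LinearMap.range m).mkQ_surjective).trans hle)
        have hq0p := hq0.1.1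
        have hyq : y ∈ q := by
          apply hle
          rw [Module.mem_annihilator]
          intro x
          obtain ⟨x, rfl⟩ := Submodule.mkQ_surjective _ x
          rw [← map_smul, Submodule.mkQ_apply, Submodule.Quotient.mk_eq_zero]
          exact ⟨x, rfl⟩
        have hyq0 : y ∉ q0 := by
          intro hy0
          have hass := Module.associatedPrimes.minimalPrimes_annihilator_subset_associatedPrimes R _ hq0
          obtain ⟨-, f, hf⟩ := (isAssociatedPrime_iff_exists_injective_linearMap _ _).mp hass
          have h1 : y • f (q0.mkQ 1) = y • (0 : N) := by
            rw [← map_smul, ← map_smul, smul_zero]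
            have : q0.mkQ (y • 1) = 0 := by
              rw [Submodule.mkQ_apply, Submodule.Quotient.mk_eq_zero]; simpa using hy0
            rw [this, map_zero]
          have h2 := hf ((hy h1).trans (map_zero f).symm)
          rw [Submodule.mkQ_apply, Submodule.Quotient.mk_eq_zero] at h2
          exact hq0p.ne_top ((Ideal.eq_top_iff_one _).mpr h2)
        have hlt : q0 < q := lt_of_le_of_ne hq0q (fun hc => hyq0 (hc ▸ hyq))
        have h2 := Ideal.height_add_one_le_of_lt_of_isPrime hlt
        have h3 := hht q0 hq0p hq0.1.2 (hq0q.trans hqp)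
        refine h3.trans ?_
        push_cast
        rw [add_comm (h : ℕ∞) 1, ← add_assoc]
        gcongr) (fun j hj => S.sub₃ (hE j (by omega)) (hE (j+1) (by omega)))
    refine ⟨S.delta _ h e, fun hc => he ?_⟩
    rw [S.delta_nat S ε ε ε' hm.symm (by ext x; rfl)] at hc
    have := hE h (by omega)
    obtain ⟨z, hz⟩ := S.exact₃ _ hc
    rw [← hz, Subsingleton.elim z 0, map_zero]
end
end EE

namespace EE
open Abelian
section
variable {R : Type u} [CommRing R]
variable {M N : Type u}
  [AddCommGroup M] [Module R M] [AddCommGroup N] [Module R N]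

/-- Given a totally reflexive module which is not free at `p`, find a functional with values in `p`
acting nontrivially on `Ext^h(R/p, M)`. -/
lemma exists_functional [IsNoetherianRing R] [Module.Finite R M] (hM : TR R M) {p : Ideal R}
    [hp : p.IsPrime] (hle : stab R M ≤ p) (h : ℕ) (hht : p.height = (h + 1 : ℕ))
    (hE : ∀ j < h + 1, Subsingleton (EE R (R ⧸ p) M j))
    (hER : ∀ j < h + 1, Subsingleton (EE R (R ⧸ p) R j)) :
    ∃ (f : M →ₗ[R] R) (e : EE R (R ⧸ p) M (h+1)), (∀ x, f x ∈ p) ∧ push (R ⧸ p) (h+1) f e ≠ 0 := by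
  obtain ⟨a, π, ι, u, hu, hπι, hf⟩ := exists_split (M := M) p
  let ε : M →ₗ[R] M := u • LinearMap.id - ι ∘ₗ π
  have hπι' : ∀ w, π (ι w) = u • w := fun w => LinearMap.congr_fun hπι w
  have hει : ε ∘ₗ ι = 0 := by
    ext1; ext; simp [ε, hπι']
  obtain ⟨e, he⟩ := exists_class u hu (h+1) M ε (by
      intro x
      simp only [ε, LinearMap.sub_apply, LinearMap.smul_apply, LinearMap.id_apply,
        LinearMap.comp_apply, map_sub, map_smul, hπι', sub_self, sub_zero]) (by
      intro r hr hc
      have hmem : r * u ∈ stab R M := by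
        rw [mem_stab_iff]
        refine ⟨a, π, r • ι, ?_⟩
        ext x
        have h1 := LinearMap.congr_fun hc x
        simp only [ε, LinearMap.sub_apply, LinearMap.smul_apply, LinearMap.id_apply,
          LinearMap.comp_apply, LinearMap.zero_apply, smul_sub, sub_eq_zero] at h1
        simp only [LinearMap.smul_apply, LinearMap.id_apply,
          LinearMap.comp_apply, mul_smul]
        exact h1.symm
      exact (hp.mem_or_mem (hle hmem)).elim hr hu) (by
      intro q _ _ _
      rw [hht]; exact le_add_self) hE
  obtain ⟨s, i, Y1, _, _, q, hfin, hV, S, -⟩ := trEmbed hM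
  have hd : Subsingleton (EE R (R ⧸ p) (Module.Dual R Y1) h) :=
    hom_depth h Y1 hV (fun i hi => hER i (by omega))
  by_contra hcon
  push Not at hcon
  apply he
  have h1 : push (R ⧸ p) (h+1) i (push (R ⧸ p) (h+1) ε e) = 0 := by
    apply pi_ext
    intro j
    rw [← push_comp, ← push_comp]
    apply hcon
    apply hf
    rw [LinearMap.comp_assoc, LinearMap.comp_assoc, hει, LinearMap.comp_zero, LinearMap.comp_zero]
  obtain ⟨z, hz⟩ := S.exact₁ _ h1
  rw [← hz, Subsingleton.elim z 0, map_zero]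

lemma final [IsNoetherianRing R] [Module.Finite R M] (hM : TR R M) {p : Ideal R}
    [hp : p.IsPrime] (hle : stab R M ≤ p) (k : ℕ) (hht : p.height = (k + 2 : ℕ))
    (hE : ∀ j < k + 2, Subsingleton (EE R (R ⧸ p) M j))
    (hER : ∀ (W : Type u) [AddCommGroup W] [Module R W] [Module.Finite R W],
      stab R M ≤ Module.annihilator R W → ∀ j < k + 2, Subsingleton (EE R W R j))
    (hMM : Subsingleton (EE R M M (k+1))) : False := by
  obtain ⟨f, e, hfp, hfe⟩ := exists_functional hM hle (k+1) hht hE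
    (hER _ (by rw [Ideal.annihilator_quotient]; exact hle))
  obtain ⟨tr, htr⟩ := exists_trace (R := R) (M := M)
    (hER _ (by rw [Ideal.annihilator_quotient]) 0 (by omega))
    (fun W _ _ _ hW => hER W hW 1 (by omega))
  let T : M →ₗ[R] (M →ₗ[R] M) := dualTensorHom R M M ∘ₗ TensorProduct.mk R (Module.Dual R M) M f
  have hT : tr ∘ₗ T = f := by
    ext s; exact htr f s
  obtain ⟨s, π, hπ⟩ := Module.Finite.exists_fin' R M
  apply hfe
  rw [← hT, push_comp]
  refine core (stab R M) (k+2) hE k le_rfl M (fun j x r hr => stab_kill hr j x) hMM s π hπ R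
    (fun W _ _ _ hW j hj => hER W hW (j+1) (by omega)) _ ?_ tr
  let E := LinearEquiv.piRing R M (Fin s) R
  have h1 : push (R ⧸ p) (k+2) (E.toLinearMap ∘ₗ LinearMap.lcomp R M π ∘ₗ T) e = 0 := by
    apply pi_ext
    intro j
    rw [← push_comp]
    have h2 : LinearMap.proj j ∘ₗ E.toLinearMap ∘ₗ LinearMap.lcomp R M π ∘ₗ T =
        f (π (Pi.single j 1)) • LinearMap.id := by
      ext x
      simp [E, T, dualTensorHom_apply]
    rw [h2, push_smul_id]
    apply smul_eq_zero_of_ann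
    intro b
    obtain ⟨b, rfl⟩ := Submodule.mkQ_surjective _ b
    rw [← map_smul, Submodule.mkQ_apply, Submodule.Quotient.mk_eq_zero]
    exact Ideal.mul_mem_right _ _ (hfp _)
  rw [← push_comp]
  have h3 : LinearMap.lcomp R M π ∘ₗ T =
      E.symm.toLinearMap ∘ₗ (E.toLinearMap ∘ₗ LinearMap.lcomp R M π ∘ₗ T) := by
    ext; simp
  rw [h3, push_comp, h1, map_zero]
end
end EE

theorem stmt7 (R : Type u) [CommRing R] [IsLocalRing R] [IsNoetherianRing R] (d n : ℕ)
    (hd : 2 ≤ d) (hCM : IsCMLocalOfDim R d) (hn1 : 1 ≤ n) (hn2 : n ≤ d - 1)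
    (M : Type u) [AddCommGroup M] [Module R M] [Module.Finite R M]
    (hMCM : moduleDepth R (ModuleCat.of R M) = d)
    (hG : FiniteGdim R M)
    (hloc : ∀ (p : Ideal R) (hp : p.IsPrime), primeHt R p hp ≤ (n : ℕ∞) →
      FinitePd (Localization.AtPrime p) (LocalizedModule p.primeCompl M))
    (hext : ∀ i : ℕ, n ≤ i → i ≤ d - 1 →
      Subsingleton (ExtMod R (ModuleCat.of R M) (ModuleCat.of R M) i)) :
    Module.Free R M := by
  obtain ⟨e, rfl⟩ : ∃ e, d = e + 1 := ⟨d - 1, by omega⟩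
  have hR := EE.depth_lt (R := R) R (e+1) hCM.2
  have hMd := EE.depth_lt (R := R) M (e+1) hMCM
  obtain ⟨g, hg⟩ := hG
  have hTR : EE.TR R M := EE.mcm_tr e (fun j hj => hR j (by omega))
    (EE.depth_eq (R := R) R (e+1) (by omega) hCM.2) g M hg (fun j hj => hMd j (by omega))
  have hm : (IsLocalRing.maximalIdeal R).height = (e + 1 : ℕ) := by
    have h1 := IsLocalRing.maximalIdeal_height_eq_ringKrullDim (R := R)
    rw [hCM.1] at h1
    exact_mod_cast h1
  by_cases htop : EE.stab R M = ⊤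
  · exact EE.free_of_stab_top htop
  exfalso
  have hprime : ∀ p : Ideal R, p.IsPrime → EE.stab R M ≤ p → (n : ℕ∞) < p.height := by
    intro p hp hle
    by_contra hlt
    refine EE.stab_not_le p hTR.v (hloc p hp ?_) hle
    have : p.height = primeHt R p hp := PrimeSpectrum.height_eq_orderHeight ⟨p, hp⟩
    rw [← this]; exact not_lt.mp hlt
  have hlem : (EE.stab R M).height ≤ (e + 1 : ℕ) := by
    rw [← hm]
    exact Ideal.height_mono (IsLocalRing.le_maximalIdeal htop)
  obtain ⟨h, hh⟩ := ENat.ne_top_iff_exists.mp (ne_top_of_le_ne_top (ENat.natCast_ne_top _) hlem)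
  obtain ⟨p, hp, hle, hpht⟩ := Ideal.exists_isPrime_height_eq hh.symm
  have hnh := hprime p hp hle
  rw [hpht] at hnh
  rw [← hh] at hlem
  have hnh' : n < h := by exact_mod_cast hnh
  have hhe : h ≤ e + 1 := by exact_mod_cast hlem
  obtain ⟨k, rfl⟩ : ∃ k, h = k + 2 := ⟨h - 2, by omega⟩
  have hlt : ∀ j < k + 2, (j : ℕ∞) < (EE.stab R M).height := by
    intro j hj
    rw [← hh]; exact_mod_cast hj
  refine EE.final hTR hle k hpht (fun j hj => ?_) (fun W _ _ _ hW j hj => ?_)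
    (EE.bridge M M (k+1) (hext (k+1) (by omega) (by omega)))
  · exact EE.depth_of_ann (e+1) hm.le hMd (EE.stab R M)
      (by rw [Ideal.annihilator_quotient]; exact hle) j (hlt j hj)
  · exact EE.depth_of_ann (e+1) hm.le hR (EE.stab R M) hW j (hlt j hj)
end
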